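/- Let r ≥ 1, n ≥ 2, let V = ℂ^{r+1}, and let S_n act on V^{⊗n} ⊗ R_n diagonally, permuting the tensor factors of V^{⊗n} and acting on R_n as above. Then dim_ℂ (V^{⊗n} ⊗ R_n)^{S_n} = (r+1)^{n−2}·((r+1)² + (n−1)(r+1)r/2). -/

import Mathlib

open MvPolynomial

set_option maxHeartbeats 1000000
set_option synthInstance.maxHeartbeats 400000

noncomputable section

/-- the ideal `(x₁y₁, …, xₙyₙ)`. -/
abbrev Bideal (n : ℕ) : Ideal (MvPolynomial (Fin n ⊕ Fin n) ℂ) :=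
  Ideal.span (Set.range fun i : Fin n => X (Sum.inl i) * X (Sum.inr i))

/-- `B n = ℂ[x₁,…,xₙ,y₁,…,yₙ]/(x₁y₁,…,xₙyₙ)`, the `n`-th tensor power of `ℂ[x,y]/(xy)`.
The variable `x_i` is `X (Sum.inl i)` and `y_i` is `X (Sum.inr i)`. -/
abbrev B (n : ℕ) : Type := MvPolynomial (Fin n ⊕ Fin n) ℂ ⧸ Bideal n

abbrev mkB (n : ℕ) : MvPolynomial (Fin n ⊕ Fin n) ℂ →ₐ[ℂ] B n :=
  Ideal.Quotient.mkₐ ℂ (Bideal n)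

def xv (n : ℕ) (i : Fin n) : B n := mkB n (X (Sum.inl i))
def yv (n : ℕ) (i : Fin n) : B n := mkB n (X (Sum.inr i))

/-- the action of a permutation `σ ∈ Sₙ` on `B n`: `σ·xᵢ = x_{σ i}`, `σ·yᵢ = y_{σ i}`. -/
def permB (n : ℕ) (σ : Equiv.Perm (Fin n)) : B n →ₐ[ℂ] B n :=
  Ideal.Quotient.liftₐ (Bideal n)
    ((mkB n).comp (MvPolynomial.rename (Sum.map ⇑σ ⇑σ)))
    (by
      intro a ha
      have h : Bideal n ≤ RingHom.ker ((mkB n).comp (MvPolynomial.rename (Sum.map ⇑σ ⇑σ))).toRingHom := by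
        rw [Ideal.span_le]
        rintro _ ⟨i, rfl⟩
        simp only [SetLike.mem_coe, RingHom.mem_ker, AlgHom.toRingHom_eq_coe, RingHom.coe_coe,
          AlgHom.comp_apply, map_mul, rename_X, Sum.map_inl, Sum.map_inr]
        rw [← map_mul, Ideal.Quotient.mkₐ_eq_mk, Ideal.Quotient.eq_zero_iff_mem]
        exact Ideal.subset_span ⟨σ i, rfl⟩
      exact h ha)

/-- evaluation at the origin. -/
def ev0 (n : ℕ) : B n →ₐ[ℂ] ℂ :=
  Ideal.Quotient.liftₐ (Bideal n) (aeval fun _ => (0 : ℂ))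
    (by
      intro a ha
      have h : Bideal n ≤ RingHom.ker (aeval (R := ℂ) fun _ : Fin n ⊕ Fin n => (0 : ℂ)).toRingHom := by
        rw [Ideal.span_le]
        rintro _ ⟨i, rfl⟩
        simp [RingHom.mem_ker]
      exact h ha)

/-- `Jₙ`, the ideal of `B n` generated by the `Sₙ`-invariant elements vanishing at the origin. -/
def Jn (n : ℕ) : Ideal (B n) :=
  Ideal.span {p : B n | (∀ σ : Equiv.Perm (Fin n), permB n σ p = p) ∧ ev0 n p = 0}

/-- the symmetric coinvariant algebra `Rₙ = Bₙ/Jₙ`. -/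
abbrev Rn (n : ℕ) : Type := B n ⧸ Jn n

/-- the action of `σ ∈ Sₙ` on the symmetric coinvariant algebra `Rₙ`. -/
def permR (n : ℕ) (σ : Equiv.Perm (Fin n)) : Rn n →ₐ[ℂ] Rn n :=
  Ideal.Quotient.liftₐ (Jn n) ((Ideal.Quotient.mkₐ ℂ (Jn n)).comp (permB n σ))
    (by
      intro a ha
      have h : Jn n ≤ RingHom.ker ((Ideal.Quotient.mkₐ ℂ (Jn n)).comp (permB n σ)).toRingHom := by
        rw [Jn, Ideal.span_le]
        rintro p ⟨hinv, hev⟩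
        simp only [SetLike.mem_coe, RingHom.mem_ker, AlgHom.toRingHom_eq_coe, RingHom.coe_coe,
          AlgHom.comp_apply, hinv σ, Ideal.Quotient.mkₐ_eq_mk, Ideal.Quotient.eq_zero_iff_mem]
        exact Ideal.subset_span ⟨hinv, hev⟩
      exact h ha)

/-- the action of a matrix `X ∈ sl_{r+1}` on `V^{⊗n} ⊗ M`, where `V = ℂ^{r+1}` and
`V^{⊗n} ⊗ M` is realized as `M`-valued functions on the index set of the standard
basis of `V^{⊗n}` (so `X` acts by the Leibniz rule on the `n` tensor factors). -/
def slAct (r n : ℕ) (M : Type) [AddCommGroup M] [Module ℂ M]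
    (X : Matrix (Fin (r + 1)) (Fin (r + 1)) ℂ) :
    ((Fin n → Fin (r + 1)) → M) →ₗ[ℂ] ((Fin n → Fin (r + 1)) → M) where
  toFun F := fun φ => ∑ k : Fin n, ∑ j : Fin (r + 1), X (φ k) j • F (Function.update φ k j)
  map_add' F G := by
    funext φ
    simp only [Pi.add_apply, smul_add]
    rw [← Finset.sum_add_distrib]
    refine Finset.sum_congr rfl fun k _ => ?_
    rw [← Finset.sum_add_distrib]
  map_smul' c F := by
    funext φ
    simp only [Pi.smul_apply, RingHom.id_apply, Finset.smul_sum]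
    refine Finset.sum_congr rfl fun k _ => ?_
    refine Finset.sum_congr rfl fun j _ => ?_
    rw [smul_comm]

/-- `(V^{⊗n} ⊗ Rₙ)^{Sₙ}`: the submodule of `Sₙ`-invariants of `V^{⊗n} ⊗ Rₙ`, where `Sₙ`
acts diagonally, permuting the tensor factors of `V^{⊗n}` and acting on `Rₙ` via `permR`. -/
def InvSub (r n : ℕ) : Submodule ℂ ((Fin n → Fin (r + 1)) → Rn n) where
  carrier := {F | ∀ (σ : Equiv.Perm (Fin n)) (φ : Fin n → Fin (r + 1)),
    permR n σ (F (φ ∘ ⇑σ)) = F φ}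
  zero_mem' := by intro σ φ; simp
  add_mem' := by
    intro F G hF hG σ φ
    simp only [Pi.add_apply, map_add, hF σ φ, hG σ φ]
  smul_mem' := by
    intro c F hF σ φ
    simp only [Pi.smul_apply, map_smul, hF σ φ]

/-- the transposition of the last two letters. -/
def swapLast (n : ℕ) : Equiv.Perm (Fin n) :=
  if h : 2 ≤ n then Equiv.swap ⟨n - 2, by omega⟩ ⟨n - 1, by omega⟩ else 1

/-- `V^{⊗(n-2)} ⊗ ∧²V`, realized as the subspace of `V^{⊗n}` of tensors antisymmetric
in the last two tensor factors. -/
def AltLast (r n : ℕ) : Submodule ℂ ((Fin n → Fin (r + 1)) → ℂ) where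
  carrier := {F | ∀ φ, F (φ ∘ ⇑(swapLast n)) = - F φ}
  zero_mem' := by intro φ; simp
  add_mem' := by
    intro F G hF hG φ
    simp only [Pi.add_apply, hF φ, hG φ]
    ring
  smul_mem' := by
    intro c F hF φ
    simp only [Pi.smul_apply, hF φ, smul_eq_mul]
    ring

/-- The polynomial ring `ℂ[x₁,…,xₙ,y₁,…,yₙ]`. -/
abbrev PXY (n : ℕ) : Type := MvPolynomial (Fin n ⊕ Fin n) ℂ

/-- The quotient map from the polynomial ring onto the coinvariant algebra. -/
def kap (n : ℕ) : PXY n →ₐ[ℂ] Rn n := (Ideal.Quotient.mkₐ ℂ (Jn n)).comp (mkB n)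

/-- The action of a permutation on polynomials. -/
def pact {n : ℕ} (σ : Equiv.Perm (Fin n)) : PXY n →ₐ[ℂ] PXY n := rename (Sum.map ⇑σ ⇑σ)

section Interface

variable {n : ℕ}

lemma kap_surjective : Function.Surjective (kap n) := by
  intro y
  obtain ⟨b, rfl⟩ := Ideal.Quotient.mk_surjective y
  obtain ⟨f, rfl⟩ := Ideal.Quotient.mk_surjective b
  exact ⟨f, rfl⟩

lemma kap_mul_eq_zero {f : PXY n} (hf : kap n f = 0) (g : PXY n) : kap n (f * g) = 0 := by
  rw [map_mul, hf]
  exact zero_mul (M₀ := Rn n) _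

lemma permB_mk (σ : Equiv.Perm (Fin n)) (f : PXY n) : permB n σ (mkB n f) = mkB n (pact σ f) := rfl

lemma permR_kap (σ : Equiv.Perm (Fin n)) (f : PXY n) : permR n σ (kap n f) = kap n (pact σ f) := rfl

lemma kap_xy (i : Fin n) : kap n (X (Sum.inl i) * X (Sum.inr i)) = 0 := by
  have : mkB n (X (Sum.inl i) * X (Sum.inr i)) = 0 := by
    rw [Ideal.Quotient.mkₐ_eq_mk, Ideal.Quotient.eq_zero_iff_mem]
    exact Ideal.subset_span ⟨i, rfl⟩
  rw [kap, AlgHom.comp_apply, this, map_zero]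

lemma ev0_mk (f : PXY n) : ev0 n (mkB n f) = constantCoeff f := by
  change aeval (fun _ => (0 : ℂ)) f = _
  rw [show (fun _ : Fin n ⊕ Fin n => (0 : ℂ)) = 0 from rfl, aeval_zero]; rfl

lemma kap_eq_zero_of_invariant (f : PXY n) (h : ∀ σ, pact σ f = f) (h0 : constantCoeff f = 0) :
    kap n f = 0 := by
  rw [kap, AlgHom.comp_apply, Ideal.Quotient.mkₐ_eq_mk, Ideal.Quotient.eq_zero_iff_mem]
  refine Ideal.subset_span ⟨fun σ => ?_, ?_⟩
  · rw [permB_mk, h]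
  · rw [ev0_mk, h0]

lemma pact_mul (σ τ : Equiv.Perm (Fin n)) (f : PXY n) : pact (σ * τ) f = pact σ (pact τ f) := by
  simp only [pact, rename_rename]
  refine congrArg (fun w => rename w f) ?_
  funext x
  cases x <;> simp

lemma sum_map_injective (σ : Equiv.Perm (Fin n)) : Function.Injective (Sum.map ⇑σ ⇑σ) :=
  Sum.map_injective.2 ⟨σ.injective, σ.injective⟩

/-- The alternation operator. -/
def altn (n : ℕ) : PXY n →ₗ[ℂ] PXY n :=
  ∑ σ : Equiv.Perm (Fin n), (((Equiv.Perm.sign σ : ℤˣ) : ℤ) : ℂ) • (pact σ).toLinearMap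

lemma altn_apply (f : PXY n) :
    altn n f = ∑ σ : Equiv.Perm (Fin n), (((Equiv.Perm.sign σ : ℤˣ) : ℤ) : ℂ) • pact σ f := by
  simp [altn]

lemma pact_altn (τ : Equiv.Perm (Fin n)) (f : PXY n) :
    pact τ (altn n f) = (((Equiv.Perm.sign τ : ℤˣ) : ℤ) : ℂ) • altn n f := by
  rw [altn_apply, map_sum, Finset.smul_sum]
  refine Fintype.sum_equiv (Equiv.mulLeft τ) _ _ fun σ => ?_
  rw [map_smul, Equiv.coe_mulLeft, pact_mul, smul_smul]
  congr 1
  rw [Equiv.Perm.sign_mul]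
  push_cast
  rw [← mul_assoc, ← Int.cast_mul, ← Units.val_mul, Int.units_mul_self]
  simp

lemma coeff_altn_eq_zero (f : PXY n) (v : Fin n ⊕ Fin n →₀ ℕ) {i j : Fin n} (hij : i ≠ j)
    (h1 : v (Sum.inl i) = v (Sum.inl j)) (h2 : v (Sum.inr i) = v (Sum.inr j)) :
    coeff v (altn n f) = 0 := by
  have hv : Finsupp.mapDomain (Sum.map ⇑(Equiv.swap i j) ⇑(Equiv.swap i j)) v = v := by
    have key : ∀ x, v (Sum.map ⇑(Equiv.swap i j) ⇑(Equiv.swap i j) x) = v x := by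
      rintro (x | x) <;> simp only [Sum.map_inl, Sum.map_inr] <;>
      · rcases eq_or_ne x i with rfl | hi
        · simp [h1, h2]
        · rcases eq_or_ne x j with rfl | hj
          · simp [h1, h2]
          · rw [Equiv.swap_apply_of_ne_of_ne hi hj]
    ext x
    have hx : x = Sum.map ⇑(Equiv.swap i j) ⇑(Equiv.swap i j)
        (Sum.map ⇑(Equiv.swap i j) ⇑(Equiv.swap i j) x) := by
      cases x <;> simp
    rw [hx, Finsupp.mapDomain_apply (sum_map_injective _), key, ← hx]
  have h := pact_altn (Equiv.swap i j) f
  have h3 := congrArg (coeff v) h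
  rw [Equiv.Perm.sign_swap hij] at h3
  nth_rewrite 1 [← hv] at h3
  rw [pact, coeff_rename_mapDomain _ (sum_map_injective _)] at h3
  simp only [Units.val_neg, Units.val_one, Int.cast_neg, Int.cast_one, neg_smul, one_smul,
    coeff_neg] at h3
  linear_combination (1 / 2 : ℂ) * h3

/-- The staircase exponent with `p` slots of type `x`. -/
def wexp (n p : ℕ) : Fin n ⊕ Fin n →₀ ℕ :=
  Finsupp.equivFunOnFinite.symm (Sum.elim (fun s => if (s : ℕ) < p then (s : ℕ) + 1 else 0)
    (fun s => if (s : ℕ) < p then 0 else (s : ℕ) - p))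

lemma wexp_inl (p : ℕ) (s : Fin n) :
    wexp n p (Sum.inl s) = if (s : ℕ) < p then (s : ℕ) + 1 else 0 := rfl

lemma wexp_inr (p : ℕ) (s : Fin n) :
    wexp n p (Sum.inr s) = if (s : ℕ) < p then 0 else (s : ℕ) - p := rfl

lemma eq_wexp_of_le {p : ℕ} (hp : p < n) (v : Fin n ⊕ Fin n →₀ ℕ) (hv : v ≤ wexp n p)
    (hd : ∀ i j : Fin n, v (Sum.inl i) = v (Sum.inl j) → v (Sum.inr i) = v (Sum.inr j) → i = j) :
    v = wexp n p := by
  have hl : ∀ s : Fin n, v (Sum.inl s) ≤ if (s : ℕ) < p then (s : ℕ) + 1 else 0 :=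
    fun s => hv (Sum.inl s)
  have hr : ∀ s : Fin n, v (Sum.inr s) ≤ if (s : ℕ) < p then 0 else (s : ℕ) - p :=
    fun s => hv (Sum.inr s)
  have hlz : ∀ s : Fin n, p ≤ (s : ℕ) → v (Sum.inl s) = 0 := fun s hs => by
    have := hl s; rw [if_neg (by omega)] at this; omega
  have hrz : ∀ s : Fin n, (s : ℕ) < p → v (Sum.inr s) = 0 := fun s hs => by
    have := hr s; rw [if_pos hs] at this; omega
  have hY : ∀ k : ℕ, ∀ s : Fin n, (s : ℕ) = p + k → v (Sum.inr s) = k := by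
    intro k
    induction k using Nat.strong_induction_on with
    | _ k ih =>
      intro s hs
      have h1 := hr s
      rw [if_neg (by omega)] at h1
      by_contra hne
      have hlt : v (Sum.inr s) < k := by omega
      have h2 := ih _ hlt ⟨p + v (Sum.inr s), by omega⟩ rfl
      have h3 := hd ⟨p + v (Sum.inr s), by omega⟩ s
        (by rw [hlz s (by omega), hlz _ (by simp)]) h2
      have := congrArg Fin.val h3
      simp only at this
      omega
  have hX : ∀ k : ℕ, ∀ s : Fin n, (s : ℕ) = k → k < p → v (Sum.inl s) = k + 1 := by
    intro k
    induction k using Nat.strong_induction_on with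
    | _ k ih =>
      intro s hs hk
      have h1 := hl s
      rw [if_pos (by omega)] at h1
      by_contra hne
      rcases Nat.eq_zero_or_pos (v (Sum.inl s)) with h0 | h0
      · have h3 := hd ⟨p, hp⟩ s (by rw [hlz _ (by simp), h0])
          (by rw [hY 0 _ rfl, hrz s (by omega)])
        have := congrArg Fin.val h3
        simp only at this
        omega
      · have h2 := ih (v (Sum.inl s) - 1) (by omega) ⟨v (Sum.inl s) - 1, by omega⟩ rfl (by omega)
        have h3 := hd ⟨v (Sum.inl s) - 1, by omega⟩ s (by rw [h2]; omega)
          (by rw [hrz s (by omega), hrz _ (by simp; omega)])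
        have := congrArg Fin.val h3
        simp only at this
        omega
  ext x
  rcases x with s | s
  · rw [wexp_inl]
    split_ifs with h
    · exact hX s s rfl h
    · exact hlz s (by omega)
  · rw [wexp_inr]
    split_ifs with h
    · exact hrz s h
    · exact hY _ s (by omega)

/-- The functional extracting the staircase coefficient of the alternation. -/
def dlt (n p : ℕ) : PXY n →ₗ[ℂ] ℂ := (lcoeff ℂ (wexp n p)).comp (altn n)

lemma dlt_apply (p : ℕ) (f : PXY n) : dlt n p f = coeff (wexp n p) (altn n f) := rfl

lemma pact_mem_Bideal (σ : Equiv.Perm (Fin n)) {f : PXY n} (hf : f ∈ Bideal n) :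
    pact σ f ∈ Bideal n := by
  have : Bideal n ≤ (Bideal n).comap (pact σ) := by
    rw [Ideal.span_le]
    rintro _ ⟨i, rfl⟩
    simp only [SetLike.mem_coe, Ideal.mem_comap, map_mul, pact, rename_X, Sum.map_inl, Sum.map_inr]
    exact Ideal.subset_span ⟨σ i, rfl⟩
  exact this hf

lemma coeff_eq_zero_of_mem_Bideal {f : PXY n} (hf : f ∈ Bideal n) (w : Fin n ⊕ Fin n →₀ ℕ)
    (hw : ∀ i, w (Sum.inl i) = 0 ∨ w (Sum.inr i) = 0) : coeff w f = 0 := by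
  obtain ⟨c, rfl⟩ := Ideal.mem_span_range_iff_exists_fun.1 hf
  rw [coeff_sum]
  refine Finset.sum_eq_zero fun i _ => ?_
  rw [← mul_assoc, coeff_mul_X']
  split_ifs with h
  · rw [coeff_mul_X', if_neg]
    have h1 : w (Sum.inl i) = 0 := by
      have := hw i
      rw [Finsupp.mem_support_iff] at h
      tauto
    simp [h1]
  · rfl

lemma wexp_column (p : ℕ) (i : Fin n) :
    wexp n p (Sum.inl i) = 0 ∨ wexp n p (Sum.inr i) = 0 := by
  rw [wexp_inl, wexp_inr]
  split_ifs <;> simp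

lemma altn_mem_Bideal {f : PXY n} (hf : f ∈ Bideal n) : altn n f ∈ Bideal n := by
  rw [altn_apply]
  refine Ideal.sum_mem _ fun σ _ => ?_
  rw [smul_eq_C_mul]
  exact Ideal.mul_mem_left _ _ (pact_mem_Bideal σ hf)

lemma dlt_eq_zero_of_kap {p : ℕ} (hp : p < n) {f : PXY n} (hf : kap n f = 0) : dlt n p f = 0 := by
  let N : Ideal (PXY n) :=
    { carrier := {f | ∀ h, dlt n p (f * h) = 0}
      zero_mem' := fun h => by simp
      add_mem' := fun {a b} ha hb h => by rw [add_mul, map_add, ha, hb, add_zero]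
      smul_mem' := fun c x hx h => by
        rw [smul_eq_mul, mul_comm c x, mul_assoc]
        exact hx _ }
  have hB : ∀ g ∈ Bideal n, coeff (wexp n p) g = 0 := fun g hg =>
    coeff_eq_zero_of_mem_Bideal hg _ (wexp_column p)
  have h1 : Bideal n ≤ N := fun g hg h => by
    rw [dlt_apply]
    exact hB _ (altn_mem_Bideal (Ideal.mul_mem_right _ _ hg))
  have h2 : Jn n ≤ N.map (mkB n) := by
    rw [Jn, Ideal.span_le]
    rintro b ⟨hinv, hev⟩
    obtain ⟨g, rfl⟩ := Ideal.Quotient.mk_surjective b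
    refine Ideal.mem_map_of_mem (mkB n) (fun h => ?_)
    change ∀ σ, permB n σ (mkB n g) = mkB n g at hinv
    change ev0 n (mkB n g) = 0 at hev
    rw [ev0_mk] at hev
    have h3 : altn n (g * h) - g * altn n h ∈ Bideal n := by
      rw [altn_apply, altn_apply, Finset.mul_sum, ← Finset.sum_sub_distrib]
      refine Ideal.sum_mem _ fun σ _ => ?_
      rw [map_mul, mul_smul_comm, ← smul_sub, ← sub_mul, smul_eq_C_mul]
      refine Ideal.mul_mem_left _ _ (Ideal.mul_mem_right _ _ ?_)
      exact Ideal.Quotient.eq.1 (hinv σ)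
    have h4 := hB _ h3
    rw [coeff_sub, sub_eq_zero] at h4
    rw [dlt_apply, h4, coeff_mul]
    refine Finset.sum_eq_zero fun x hx => ?_
    rw [Finset.HasAntidiagonal.mem_antidiagonal] at hx
    by_cases hd : ∀ i j : Fin n, x.2 (Sum.inl i) = x.2 (Sum.inl j) →
        x.2 (Sum.inr i) = x.2 (Sum.inr j) → i = j
    · have h5 : x.2 = wexp n p := eq_wexp_of_le hp _ (by rw [← hx]; exact le_add_self) hd
      have h6 : x.1 = 0 := by
        rw [h5] at hx
        exact add_eq_right.1 hx
      rw [h6, ← constantCoeff_eq, hev, zero_mul]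
    · push Not at hd
      obtain ⟨i, j, h5, h6, h7⟩ := hd
      rw [coeff_altn_eq_zero _ _ h7 h5 h6, mul_zero]
  have h3 : f ∈ (N.map (mkB n)).comap (mkB n) := by
    rw [Ideal.mem_comap]
    exact h2 (Ideal.Quotient.eq_zero_iff_mem.1 hf)
  rw [Ideal.comap_map_of_surjective (mkB n) Ideal.Quotient.mk_surjective] at h3
  have h4 : f ∈ N := by
    refine (sup_le le_rfl ?_ : N ⊔ _ ≤ N) h3
    refine le_trans ?_ h1
    intro g hg
    exact Ideal.Quotient.eq_zero_iff_mem.1 hg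
  simpa using h4 1

lemma dlt_monomial (p : ℕ) (s : Fin n ⊕ Fin n →₀ ℕ) :
    dlt n p (monomial s 1) = ∑ σ : Equiv.Perm (Fin n), (((Equiv.Perm.sign σ : ℤˣ) : ℤ) : ℂ) *
      if Finsupp.mapDomain (Sum.map ⇑σ ⇑σ) s = wexp n p then 1 else 0 := by
  rw [dlt_apply, altn_apply, coeff_sum]
  refine Finset.sum_congr rfl fun σ _ => ?_
  rw [coeff_smul, pact, rename_monomial, coeff_monomial, smul_eq_mul]

lemma exists_of_dlt_monomial_ne_zero {p : ℕ} {s : Fin n ⊕ Fin n →₀ ℕ}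
    (h : dlt n p (monomial s 1) ≠ 0) :
    ∃ σ : Equiv.Perm (Fin n), (∀ i, s (Sum.inl i) = wexp n p (Sum.inl (σ i))) ∧
      (∀ i, s (Sum.inr i) = wexp n p (Sum.inr (σ i))) := by
  rw [dlt_monomial] at h
  obtain ⟨σ, _, hσ⟩ := Finset.exists_ne_zero_of_sum_ne_zero h
  have h1 : Finsupp.mapDomain (Sum.map ⇑σ ⇑σ) s = wexp n p := by
    by_contra h1
    rw [if_neg h1, mul_zero] at hσ
    exact hσ rfl
  refine ⟨σ, fun i => ?_, fun i => ?_⟩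
  · rw [← h1]
    exact (Finsupp.mapDomain_apply (sum_map_injective σ) s (Sum.inl i)).symm
  · rw [← h1]
    exact (Finsupp.mapDomain_apply (sum_map_injective σ) s (Sum.inr i)).symm

lemma dlt_monomial_ne_zero {p : ℕ} {s : Fin n ⊕ Fin n →₀ ℕ}
    (σ : Equiv.Perm (Fin n)) (h1 : ∀ i, s (Sum.inl i) = wexp n p (Sum.inl (σ i)))
    (h2 : ∀ i, s (Sum.inr i) = wexp n p (Sum.inr (σ i))) :
    dlt n p (monomial s 1) ≠ 0 := by
  have hm : ∀ τ : Equiv.Perm (Fin n),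
      Finsupp.mapDomain (Sum.map ⇑τ ⇑τ) s = wexp n p ↔ τ = σ := by
    intro τ
    constructor
    · intro h
      have h3 : ∀ i, s (Sum.inl i) = wexp n p (Sum.inl (τ i)) := fun i => by
        rw [← h]
        exact (Finsupp.mapDomain_apply (sum_map_injective τ) s (Sum.inl i)).symm
      have h4 : ∀ i, s (Sum.inr i) = wexp n p (Sum.inr (τ i)) := fun i => by
        rw [← h]
        exact (Finsupp.mapDomain_apply (sum_map_injective τ) s (Sum.inr i)).symm
      ext i
      have h5 := (h1 i).symm.trans (h3 i)
      have h6 := (h2 i).symm.trans (h4 i)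
      rw [wexp_inl, wexp_inl] at h5
      rw [wexp_inr, wexp_inr] at h6
      split_ifs at h5 h6 <;> omega
    · rintro rfl
      ext x
      rcases x with i | i
      · have := h1 (τ.symm i)
        rw [Equiv.apply_symm_apply] at this
        rw [← this, ← Finsupp.mapDomain_apply (sum_map_injective τ) s (Sum.inl (τ.symm i))]
        simp
      · have := h2 (τ.symm i)
        rw [Equiv.apply_symm_apply] at this
        rw [← this, ← Finsupp.mapDomain_apply (sum_map_injective τ) s (Sum.inr (τ.symm i))]
        simp
  rw [dlt_monomial, Finset.sum_eq_single σ]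
  · rw [if_pos ((hm σ).2 rfl), mul_one]
    simp
  · intro τ _ hτ
    rw [if_neg (fun h => hτ ((hm τ).1 h)), mul_zero]
  · simp

/-- The squarefree monomial `∏_{i ∈ I} x_i`. -/
def xmon (I : Finset (Fin n)) : PXY n := ∏ i ∈ I, X (Sum.inl i)

lemma pact_xmon (σ : Equiv.Perm (Fin n)) (I : Finset (Fin n)) :
    pact σ (xmon I) = xmon (I.map σ.toEmbedding) := by
  simp [xmon, pact, map_prod, Finset.prod_map]

lemma dlt_xmon_mul {p : ℕ} {J : Finset (Fin n)} (hJ : p < J.card) (g : PXY n) :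
    dlt n p (xmon J * g) = 0 := by
  rw [dlt_apply, altn_apply, coeff_sum]
  refine Finset.sum_eq_zero fun σ _ => ?_
  rw [coeff_smul, map_mul, pact_xmon]
  have : ∃ i ∈ J.map σ.toEmbedding, p ≤ (i : ℕ) := by
    by_contra! hc
    have h1 : ((J.map σ.toEmbedding).map Fin.valEmbedding) ⊆ Finset.range p := by
      intro k hk
      rw [Finset.mem_map] at hk
      obtain ⟨i, hi, rfl⟩ := hk
      exact Finset.mem_range.2 (hc i hi)
    have := Finset.card_le_card h1
    simp at this
    omega
  obtain ⟨i, hi, hip⟩ := this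
  have : coeff (wexp n p) (xmon (J.map σ.toEmbedding) * pact σ g) = 0 := by
    rw [xmon, ← Finset.mul_prod_erase _ _ hi, mul_assoc, mul_comm, coeff_mul_X', if_neg]
    rw [Finsupp.notMem_support_iff, wexp_inl, if_neg (by omega)]
  rw [this, smul_zero]

end Interface

section Combinatorics

variable {n : ℕ}

/-- The rank of a slot inside its block: from the left inside `I`, from the right outside `I`. -/
def rk (I : Finset (Fin n)) (l : Fin n) : ℕ :=
  if l ∈ I then (I.filter (· < l)).card else (Iᶜ.filter (l < ·)).card

/-- The exponents of Artin monomials for the block decomposition `I ⊔ Iᶜ`. -/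
def Art (I : Finset (Fin n)) : Finset (Fin n → ℕ) :=
  Fintype.piFinset fun l => Finset.range (rk I l + 1)

lemma mem_Art {I : Finset (Fin n)} {a : Fin n → ℕ} : a ∈ Art I ↔ ∀ l, a l ≤ rk I l := by
  simp [Art, Fintype.mem_piFinset]

lemma prod_rank_succ {α : Type*} [DecidableEq α] (f : α → ℤ) (s : Finset α)
    (hf : Set.InjOn f s) :
    ∏ l ∈ s, ((s.filter (fun l' => f l' < f l)).card + 1) = s.card.factorial := by
  induction s using Finset.induction_on_max_value f with
  | empty => simp
  | insert m s hm hmax ih =>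
    have hlt : ∀ x ∈ s, f x < f m := fun x hx => lt_of_le_of_ne (hmax x hx) fun h => by
      have := hf (Finset.mem_coe.2 (Finset.mem_insert_of_mem hx))
        (Finset.mem_coe.2 (Finset.mem_insert_self m s)) h
      exact hm (this ▸ hx)
    rw [Finset.prod_insert hm, Finset.card_insert_of_notMem hm, Nat.factorial_succ,
      ← ih (hf.mono (by simp))]
    congr 1
    · congr 2
      ext x
      simp only [Finset.mem_filter, Finset.mem_insert]
      constructor
      · rintro ⟨rfl | h, h2⟩
        · exact absurd h2 (lt_irrefl _)
        · exact h
      · exact fun h => ⟨Or.inr h, hlt x h⟩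
    · refine Finset.prod_congr rfl fun l hl => ?_
      congr 2
      ext x
      simp only [Finset.mem_filter, Finset.mem_insert]
      constructor
      · rintro ⟨rfl | h, h2⟩
        · exact absurd h2 (not_lt.2 (hmax l hl))
        · exact ⟨h, h2⟩
      · exact fun h => ⟨Or.inr h.1, h.2⟩

lemma card_Art (I : Finset (Fin n)) :
    (Art I).card = I.card.factorial * (n - I.card).factorial := by
  rw [Art, Fintype.card_piFinset]
  simp only [Finset.card_range]
  rw [← Finset.prod_mul_prod_compl I]
  congr 1
  · rw [← prod_rank_succ (fun l : Fin n => ((l : ℕ) : ℤ)) I (fun a _ b _ h => by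
      simpa [Fin.ext_iff] using h)]
    refine Finset.prod_congr rfl fun l hl => ?_
    simp [rk, hl]
  · have hc : Iᶜ.card = n - I.card := by rw [Finset.card_compl, Fintype.card_fin]
    rw [← hc, ← prod_rank_succ (fun l : Fin n => -((l : ℕ) : ℤ)) Iᶜ (fun a _ b _ h => by
      simpa [Fin.ext_iff] using h)]
    refine Finset.prod_congr rfl fun l hl => ?_
    rw [Finset.mem_compl] at hl
    simp [rk, hl]

/-- Indices: a block of `x`-slots together with an exponent vector. -/
abbrev Idx (n : ℕ) : Type := (_ : Finset (Fin n)) × (Fin n → ℕ)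

/-- Artin indices with `p` slots of type `x`. -/
def ArtF (n p : ℕ) : Finset (Idx n) := (Finset.powersetCard p Finset.univ).sigma Art

lemma mem_ArtF {p : ℕ} {x : Idx n} : x ∈ ArtF n p ↔ x.1.card = p ∧ ∀ l, x.2 l ≤ rk x.1 l := by
  simp [ArtF, mem_Art, Finset.mem_powersetCard]

lemma card_ArtF {p : ℕ} (hp : p ≤ n) : (ArtF n p).card = n.factorial := by
  rw [ArtF, Finset.card_sigma, Finset.sum_congr rfl (g := fun _ => p.factorial * (n - p).factorial)]
  · rw [Finset.sum_const, Finset.card_powersetCard, Finset.card_univ, Fintype.card_fin, smul_eq_mul,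
      ← mul_assoc, Nat.choose_mul_factorial_mul_factorial hp]
  · intro I hI
    rw [card_Art, (Finset.mem_powersetCard.1 hI).2]

/-- All zeros of the exponent inside the block precede all zeros outside the block. -/
def Good (x : Idx n) : Prop := ∀ i ∈ x.1, ∀ j ∉ x.1, x.2 i = 0 → x.2 j = 0 → i < j

instance : DecidablePred (Good (n := n)) := Classical.decPred _

/-- The good Artin indices with `p` slots of type `x`. -/
def AA (n p : ℕ) : Finset (Idx n) := (ArtF n p).filter Good

lemma mem_AA {p : ℕ} {x : Idx n} :
    x ∈ AA n p ↔ x.1.card = p ∧ (∀ l, x.2 l ≤ rk x.1 l) ∧ Good x := by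
  rw [AA, Finset.mem_filter, mem_ArtF, and_assoc]

lemma card_AA_zero : (AA n 0).card = n.factorial := by
  rw [← card_ArtF (Nat.zero_le n), AA, Finset.filter_true_of_mem]
  intro x hx i hi
  rw [mem_ArtF, Finset.card_eq_zero] at hx
  simp [hx.1] at hi

/-- `i` is the last zero inside the block, `j` the first zero outside, and `j < i`. -/
def BadAt (x : Idx n) (i j : Fin n) : Prop :=
  i ∈ x.1 ∧ j ∉ x.1 ∧ x.2 i = 0 ∧ x.2 j = 0 ∧ j < i ∧
    (∀ l ∈ x.1, i < l → x.2 l ≠ 0) ∧ (∀ l ∉ x.1, l < j → x.2 l ≠ 0)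

lemma exists_badAt {x : Idx n} (h : ¬ Good x) : ∃ i j, BadAt x i j := by
  unfold Good at h
  push Not at h
  obtain ⟨i, hi, j, hj, hi0, hj0, hij⟩ := h
  have h1 : (x.1.filter fun l => x.2 l = 0).Nonempty := ⟨i, by simp [hi, hi0]⟩
  have h2 : (x.1ᶜ.filter fun l => x.2 l = 0).Nonempty := ⟨j, by simp [hj, hj0]⟩
  have m1 := Finset.max'_mem _ h1
  have m2 := Finset.min'_mem _ h2
  have l1 := Finset.le_max' (x.1.filter fun l => x.2 l = 0) i (by simp [hi, hi0])
  have l2 := Finset.min'_le (x.1ᶜ.filter fun l => x.2 l = 0) j (by simp [hj, hj0])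
  set i' := Finset.max' _ h1
  set j' := Finset.min' _ h2
  simp only [Finset.mem_filter, Finset.mem_compl] at m1 m2
  refine ⟨i', j', m1.1, m2.1, m1.2, m2.2, ?_, ?_, ?_⟩
  · refine lt_of_le_of_ne (l2.trans (hij.trans l1)) fun h => ?_
    rw [h] at m2
    exact m2.1 m1.1
  · intro l hl hil h0
    have := Finset.le_max' (x.1.filter fun l => x.2 l = 0) l (by simp [hl, h0])
    exact absurd hil (not_lt.2 this)
  · intro l hl hil h0
    have := Finset.min'_le (x.1ᶜ.filter fun l => x.2 l = 0) l (by simp [hl, h0])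
    exact absurd hil (not_lt.2 this)

/-- Exchange the types of the slots `i` and `j`. -/
def flipIdx (x : Idx n) (i j : Fin n) : Idx n :=
  ⟨insert j (x.1.erase i), fun l => x.2 l + if j < l ∧ l < i then 1 else 0⟩

lemma rk_flip {I : Finset (Fin n)} {i j l : Fin n} (hi : i ∈ I) (hj : j ∉ I) (hji : j < i)
    (hli : l ≠ i) (hlj : l ≠ j) :
    rk (insert j (I.erase i)) l = rk I l + if j < l ∧ l < i then 1 else 0 := by
  have hij : i ≠ j := hji.ne'
  have hc : (insert j (I.erase i))ᶜ = insert i (Iᶜ.erase j) := by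
    ext t
    simp only [Finset.mem_compl, Finset.mem_insert, Finset.mem_erase]
    rcases eq_or_ne t i with rfl | h1
    · simp [hij]
    · simp [h1]
  have hm : l ∈ insert j (I.erase i) ↔ l ∈ I := by simp [hli, hlj]
  have gen : ∀ (S : Finset (Fin n)) (P : Fin n → Prop) [DecidablePred P] (s t : Fin n),
      s ∈ S → t ∉ S →
      (((insert t (S.erase s)).filter P).card + if P s then 1 else 0)
        = (S.filter P).card + if P t then 1 else 0 := by
    intro S P _ s t hs ht
    have ht' : t ∉ (S.erase s).filter P := fun h =>
      ht (Finset.mem_of_mem_erase (Finset.mem_filter.1 h).1)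
    rw [Finset.filter_insert, Finset.filter_erase]
    rw [Finset.filter_erase] at ht'
    by_cases h1 : P s
    · have h3 : s ∈ S.filter P := Finset.mem_filter.2 ⟨hs, h1⟩
      have h4 := Finset.card_erase_add_one h3
      by_cases h2 : P t
      · simp only [h1, h2, if_true]
        rw [Finset.card_insert_of_notMem ht']
        omega
      · simp only [h1, h2, if_true, if_false]
        omega
    · have h3 : s ∉ S.filter P := fun h => h1 (Finset.mem_filter.1 h).2
      rw [Finset.erase_eq_of_notMem h3] at ht' ⊢
      by_cases h2 : P t
      · simp only [h1, h2, if_true, if_false]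
        rw [Finset.card_insert_of_notMem ht']
      · simp only [h1, h2, if_false]
  unfold rk
  by_cases hl : l ∈ I
  · rw [if_pos hl, if_pos (hm.2 hl)]
    have := gen I (· < l) i j hi hj
    split_ifs at this ⊢ <;> grind
  · rw [if_neg hl, if_neg (fun h => hl (hm.1 h)), hc]
    have := gen Iᶜ (l < ·) j i (by simpa using hj) (by simpa using hi)
    split_ifs at this ⊢ <;> grind

lemma flip_mem_AA {p : ℕ} {x : Idx n} {i j : Fin n} (hx : x ∈ ArtF n p) (hb : BadAt x i j) :
    flipIdx x i j ∈ AA n p := by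
  obtain ⟨hi, hj, hi0, hj0, hji, hI, hJ⟩ := hb
  rw [mem_ArtF] at hx
  rw [mem_AA]
  refine ⟨?_, ?_, ?_⟩
  · simp only [flipIdx]
    rw [Finset.card_insert_of_notMem (fun h => hj (Finset.mem_of_mem_erase h)),
      Finset.card_erase_add_one hi, hx.1]
  · intro l
    simp only [flipIdx]
    rcases eq_or_ne l i with rfl | h1
    · simp [hi0]
    · rcases eq_or_ne l j with rfl | h2
      · simp [hj0]
      · rw [rk_flip hi hj hji h1 h2]
        exact Nat.add_le_add_right (hx.2 l) _
  · intro s hs t ht hs0 ht0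
    simp only [flipIdx, Finset.mem_insert, Finset.mem_erase, not_or, not_and] at hs ht hs0 ht0
    grind

lemma flip_inj {x y : Idx n} {i j i' j' : Fin n} (hx : BadAt x i j) (hy : BadAt y i' j')
    (h : flipIdx x i j = flipIdx y i' j') : x = y := by
  obtain ⟨I, a⟩ := x
  obtain ⟨I', a'⟩ := y
  simp only [flipIdx, Sigma.mk.injEq, heq_eq_eq] at h
  obtain ⟨h1, h2⟩ := h
  simp only [BadAt] at hx hy
  obtain ⟨hi, hj, hi0, hj0, hji, hI, hJ⟩ := hx
  obtain ⟨hi', hj', hi0', hj0', hji', hI', hJ'⟩ := hy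
  have hm : ∀ t, t ∈ insert j (I.erase i) ↔ t ∈ insert j' (I'.erase i') := fun t => by rw [h1]
  have ha : ∀ t, (a t + if j < t ∧ t < i then 1 else 0) =
    a' t + if j' < t ∧ t < i' then 1 else 0 := fun t => congrFun h2 t
  simp only [Finset.mem_insert, Finset.mem_erase] at hm
  have ej : j = j' := by
    rcases lt_trichotomy j j' with hlt | rfl | hlt
    · have m1 := hm j'
      have m2 := ha j'
      grind
    · rfl
    · have m1 := hm j
      have m2 := ha j
      grind
  subst ej
  have ei : i = i' := by
    rcases lt_trichotomy i i' with hlt | rfl | hlt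
    · have m1 := hm i
      have m2 := ha i
      grind
    · rfl
    · have m1 := hm i'
      have m2 := ha i'
      grind
  subst ei
  have e1 : I = I' := by
    ext t
    have := hm t
    grind
  have e2 : a = a' := by
    funext t
    have := ha t
    omega
  rw [e1, e2]

lemma factorial_le_two_mul_card_AA {p : ℕ} (hn : 0 < n) (hp : p ≤ n) : n.factorial ≤ 2 * (AA n p).card := by
  classical
  have h1 : ((ArtF n p).filter fun x => ¬ Good x).card ≤ (AA n p).card := by
    have hex : ∀ x : Idx n, ∃ ij : Fin n × Fin n, ¬ Good x → BadAt x ij.1 ij.2 := by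
      intro x
      by_cases hg : Good x
      · exact ⟨(⟨0, hn⟩, ⟨0, hn⟩), fun h => absurd hg h⟩
      · obtain ⟨i, j, h⟩ := exists_badAt hg
        exact ⟨(i, j), fun _ => h⟩
    choose f hf using hex
    refine Finset.card_le_card_of_injOn (fun x => flipIdx x (f x).1 (f x).2) ?_ ?_
    · intro x hx
      rw [Finset.mem_coe, Finset.mem_filter] at hx
      exact flip_mem_AA hx.1 (hf x hx.2)
    · intro x hx y hy hxy
      rw [Finset.mem_coe, Finset.mem_filter] at hx hy
      exact flip_inj (hf x hx.2) (hf y hy.2) hxy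
  have h2 := Finset.card_filter_add_card_filter_not (s := ArtF n p) (p := Good)
  rw [card_ArtF hp] at h2
  rw [AA] at h1 ⊢
  have : (Finset.filter Good (ArtF n p)).card = (Finset.filter Good (ArtF n p)).card := rfl
  omega

end Combinatorics

section Triangularity

variable {n : ℕ}

/-- The exponent with `x`-exponents `a` on `I` and `y`-exponents `a` off `I`. -/
def ex (I : Finset (Fin n)) (a : Fin n → ℕ) : Fin n ⊕ Fin n →₀ ℕ :=
  Finsupp.equivFunOnFinite.symm (Sum.elim (fun l => if l ∈ I then a l else 0)
    (fun l => if l ∈ I then 0 else a l))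

lemma ex_inl (I : Finset (Fin n)) (a : Fin n → ℕ) (l : Fin n) :
    ex I a (Sum.inl l) = if l ∈ I then a l else 0 := rfl

lemma ex_inr (I : Finset (Fin n)) (a : Fin n → ℕ) (l : Fin n) :
    ex I a (Sum.inr l) = if l ∈ I then 0 else a l := rfl

/-- The weight complementary to the Artin bound. -/
def Wt (I : Finset (Fin n)) (l : Fin n) : ℕ := rk I l + if l ∈ I then 1 else 0

/-- The test monomial `∏ z^a` attached to an index. -/
def hmon (x : Idx n) : PXY n := monomial (ex x.1 x.2) 1

/-- The monomial dual to an index. -/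
def fmon (x : Idx n) : PXY n := monomial (ex x.1 fun l => Wt x.1 l - x.2 l) 1

/-- The order in which the pairing is triangular. -/
def key (x : Idx n) : ℕ ×ₗ (ℕ ×ₗ ℕ) :=
  toLex (n - x.1.card, toLex (∑ i ∈ x.1, (i : ℕ), ∑ l, rk x.1 l * x.2 l))

lemma rk_lt_of_mem {I : Finset (Fin n)} {l : Fin n} (hl : l ∈ I) : rk I l < I.card := by
  rw [rk, if_pos hl]
  refine Finset.card_lt_card (Finset.filter_ssubset.2 ⟨l, hl, lt_irrefl _⟩)

lemma rk_lt_of_notMem {I : Finset (Fin n)} {l : Fin n} (hl : l ∉ I) : rk I l < n - I.card := by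
  rw [rk, if_neg hl]
  have hc : Iᶜ.card = n - I.card := by rw [Finset.card_compl, Fintype.card_fin]
  rw [← hc]
  refine Finset.card_lt_card (Finset.filter_ssubset.2 ⟨l, by simpa using hl, lt_irrefl _⟩)

lemma card_le_fin (I : Finset (Fin n)) : I.card ≤ n := by
  simpa using Finset.card_le_univ I

/-- The slot of the staircase occupied by `l`. -/
def slotFun (I : Finset (Fin n)) (l : Fin n) : Fin n :=
  if h : l ∈ I then ⟨rk I l, (rk_lt_of_mem h).trans_le (card_le_fin I)⟩
  else ⟨I.card + rk I l, by have := rk_lt_of_notMem h; omega⟩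

lemma rk_inj {I : Finset (Fin n)} {s t : Fin n} (h : s ∈ I ↔ t ∈ I) (hr : rk I s = rk I t) :
    s = t := by
  unfold rk at hr
  by_cases hs : s ∈ I
  · rw [if_pos hs, if_pos (h.1 hs)] at hr
    have : ∀ u v : Fin n, u ∈ I → u < v → (I.filter (· < u)).card < (I.filter (· < v)).card := by
      intro u v hu huv
      refine Finset.card_lt_card ⟨fun w hw => ?_, fun hc => ?_⟩
      · simp only [Finset.mem_filter] at hw ⊢
        exact ⟨hw.1, hw.2.trans huv⟩
      · simpa using hc (Finset.mem_filter.2 ⟨hu, huv⟩)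
    rcases lt_trichotomy s t with hlt | rfl | hlt
    · have := this _ _ hs hlt
      omega
    · rfl
    · have := this _ _ (h.1 hs) hlt
      omega
  · have ht : t ∉ I := fun h' => hs (h.2 h')
    rw [if_neg hs, if_neg ht] at hr
    have : ∀ u v : Fin n, v ∉ I → u < v → (Iᶜ.filter (v < ·)).card < (Iᶜ.filter (u < ·)).card := by
      intro u v hv huv
      refine Finset.card_lt_card ⟨fun w hw => ?_, fun hc => ?_⟩
      · simp only [Finset.mem_filter] at hw ⊢
        exact ⟨hw.1, huv.trans hw.2⟩
      · simpa using hc (Finset.mem_filter.2 ⟨Finset.mem_compl.2 hv, huv⟩)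
    rcases lt_trichotomy s t with hlt | rfl | hlt
    · have := this _ _ ht hlt
      omega
    · rfl
    · have := this _ _ hs hlt
      omega

lemma slotFun_injective (I : Finset (Fin n)) : Function.Injective (slotFun I) := by
  intro s t hst
  unfold slotFun at hst
  split_ifs at hst with h1 h2 h2 <;> simp only [Fin.mk.injEq] at hst
  · exact rk_inj (by simp [h1, h2]) hst
  · have := rk_lt_of_mem h1
    omega
  · have := rk_lt_of_mem h2
    omega
  · exact rk_inj (I := I) (by simp [h1, h2]) (by omega)

lemma exists_perm_Wt (I : Finset (Fin n)) : ∃ σ : Equiv.Perm (Fin n),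
    (∀ i, ex I (Wt I) (Sum.inl i) = wexp n I.card (Sum.inl (σ i))) ∧
    (∀ i, ex I (Wt I) (Sum.inr i) = wexp n I.card (Sum.inr (σ i))) := by
  refine ⟨Equiv.ofBijective (slotFun I) (Finite.injective_iff_bijective.1 (slotFun_injective I)),
    fun i => ?_, fun i => ?_⟩ <;>
  · simp only [Equiv.ofBijective_apply, ex_inl, ex_inr, wexp_inl, wexp_inr, slotFun, Wt]
    by_cases h : i ∈ I
    · have := rk_lt_of_mem h
      simp [h, this]
    · simp [h]

lemma fmon_mul_hmon (x y : Idx n) :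
    fmon x * hmon y = monomial (ex x.1 (fun l => Wt x.1 l - x.2 l) + ex y.1 y.2) 1 := by
  rw [fmon, hmon, monomial_mul, one_mul]

lemma dlt_diag {x : Idx n} (hx : ∀ l, x.2 l ≤ rk x.1 l) :
    dlt n x.1.card (fmon x * hmon x) ≠ 0 := by
  rw [fmon_mul_hmon]
  have : ex x.1 (fun l => Wt x.1 l - x.2 l) + ex x.1 x.2 = ex x.1 (Wt x.1) := by
    ext (l | l) <;>
    · have := hx l
      simp only [Finsupp.add_apply, ex_inl, ex_inr, Wt]
      split_ifs <;> omega
  rw [this]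
  obtain ⟨σ, h1, h2⟩ := exists_perm_Wt x.1
  exact dlt_monomial_ne_zero σ h1 h2

lemma sum_lt_of_separated {I J : Finset (Fin n)} (hc : I.card = J.card) (hne : I ≠ J)
    (hsep : ∀ i ∈ J, i ∉ I → ∀ j ∈ I, j ∉ J → i < j) :
    ∑ i ∈ J, (i : ℕ) < ∑ i ∈ I, (i : ℕ) := by
  rw [← Finset.sum_sdiff (Finset.inter_subset_left (s₁ := I) (s₂ := J)),
    ← Finset.sum_sdiff (Finset.inter_subset_right (s₁ := I) (s₂ := J))]
  simp only [Finset.sdiff_inter_self_left, Finset.sdiff_inter_self_right]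
  refine Nat.add_lt_add_right ?_ _
  have hcard : (I \ J).card = (J \ I).card := by
    have h1 := Finset.card_sdiff_add_card_inter I J
    have h2 := Finset.card_sdiff_add_card_inter J I
    rw [Finset.inter_comm] at h2
    omega
  have hpos : (J \ I).Nonempty := by
    rw [Finset.nonempty_iff_ne_empty]
    intro h0
    rw [Finset.sdiff_eq_empty_iff_subset] at h0
    exact hne (Finset.eq_of_subset_of_card_le h0 hc.le).symm
  set m := (J \ I).max' hpos
  have hm := Finset.max'_mem _ hpos
  have h1 : ∑ i ∈ J \ I, (i : ℕ) ≤ (J \ I).card * (m : ℕ) := by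
    rw [← smul_eq_mul]
    exact Finset.sum_le_card_nsmul _ _ _ fun i hi => Finset.le_max' _ i hi
  have h2 : (I \ J).card * ((m : ℕ) + 1) ≤ ∑ i ∈ I \ J, (i : ℕ) := by
    rw [← smul_eq_mul]
    refine Finset.card_nsmul_le_sum _ _ _ fun j hj => ?_
    rw [Finset.mem_sdiff] at hm hj
    exact hsep _ hm.1 hm.2 j hj.1 hj.2
  have h3 : 0 < (J \ I).card := Finset.card_pos.2 hpos
  rw [hcard] at h2
  nlinarith

lemma key_lt_of_dlt_ne_zero {x y : Idx n} (hx : ∀ l, x.2 l ≤ rk x.1 l) (hy : Good y)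
    (hxy : dlt n y.1.card (fmon x * hmon y) ≠ 0) : y = x ∨ key y < key x := by
  obtain ⟨I, a⟩ := x
  obtain ⟨J, b⟩ := y
  simp only at hx hxy
  rw [fmon_mul_hmon] at hxy
  obtain ⟨σ, h1, h2⟩ := exists_of_dlt_monomial_ne_zero hxy
  simp only [Finsupp.add_apply, ex_inl, ex_inr] at h1 h2
  set S := Finset.univ.filter fun i : Fin n => ((σ i : Fin n) : ℕ) < J.card with hS
  have hScard : S.card = J.card := by
    have e1 : S.map σ.toEmbedding = Finset.univ.filter fun i : Fin n => (i : ℕ) < J.card := by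
      ext i
      simp only [Finset.mem_map, hS, Finset.mem_filter, Finset.mem_univ, true_and,
        Equiv.coe_toEmbedding]
      constructor
      · rintro ⟨k, hk, rfl⟩
        exact hk
      · exact fun h => ⟨σ.symm i, by simpa using h, by simp⟩
    rw [← Finset.card_map σ.toEmbedding, e1, Fin.card_filter_val_lt]
    exact min_eq_right (card_le_fin J)
  have hmemS : ∀ i, i ∈ S ↔ ((σ i : Fin n) : ℕ) < J.card := fun i => by simp [hS]
  have hIS : I ⊆ S := by
    intro i hi
    rw [hmemS]
    by_contra hc
    have := h1 i
    have h3 := hx i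
    rw [wexp_inl, if_neg hc, if_pos hi, Wt, if_pos hi] at this
    omega
  have hle : I.card ≤ J.card := hScard ▸ Finset.card_le_card hIS
  rcases hle.lt_or_eq with hlt | heq
  · right
    rw [key, key, Prod.Lex.toLex_lt_toLex]
    left
    have := card_le_fin J
    simp only
    omega
  have hSI : I = S := Finset.eq_of_subset_of_card_le hIS (by omega)
  have hI : ∀ i, i ∈ I ↔ ((σ i : Fin n) : ℕ) < J.card := fun i => by rw [hSI]; exact hmemS i
  by_cases hIJ : I = J
  · subst hIJ
    by_cases hab : a = b
    · left; rw [hab]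
    right
    rw [key, key, Prod.Lex.toLex_lt_toLex]
    right
    refine ⟨rfl, ?_⟩
    rw [Prod.Lex.toLex_lt_toLex]
    right
    refine ⟨rfl, ?_⟩
    simp only
    obtain ⟨τ, t1, t2⟩ := exists_perm_Wt I
    let ph : Fin n → ℤ := fun s => (((wexp n I.card (Sum.inl s) - 1 : ℕ) : ℤ)) ^ 2 +
      ((wexp n I.card (Sum.inr s) : ℕ) : ℤ) ^ 2
    have e1 : ∑ l, ((rk I l : ℤ)) ^ 2 = ∑ s, ph s := by
      rw [← Equiv.sum_comp τ ph]
      refine Finset.sum_congr rfl fun l _ => ?_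
      simp only [ph]
      rw [← t1, ← t2, ex_inl, ex_inr, Wt]
      split_ifs <;> simp
    have e2 : ∑ l, ((rk I l : ℤ) - a l + b l) ^ 2 = ∑ s, ph s := by
      rw [← Equiv.sum_comp σ ph]
      refine Finset.sum_congr rfl fun l _ => ?_
      simp only [ph]
      rw [← h1, ← h2, Wt]
      have := hx l
      split_ifs
      · rw [show rk I l + 1 - a l + b l - 1 = rk I l - a l + b l by omega]
        push_cast [this]
        ring
      · rw [show rk I l + 0 - a l + b l = rk I l - a l + b l by omega]
        push_cast [this]
        ring
    have e3 : ∑ l, ((rk I l : ℤ) - a l + b l) ^ 2 = ∑ l, ((rk I l : ℤ)) ^ 2 +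
        ∑ l, ((b l : ℤ) - a l) ^ 2 + 2 * ∑ l, (rk I l : ℤ) * b l - 2 * ∑ l, (rk I l : ℤ) * a l := by
      rw [Finset.mul_sum, Finset.mul_sum, ← Finset.sum_add_distrib, ← Finset.sum_add_distrib,
        ← Finset.sum_sub_distrib]
      refine Finset.sum_congr rfl fun l _ => ?_
      ring
    have e4 : 0 < ∑ l, ((b l : ℤ) - a l) ^ 2 := by
      obtain ⟨l, hl⟩ := Function.ne_iff.1 hab
      refine Finset.sum_pos' (fun l _ => sq_nonneg _) ⟨l, Finset.mem_univ _, ?_⟩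
      have : (b l : ℤ) - a l ≠ 0 := by omega
      positivity
    have e5 : ∑ l, (rk I l : ℤ) * b l < ∑ l, (rk I l : ℤ) * a l := by linarith
    exact_mod_cast e5
  · right
    rw [key, key, Prod.Lex.toLex_lt_toLex]
    right
    refine ⟨by simp [heq], ?_⟩
    rw [Prod.Lex.toLex_lt_toLex]
    left
    simp only
    refine sum_lt_of_separated heq hIJ fun i hiJ hiI j hjI hjJ => hy i hiJ j hjJ ?_ ?_
    · have := h1 i
      rw [if_neg hiI, if_pos hiJ, wexp_inl, if_neg (fun h => hiI ((hI i).2 h))] at this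
      simpa using this
    · have := h2 j
      rw [if_pos hjI, if_neg hjJ, wexp_inr, if_pos ((hI j).1 hjI)] at this
      simpa using this

/-- A triangularity argument: the monomials dual to good indices are independent in the
coinvariant algebra. -/
lemma coeff_eq_zero_of_kap_sum {A : Finset (Idx n)}
    (hA : ∀ x ∈ A, x.1.card < n ∧ (∀ l, x.2 l ≤ rk x.1 l) ∧ Good x) (c : Idx n → ℂ)
    (h : kap n (∑ x ∈ A, c x • fmon x) = 0) : ∀ x ∈ A, c x = 0 := by
  by_contra! hc
  obtain ⟨x0, hx0, hc0⟩ := hc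
  obtain ⟨y, hy, hmax⟩ := Finset.exists_max_image (A.filter fun x => c x ≠ 0) key
    ⟨x0, Finset.mem_filter.2 ⟨hx0, hc0⟩⟩
  rw [Finset.mem_filter] at hy
  have h1 : dlt n y.1.card ((∑ x ∈ A, c x • fmon x) * hmon y) = 0 :=
    dlt_eq_zero_of_kap (hA y hy.1).1 (kap_mul_eq_zero h _)
  rw [Finset.sum_mul, map_sum, Finset.sum_eq_single y] at h1
  · rw [smul_mul_assoc, map_smul, smul_eq_mul, mul_eq_zero] at h1
    exact h1.elim hy.2 (dlt_diag (hA y hy.1).2.1)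
  · intro x hx hxy
    rw [smul_mul_assoc, map_smul]
    by_cases hcx : c x = 0
    · rw [hcx, zero_smul]
    · by_contra hne
      rcases key_lt_of_dlt_ne_zero (hA x hx).2.1 (hA y hy.1).2.2 (right_ne_zero_of_smul hne) with
        h2 | h2
      · exact hxy h2.symm
      · exact absurd (hmax x (Finset.mem_filter.2 ⟨hx, hcx⟩)) (not_le.2 h2)
  · exact fun h => absurd hy.1 h

/-- All good indices with fewer than `n` slots of type `x`. -/
def AAll (n : ℕ) : Finset (Idx n) := (Finset.range n).biUnion (AA n)

lemma two_mul_card_AAll (hn : 0 < n) :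
    2 * n.factorial + (n - 1) * n.factorial ≤ 2 * (AAll n).card := by
  rw [AAll, Finset.card_biUnion]
  · obtain ⟨m, rfl⟩ : ∃ m, n = m + 1 := ⟨n - 1, by omega⟩
    rw [Finset.sum_range_succ', card_AA_zero, mul_add, Finset.mul_sum, Nat.add_sub_cancel, add_comm]
    refine Nat.add_le_add_right ?_ _
    rw [← smul_eq_mul]
    nth_rewrite 1 [← Finset.card_range m]
    refine Finset.card_nsmul_le_sum _ _ _ fun p hp => ?_
    exact factorial_le_two_mul_card_AA hn (by simp at hp; omega)
  · intro p _ q _ hpq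
    rw [Function.onFun, Finset.disjoint_left]
    intro x hx hy
    rw [mem_AA] at hx hy
    exact hpq (hx.1.symm.trans hy.1)

lemma card_AAll_le_finrank [FiniteDimensional ℂ (Rn n)] :
    (AAll n).card ≤ Module.finrank ℂ (Rn n) := by
  have hli : LinearIndependent ℂ fun x : AAll n => kap n (fmon (x : Idx n)) := by
    rw [Fintype.linearIndependent_iff]
    intro g hg
    let c : Idx n → ℂ := fun x => if h : x ∈ AAll n then g ⟨x, h⟩ else 0
    have h1 := coeff_eq_zero_of_kap_sum (A := AAll n) (fun x hx => ?_) c ?_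
    · intro x
      have := h1 x x.2
      simpa [c] using this
    · rw [AAll, Finset.mem_biUnion] at hx
      obtain ⟨p, hp, hx⟩ := hx
      rw [mem_AA] at hx
      rw [Finset.mem_range] at hp
      exact ⟨by omega, hx.2⟩
    · rw [map_sum, ← Finset.sum_coe_sort, ← hg]
      refine Finset.sum_congr rfl fun x _ => ?_
      simp [c]
  simpa using hli.fintype_card_le_finrank

end Triangularity

/-- The polynomial ring `ℂ[z₁,…,zₙ]`. -/
abbrev PZ (n : ℕ) : Type := MvPolynomial (Fin n) ℂ

section ArtinSpanning

lemma artin_monomial_mem_closure {α A : Type} [DecidableEq α] [CommRing A] (f : α → ℤ) (z : α → A)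
    (I : Finset α) (hf : Set.InjOn f I) :
    ∀ (S : Type) [CommRing S] [Nontrivial S] (φ : S →+* A) (χ : Polynomial S), χ.Monic →
      χ.natDegree = I.card →
      χ.map φ = ∏ l ∈ I, (Polynomial.X - Polynomial.C (z l)) → ∀ a : α → ℕ,
      ∏ l ∈ I, z l ^ a l ∈ AddSubmonoid.closure {t | ∃ (s : S) (b : α → ℕ),
        (∀ l ∈ I, b l ≤ (I.filter (fun l' => f l' < f l)).card) ∧ t = φ s * ∏ l ∈ I, z l ^ b l} := by
  induction I using Finset.induction_on_max_value f with
  | empty =>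
    intro S _ _ φ χ _ _ _ a
    exact AddSubmonoid.subset_closure ⟨1, a, by simp, by simp⟩
  | insert m I hm hmax ih =>
    intro S _ _ φ χ hχ hdeg hmap a
    have hlt : ∀ x ∈ I, f x < f m := fun x hx => lt_of_le_of_ne (hmax x hx) fun h => by
      have := hf (Finset.mem_coe.2 (Finset.mem_insert_of_mem hx))
        (Finset.mem_coe.2 (Finset.mem_insert_self m I)) h
      exact hm (this ▸ hx)
    rw [Finset.card_insert_of_notMem hm] at hdeg
    let φ' : Polynomial S →+* A := Polynomial.eval₂RingHom φ (z m)
    have hφ' : φ'.comp Polynomial.C = φ := by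
      ext s
      simp [φ']
    let χ' : Polynomial (Polynomial S) :=
      (χ.map Polynomial.C) /ₘ (Polynomial.X - Polynomial.C Polynomial.X)
    have hmon : (Polynomial.X - Polynomial.C (Polynomial.X : Polynomial S)).Monic :=
      Polynomial.monic_X_sub_C _
    have hχC : (χ.map (Polynomial.C : S →+* Polynomial S)).Monic := hχ.map _
    have hdC : (χ.map (Polynomial.C : S →+* Polynomial S)).natDegree = I.card + 1 := by
      rw [hχ.natDegree_map, hdeg]
    have h1 : χ'.Monic := by
      rw [Polynomial.Monic, Polynomial.leadingCoeff_divByMonic_of_monic hmon]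
      · exact hχC
      · rw [Polynomial.degree_X_sub_C, Polynomial.degree_eq_natDegree hχC.ne_zero, hdC]
        exact_mod_cast Nat.le_add_left 1 _
    have h2 : χ'.natDegree = I.card := by
      rw [Polynomial.natDegree_divByMonic _ hmon, hdC, Polynomial.natDegree_X_sub_C,
        Nat.add_sub_cancel]
    have h3 : χ'.map φ' = ∏ l ∈ I, (Polynomial.X - Polynomial.C (z l)) := by
      rw [Polynomial.map_divByMonic _ hmon, Polynomial.map_map, hφ', hmap, Finset.prod_insert hm]
      have : (Polynomial.X - Polynomial.C (Polynomial.X : Polynomial S)).map φ' =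
          Polynomial.X - Polynomial.C (z m) := by simp [φ']
      rw [this]
      exact Polynomial.mul_divByMonic_cancel_left _ (Polynomial.monic_X_sub_C _)
    have h4 := ih (hf.mono (by simp)) (Polynomial S) φ' χ' h1 h2 h3 a
    rw [Finset.prod_insert hm]
    have hroot : φ' χ = 0 := by
      have : (χ.map φ).eval (z m) = 0 := by
        rw [hmap, Finset.prod_insert hm]; simp
      rwa [Polynomial.eval_map] at this
    have hred : ∀ (s : Polynomial S) (b : α → ℕ),
        (∀ l ∈ I, b l ≤ (I.filter (fun l' => f l' < f l)).card) →
        φ' s * ∏ l ∈ I, z l ^ b l ∈ AddSubmonoid.closure {t | ∃ (s : S) (b : α → ℕ),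
        (∀ l ∈ insert m I, b l ≤ ((insert m I).filter (fun l' => f l' < f l)).card) ∧
          t = φ s * ∏ l ∈ insert m I, z l ^ b l} := by
      intro s b hb
      have hs : φ' s = φ' (s %ₘ χ) := by
        conv_lhs => rw [← Polynomial.modByMonic_add_div s χ]
        rw [map_add, map_mul, hroot, zero_mul, add_zero]
      have hd : (s %ₘ χ).natDegree < I.card + 1 := by
        rw [← hdeg]
        exact Polynomial.natDegree_modByMonic_lt _ hχ (fun h => by simp [h] at hdeg)
      have he : φ' (s %ₘ χ) = ∑ k ∈ Finset.range (I.card + 1), φ ((s %ₘ χ).coeff k) * z m ^ k :=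
        Polynomial.eval₂_eq_sum_range' φ hd (z m)
      rw [hs, he, Finset.sum_mul]
      refine AddSubmonoid.sum_mem _ fun k hk => AddSubmonoid.subset_closure ?_
      refine ⟨(s %ₘ χ).coeff k, Function.update b m k, fun l hl => ?_, ?_⟩
      · rw [Finset.mem_insert] at hl
        rcases hl with rfl | hl
        · rw [Function.update_self]
          have : (insert l I).filter (fun l' => f l' < f l) = I := by
            ext x
            simp only [Finset.mem_filter, Finset.mem_insert]
            constructor
            · rintro ⟨rfl | h, h2⟩
              · exact absurd h2 (lt_irrefl _)
              · exact h
            · exact fun h => ⟨Or.inr h, hlt x h⟩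
          rw [this]
          simpa [Nat.lt_succ_iff] using hk
        · have hne : l ≠ m := fun h => hm (h ▸ hl)
          rw [Function.update_of_ne hne]
          exact (hb l hl).trans (Finset.card_le_card
            (Finset.filter_subset_filter _ (Finset.subset_insert m I)))
      · rw [Finset.prod_insert hm, Function.update_self, mul_assoc]
        congr 2
        refine Finset.prod_congr rfl fun l hl => ?_
        have hne : l ≠ m := fun h => hm (h ▸ hl)
        rw [Function.update_of_ne hne]
    have hX : z m ^ a m = φ' (Polynomial.X ^ a m) := by simp [φ']
    rw [hX]
    clear hX
    generalize ∏ l ∈ I, z l ^ a l = w at h4 ⊢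
    induction h4 using AddSubmonoid.closure_induction with
    | mem t ht =>
      obtain ⟨s, b, hb, rfl⟩ := ht
      rw [← mul_assoc, ← map_mul]
      exact hred _ b hb
    | zero => rw [mul_zero]; exact zero_mem _
    | add x y _ _ hx hy => rw [mul_add]; exact add_mem hx hy

variable {n : ℕ}

/-- Elementary symmetric polynomials in the variables of a block. -/
def eS (I : Finset (Fin n)) (j : ℕ) : PZ n := ∑ K ∈ I.powersetCard j, ∏ k ∈ K, X k

/-- The positive degree elementary symmetric polynomials of both blocks. -/
def gen (I : Finset (Fin n)) (x : Fin n × Bool) : PZ n :=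
  eS (if x.2 then I else Iᶜ) ((x.1 : ℕ) + 1)

/-- The ideal of block-symmetric polynomials without constant term. -/
def KI (I : Finset (Fin n)) : Ideal (PZ n) := Ideal.span (Set.range (gen I))

/-- The monomial `z^a`. -/
def zmon (a : Fin n → ℕ) : PZ n := ∏ l, X l ^ a l

lemma zmon_eq (a : Fin n → ℕ) : zmon a = monomial (Finsupp.equivFunOnFinite.symm a) 1 := by
  rw [monomial_eq, C_1, one_mul, Finsupp.prod_fintype _ _ (fun i => pow_zero _)]
  rfl

lemma block_poly (I J : Finset (Fin n)) (hJ : J = I ∨ J = Iᶜ) :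
    ∏ l ∈ J, (Polynomial.X - Polynomial.C (Ideal.Quotient.mk (KI I) (X l))) =
      Polynomial.X ^ J.card := by
  have h := Multiset.prod_X_sub_X_eq_sum_esymm (J.val.map fun l => Ideal.Quotient.mk (KI I) (X l))
  rw [Multiset.map_map] at h
  refine Eq.trans h ?_
  rw [Multiset.card_map, Finset.card_val, Finset.sum_range_succ', Finset.sum_eq_zero]
  · rw [Finset.esymm_map_val]
    simp
  · intro j hj
    rw [Finset.esymm_map_val]
    have : ∑ t ∈ Finset.powersetCard (j + 1) J, ∏ i ∈ t, Ideal.Quotient.mk (KI I) (X i) = 0 := by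
      have e : ∑ t ∈ Finset.powersetCard (j + 1) J, ∏ i ∈ t, Ideal.Quotient.mk (KI I) (X i)
          = Ideal.Quotient.mk (KI I) (eS J (j + 1)) := by
        rw [eS, map_sum]
        refine Finset.sum_congr rfl fun t _ => ?_
        rw [map_prod]
      rw [e, Ideal.Quotient.eq_zero_iff_mem]
      have hjn : j < n := (Finset.mem_range.1 hj).trans_le (card_le_fin J)
      rcases hJ with rfl | rfl
      · exact Ideal.subset_span ⟨(⟨j, hjn⟩, true), by simp [gen]⟩
      · exact Ideal.subset_span ⟨(⟨j, hjn⟩, false), by simp [gen]⟩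
    rw [this]
    simp

/-- The span of the Artin monomials. -/
def artSpan (I : Finset (Fin n)) : Submodule ℂ (PZ n) :=
  Submodule.span ℂ (zmon '' {a | a ∈ Art I})

lemma artSpan_sup_KI (I : Finset (Fin n)) (f : PZ n) :
    ∃ g ∈ artSpan I, f - g ∈ KI I := by
  have hmain : ∀ J : Finset (Fin n), ∀ g : Fin n → ℤ, Set.InjOn g J → (J = I ∨ J = Iᶜ) →
      ∀ a : Fin n → ℕ, ∏ l ∈ J, (Ideal.Quotient.mk (KI I) (X l)) ^ a l ∈
      Submodule.span ℂ {t | ∃ b : Fin n → ℕ,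
        (∀ l ∈ J, b l ≤ (J.filter (fun l' => g l' < g l)).card) ∧
        t = ∏ l ∈ J, (Ideal.Quotient.mk (KI I) (X l)) ^ b l} := by
    intro J g hg hJ a
    have := artin_monomial_mem_closure g (fun l => Ideal.Quotient.mk (KI I) (X l)) J hg ℂ
      (algebraMap ℂ (PZ n ⧸ KI I)) (Polynomial.X ^ J.card) (Polynomial.monic_X_pow _)
      (Polynomial.natDegree_X_pow _) (by rw [block_poly I J hJ]; simp) a
    generalize ∏ l ∈ J, (Ideal.Quotient.mk (KI I) (X l)) ^ a l = w at this ⊢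
    induction this using AddSubmonoid.closure_induction with
    | mem t ht =>
      obtain ⟨s, b, hb, rfl⟩ := ht
      rw [← Algebra.smul_def]
      exact Submodule.smul_mem _ _ (Submodule.subset_span ⟨b, hb, rfl⟩)
    | zero => exact zero_mem _
    | add x y _ _ hx hy => exact add_mem hx hy
  have hmon : ∀ a : Fin n → ℕ, Ideal.Quotient.mk (KI I) (zmon a) ∈
      (artSpan I).map (Ideal.Quotient.mkₐ ℂ (KI I)).toLinearMap := by
    intro a
    have h1 := hmain I (fun l => ((l : ℕ) : ℤ)) (fun a _ b _ h => by simpa [Fin.ext_iff] using h)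
      (Or.inl rfl) a
    have h2 := hmain Iᶜ (fun l => -((l : ℕ) : ℤ)) (fun a _ b _ h => by simpa [Fin.ext_iff] using h)
      (Or.inr rfl) a
    have h3 := Submodule.mul_mem_mul h1 h2
    rw [Submodule.span_mul_span, Finset.prod_mul_prod_compl] at h3
    simp only [← map_pow, ← map_prod] at h3
    refine Submodule.span_le.2 ?_ h3
    rintro _ ⟨_, ⟨b, hb, rfl⟩, _, ⟨c, hc, rfl⟩, rfl⟩
    refine ⟨zmon fun l => if l ∈ I then b l else c l, Submodule.subset_span ⟨_, ?_, rfl⟩, ?_⟩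
    · change _ ∈ Art I
      rw [mem_Art]
      intro l
      by_cases hl : l ∈ I
      · have := hb l hl
        simpa [hl, rk] using this
      · have := hc l (by simpa using hl)
        simpa [hl, rk] using this
    · change Ideal.Quotient.mk (KI I) _ = _ * _
      rw [← map_mul]
      congr 1
      rw [zmon, ← Finset.prod_mul_prod_compl I]
      congr 1
      · exact Finset.prod_congr rfl fun l hl => by simp [hl]
      · exact Finset.prod_congr rfl fun l hl => by
          rw [Finset.mem_compl] at hl
          simp [hl]
  have hall : Ideal.Quotient.mk (KI I) f ∈
      (artSpan I).map (Ideal.Quotient.mkₐ ℂ (KI I)).toLinearMap := by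
    induction f using MvPolynomial.induction_on' with
    | monomial u a =>
      have := Submodule.smul_mem _ a (hmon u)
      rw [zmon_eq] at this
      have e : Finsupp.equivFunOnFinite.symm ⇑u = u := by ext; rfl
      rw [e] at this
      have e2 : (monomial u a : PZ n) = a • monomial u 1 := by
        rw [smul_monomial, smul_eq_mul, mul_one]
      rw [e2]
      exact this
    | add p q hp hq => rw [map_add]; exact add_mem hp hq
  obtain ⟨g, hg, hfg⟩ := hall
  exact ⟨g, hg, Ideal.Quotient.eq.1 hfg.symm⟩

end ArtinSpanning

section Degree

variable {n : ℕ}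

/-- Polynomials of degree less than `d`. -/
def degLT (n d : ℕ) : Submodule ℂ (PZ n) where
  carrier := {f | ∀ s : Fin n →₀ ℕ, d ≤ s.degree → coeff s f = 0}
  zero_mem' := fun s _ => coeff_zero s
  add_mem' := fun {f g} hf hg s hs => by rw [coeff_add, hf s hs, hg s hs, add_zero]
  smul_mem' := fun c f hf s hs => by rw [coeff_smul, hf s hs, smul_zero]

lemma degLT_mono {d e : ℕ} (h : d ≤ e) : degLT n d ≤ degLT n e :=
  fun _ hf s hs => hf s (h.trans hs)

lemma eq_zero_of_mem_degLT_zero {f : PZ n} (hf : f ∈ degLT n 0) : f = 0 := by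
  ext s
  rw [hf s (Nat.zero_le _), coeff_zero]

lemma exists_mem_degLT (f : PZ n) : ∃ d, f ∈ degLT n d := by
  refine ⟨f.totalDegree + 1, fun s hs => ?_⟩
  refine coeff_eq_zero_of_totalDegree_lt ?_
  exact hs

lemma homogeneous_mem_degLT {d e : ℕ} {f : PZ n} (hf : f.IsHomogeneous e) (h : e < d) :
    f ∈ degLT n d := by
  intro s hs
  exact hf.coeff_eq_zero (by omega)

lemma sub_comp_mem_degLT {d : ℕ} {f : PZ n} (hf : f ∈ degLT n (d + 1)) :
    f - homogeneousComponent d f ∈ degLT n d := by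
  intro s hs
  rw [coeff_sub, coeff_homogeneousComponent]
  split_ifs with h
  · rw [sub_self]
  · rw [hf s (by omega), sub_zero]

lemma zmon_isHomogeneous (a : Fin n → ℕ) : (zmon a).IsHomogeneous (∑ l, a l) := by
  rw [zmon_eq]
  refine isHomogeneous_monomial _ ?_
  rw [Finsupp.degree_eq_sum]
  rfl

lemma rename_mem_degLT {d : ℕ} {f : PZ n} (σ : Equiv.Perm (Fin n)) (hf : f ∈ degLT n d) :
    rename σ f ∈ degLT n d := by
  intro s hs
  obtain ⟨t, rfl⟩ : ∃ t : Fin n →₀ ℕ, t.mapDomain σ = s := ⟨s.mapDomain σ.symm, by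
    rw [← Finsupp.mapDomain_comp]; simp⟩
  rw [coeff_rename_mapDomain _ σ.injective]
  refine hf t (hs.trans ?_)
  rw [Finsupp.degree_mapDomain]

lemma homogeneousComponent_mem_artSpan (I : Finset (Fin n)) (d : ℕ) {g : PZ n}
    (hg : g ∈ artSpan I) : homogeneousComponent d g ∈ artSpan I := by
  induction hg using Submodule.span_induction with
  | mem x hx =>
    obtain ⟨a, ha, rfl⟩ := hx
    rw [homogeneousComponent_of_mem (zmon_isHomogeneous a)]
    split_ifs
    · exact Submodule.subset_span ⟨a, ha, rfl⟩
    · exact zero_mem _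
  | zero => rw [map_zero]; exact zero_mem _
  | add x y _ _ hx hy => rw [map_add]; exact add_mem hx hy
  | smul c x _ hx => rw [map_smul]; exact Submodule.smul_mem _ _ hx

lemma homogeneousComponent_mul_homogeneous (d : ℕ) {m : ℕ} (hm : 0 < m) (c : PZ n) {g : PZ n}
    (hg : g.IsHomogeneous m) : ∃ c' ∈ degLT n d, homogeneousComponent d (c * g) = c' * g := by
  refine ⟨∑ i ∈ Finset.range (c.totalDegree + 1),
    if d = i + m then homogeneousComponent i c else 0, ?_, ?_⟩
  · refine Submodule.sum_mem _ fun i _ => ?_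
    split_ifs with h
    · exact homogeneous_mem_degLT (homogeneousComponent_isHomogeneous i c) (by omega)
    · exact zero_mem _
  · conv_lhs => rw [← sum_homogeneousComponent c]
    rw [Finset.sum_mul, Finset.sum_mul, map_sum]
    refine Finset.sum_congr rfl fun i _ => ?_
    rw [homogeneousComponent_of_mem ((homogeneousComponent_isHomogeneous i c).mul hg)]
    split_ifs
    · rfl
    · rw [zero_mul]

lemma eS_isHomogeneous (I : Finset (Fin n)) (j : ℕ) : (eS I j).IsHomogeneous j := by
  refine IsHomogeneous.sum _ _ _ fun K hK => ?_
  have := IsHomogeneous.prod K (fun k => (X k : PZ n)) (fun _ => 1) fun k _ => isHomogeneous_X _ _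
  rwa [Finset.sum_const, (Finset.mem_powersetCard.1 hK).2, smul_eq_mul, mul_one] at this

lemma rename_eS (σ : Equiv.Perm (Fin n)) (I : Finset (Fin n)) (j : ℕ) :
    rename σ (eS I j) = eS (I.map σ.toEmbedding) j := by
  rw [eS, eS, map_sum, Finset.powersetCard_map, Finset.sum_map]
  refine Finset.sum_congr rfl fun K _ => ?_
  simp [map_prod]

lemma rename_gen (σ : Equiv.Perm (Fin n)) (I : Finset (Fin n)) (x : Fin n × Bool) :
    rename σ (gen I x) = gen (I.map σ.toEmbedding) x := by
  have hc : (I.map σ.toEmbedding)ᶜ = Iᶜ.map σ.toEmbedding := by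
    ext t
    simp [Finset.mem_map_equiv]
  rw [gen, gen, rename_eS, hc]
  split_ifs <;> rfl

/-- `f` vanishes at the points of the orbit of `c` whose block `S` sits in the position `I`. -/
def VanishAt (S : Finset (Fin n)) (c : Fin n → ℂ) (I : Finset (Fin n)) (f : PZ n) : Prop :=
  ∀ σ : Equiv.Perm (Fin n), S.map σ.toEmbedding = I → eval (c ∘ ⇑σ⁻¹) f = 0

lemma eval_gen {S : Finset (Fin n)} (c : Fin n → ℂ) {I : Finset (Fin n)} (x : Fin n × Bool)
    {σ : Equiv.Perm (Fin n)} (h : S.map σ.toEmbedding = I) :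
    eval (c ∘ ⇑σ⁻¹) (gen I x) = eval c (gen S x) := by
  rw [← h, ← rename_gen, eval_rename]
  congr 2
  funext t
  simp

lemma leading_reduction (S : Finset (Fin n)) (c : Fin n → ℂ) (I : Finset (Fin n)) {d : ℕ}
    {f : PZ n} (hf : f ∈ degLT n (d + 1)) :
    ∃ A ∈ artSpan I, A ∈ degLT n (d + 1) ∧ ∃ k, VanishAt S c I k ∧
      (∃ k0 ∈ KI I, k - k0 ∈ degLT n d) ∧ f - A - k ∈ degLT n d := by
  obtain ⟨g, hg, hfg⟩ := artSpan_sup_KI I f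
  obtain ⟨b, hb⟩ := Ideal.mem_span_range_iff_exists_fun.1 hfg
  have hex : ∀ x : Fin n × Bool, ∃ c' ∈ degLT n d,
      homogeneousComponent d (b x * gen I x) = c' * gen I x := fun x =>
    homogeneousComponent_mul_homogeneous d (Nat.succ_pos _) _ (eS_isHomogeneous _ _)
  choose b' hb' hbb using hex
  have hk0 : homogeneousComponent d f - homogeneousComponent d g = ∑ x, b' x * gen I x := by
    rw [← map_sub, ← hb, map_sum]
    exact Finset.sum_congr rfl fun x _ => hbb x
  have hdiff : ∑ x, b' x * (gen I x - C (eval c (gen S x))) - ∑ x, b' x * gen I x ∈ degLT n d := by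
    rw [← Finset.sum_sub_distrib]
    refine Submodule.sum_mem _ fun x _ => ?_
    have : b' x * (gen I x - C (eval c (gen S x))) - b' x * gen I x
        = (-(eval c (gen S x))) • b' x := by
      rw [smul_eq_C_mul, C_neg]; ring
    rw [this]
    exact Submodule.smul_mem _ _ (hb' x)
  refine ⟨homogeneousComponent d g, homogeneousComponent_mem_artSpan I d hg,
    homogeneous_mem_degLT (homogeneousComponent_isHomogeneous d g) (Nat.lt_succ_self d),
    ∑ x, b' x * (gen I x - C (eval c (gen S x))), ?_, ⟨∑ x, b' x * gen I x, ?_, hdiff⟩, ?_⟩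
  · intro σ hσ
    rw [map_sum]
    refine Finset.sum_eq_zero fun x _ => ?_
    rw [map_mul, map_sub, eval_gen c x hσ, eval_C, sub_self, mul_zero]
  · exact Ideal.sum_mem _ fun x _ => Ideal.mul_mem_left _ _ (Ideal.subset_span ⟨x, rfl⟩)
  · have := Submodule.sub_mem _ (sub_comp_mem_degLT hf) hdiff
    rw [← hk0] at this
    convert this using 1
    ring

lemma artin_reduction (S : Finset (Fin n)) (c : Fin n → ℂ) (I : Finset (Fin n)) (d : ℕ)
    (f : PZ n) (hf : f ∈ degLT n d) :
    ∃ A ∈ artSpan I, A ∈ degLT n d ∧ VanishAt S c I (f - A) := by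
  induction d generalizing f with
  | zero =>
    refine ⟨0, zero_mem _, zero_mem _, fun σ _ => ?_⟩
    rw [eq_zero_of_mem_degLT_zero hf, sub_zero, map_zero]
  | succ d ih =>
    obtain ⟨A, hA, hAd, k, hk, -, hr⟩ := leading_reduction S c I hf
    obtain ⟨A', hA', hAd', hv⟩ := ih _ hr
    refine ⟨A + A', add_mem hA hA', add_mem hAd (degLT_mono (Nat.le_succ d) hAd'), fun σ hσ => ?_⟩
    have h1 := hk σ hσ
    have h2 := hv σ hσ
    rw [show f - (A + A') = (f - A - k - A') + k by ring, map_add, h1, h2, add_zero]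

/-- Families of polynomials indexed by blocks. -/
abbrev Fam (n : ℕ) : Type := Finset (Fin n) → PZ n

/-- Evaluation of a family on the orbit of `c` with marked block `S`. -/
def evf (S : Finset (Fin n)) (c : Fin n → ℂ) : Fam n →ₗ[ℂ] (Equiv.Perm (Fin n) → ℂ) where
  toFun v := fun σ => eval (c ∘ ⇑σ⁻¹) (v (S.map σ.toEmbedding))
  map_add' v w := by funext σ; simp
  map_smul' a v := by funext σ; simp

lemma evf_apply (S : Finset (Fin n)) (c : Fin n → ℂ) (v : Fam n) (σ : Equiv.Perm (Fin n)) :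
    evf S c v σ = eval (c ∘ ⇑σ⁻¹) (v (S.map σ.toEmbedding)) := rfl

/-- The values `c` separate slots inside each of the two blocks. -/
def SepOn (S : Finset (Fin n)) (c : Fin n → ℂ) : Prop :=
  ∀ s t, (s ∈ S ↔ t ∈ S) → c s = c t → s = t

lemma exists_evf_eq_single {S : Finset (Fin n)} {c : Fin n → ℂ} (hc : SepOn S c)
    (σ : Equiv.Perm (Fin n)) : ∃ v : Fam n, evf S c v = Pi.single σ 1 := by
  classical
  let P : PZ n := ∏ l : Fin n, ∏ s ∈ Finset.univ.filter
    (fun s => s ≠ σ⁻¹ l ∧ (s ∈ S ↔ σ⁻¹ l ∈ S)), (X l - C (c s))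
  have hP : eval (c ∘ ⇑σ⁻¹) P ≠ 0 := by
    simp only [P, map_prod, Finset.prod_ne_zero_iff, Finset.mem_univ, true_implies,
      Finset.mem_filter, true_and, map_sub, eval_X, eval_C, Function.comp_apply]
    rintro l s ⟨h1, h2⟩ h3
    exact h1 (hc _ _ h2 (sub_eq_zero.1 h3).symm)
  refine ⟨Pi.single (S.map σ.toEmbedding) ((eval (c ∘ ⇑σ⁻¹) P)⁻¹ • P), ?_⟩
  funext τ
  rw [evf_apply]
  by_cases h : τ = σ
  · subst h
    rw [Pi.single_eq_same, Pi.single_eq_same, smul_eval, inv_mul_cancel₀ hP]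
  · rw [Pi.single_eq_of_ne h]
    by_cases hI : S.map τ.toEmbedding = S.map σ.toEmbedding
    · rw [hI, Pi.single_eq_same, smul_eval]
      obtain ⟨l, hl⟩ : ∃ l, τ⁻¹ l ≠ σ⁻¹ l := by
        by_contra! hcon
        exact h (inv_injective (Equiv.ext hcon))
      have hmem : τ⁻¹ l ∈ S ↔ σ⁻¹ l ∈ S := by
        have := Finset.ext_iff.1 hI l
        rwa [Finset.mem_map_equiv, Finset.mem_map_equiv] at this
      have : eval (c ∘ ⇑τ⁻¹) P = 0 := by
        simp only [P, map_prod]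
        refine Finset.prod_eq_zero (Finset.mem_univ l) ?_
        have hm : τ⁻¹ l ∈ Finset.univ.filter (fun s => s ≠ σ⁻¹ l ∧ (s ∈ S ↔ σ⁻¹ l ∈ S)) :=
          Finset.mem_filter.2 ⟨Finset.mem_univ _, hl, hmem⟩
        refine Finset.prod_eq_zero hm ?_
        simp
      rw [this, mul_zero]
    · rw [Pi.single_eq_of_ne hI, map_zero]

lemma evf_surjective {S : Finset (Fin n)} {c : Fin n → ℂ} (hc : SepOn S c) :
    Function.Surjective (evf S c) := by
  classical
  intro g
  choose v hv using exists_evf_eq_single hc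
  refine ⟨∑ σ, g σ • v σ, ?_⟩
  rw [map_sum]
  funext τ
  simp [hv, Finset.sum_apply, Pi.single_apply]

/-- The family supported at one block with a single monomial. -/
def efam (x : Idx n) : Fam n := Pi.single x.1 (zmon x.2)

lemma evf_congr {S : Finset (Fin n)} {c : Fin n → ℂ} {v w : Fam n}
    (h : ∀ I, I.card = S.card → VanishAt S c I (v I - w I)) : evf S c v = evf S c w := by
  funext σ
  have := h (S.map σ.toEmbedding) (Finset.card_map _) σ rfl
  rw [map_sub, sub_eq_zero] at this
  exact this

lemma sum_single_eq_of_artSpan {p : ℕ} {w : Fam n} (hw : ∀ I, I.card = p → w I ∈ artSpan I) :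
    ∃ b : Idx n → ℂ, ∀ I, I.card = p → w I = (∑ x ∈ ArtF n p, b x • efam x) I := by
  classical
  have : ∀ I : Finset (Fin n), ∃ b : (Fin n → ℕ) → ℂ, I.card = p →
      w I = ∑ a ∈ Art I, b a • zmon a := by
    intro I
    by_cases hI : I.card = p
    · have h1 := hw I hI
      rw [artSpan] at h1
      obtain ⟨b, hb⟩ := (Submodule.mem_span_image_finset_iff_exists_fun' ℂ (s := Art I)).1 h1
      exact ⟨b, fun _ => hb.symm⟩
    · exact ⟨0, fun h => absurd h hI⟩
  choose b hb using this
  refine ⟨fun x => b x.1 x.2, fun I hI => ?_⟩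
  rw [hb I hI, Finset.sum_apply, ArtF, Finset.sum_sigma, Finset.sum_eq_single I]
  · refine Finset.sum_congr rfl fun a _ => ?_
    simp [efam]
  · intro J _ hJ
    refine Finset.sum_eq_zero fun a _ => ?_
    simp [efam, Pi.single_eq_of_ne hJ.symm]
  · intro h
    exact absurd (Finset.mem_powersetCard.2 ⟨Finset.subset_univ _, hI⟩) h

lemma evf_efam_linearIndependent {S : Finset (Fin n)} {c : Fin n → ℂ} (hc : SepOn S c) :
    LinearIndependent ℂ fun x : ArtF n S.card => evf S c (efam (x : Idx n)) := by
  refine linearIndependent_of_top_le_span_of_card_eq_finrank ?_ ?_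
  · intro g _
    obtain ⟨v, rfl⟩ := evf_surjective hc g
    have : ∀ I, ∃ A ∈ artSpan I, VanishAt S c I (v I - A) := fun I => by
      obtain ⟨d, hd⟩ := exists_mem_degLT (v I)
      obtain ⟨A, h1, -, h2⟩ := artin_reduction S c I d _ hd
      exact ⟨A, h1, h2⟩
    choose A hA hv using this
    rw [evf_congr fun I _ => hv I]
    obtain ⟨b, hb⟩ := sum_single_eq_of_artSpan (p := S.card) fun I _ => hA I
    rw [evf_congr (w := ∑ x ∈ ArtF n S.card, b x • efam x) fun I hI σ _ => by
      rw [hb I hI, sub_self, map_zero], map_sum]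
    refine Submodule.sum_mem _ fun x hx => ?_
    rw [map_smul]
    exact Submodule.smul_mem _ _ (Submodule.subset_span ⟨⟨x, hx⟩, rfl⟩)
  · rw [Fintype.card_coe, card_ArtF (card_le_fin S), Module.finrank_fintype_fun_eq_card,
      Fintype.card_perm, Fintype.card_fin]

lemma eq_zero_of_artSpan_of_evf {S : Finset (Fin n)} {c : Fin n → ℂ} (hc : SepOn S c)
    {w : Fam n} (hw : ∀ I, I.card = S.card → w I ∈ artSpan I) (h0 : evf S c w = 0) :
    ∀ I, I.card = S.card → w I = 0 := by
  obtain ⟨b, hb⟩ := sum_single_eq_of_artSpan hw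
  have h1 : evf S c (∑ x ∈ ArtF n S.card, b x • efam x) = 0 := by
    rw [← h0]
    refine (evf_congr fun I hI σ _ => ?_).symm
    rw [hb I hI, sub_self, map_zero]
  have h2 := Fintype.linearIndependent_iff.1 (evf_efam_linearIndependent hc) (fun x => b x) (by
    rw [map_sum] at h1
    simp only [map_smul] at h1
    rw [← h1]
    exact Finset.sum_coe_sort (ArtF n S.card) fun x => b x • evf S c (efam x))
  intro I hI
  rw [hb I hI, Finset.sum_eq_zero, Pi.zero_apply]
  intro x hx
  rw [show b x = 0 from h2 ⟨x, hx⟩, zero_smul]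

/-- A family of degree at most `d` vanishing on the orbit has leading forms in the ideals of
block-symmetric polynomials. -/
lemma mem_KI_sup_degLT_of_evf {S : Finset (Fin n)} {c : Fin n → ℂ} (hc : SepOn S c) {d : ℕ}
    {v : Fam n} (hd : ∀ I, I.card = S.card → v I ∈ degLT n (d + 1)) (h0 : evf S c v = 0) :
    ∀ I, I.card = S.card → ∃ k0 ∈ KI I, v I - k0 ∈ degLT n d := by
  have : ∀ I, ∃ A ∈ artSpan I, ∃ A' ∈ artSpan I, A' ∈ degLT n d ∧ ∃ k k0, k0 ∈ KI I ∧
      k - k0 ∈ degLT n d ∧ (I.card = S.card → VanishAt S c I (v I - (A + A')) ∧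
        v I - A - k ∈ degLT n d) := by
    intro I
    by_cases hI : I.card = S.card
    · obtain ⟨A, hA, -, k, hk, ⟨k0, hk0, hkk⟩, hr⟩ := leading_reduction S c I (hd I hI)
      obtain ⟨A', hA', hAd', hv⟩ := artin_reduction S c I d _ hr
      refine ⟨A, hA, A', hA', hAd', k, k0, hk0, hkk, fun _ => ⟨fun σ hσ => ?_, hr⟩⟩
      rw [show v I - (A + A') = (v I - A - k - A') + k by ring, map_add, hv σ hσ, hk σ hσ,
        add_zero]
    · exact ⟨0, zero_mem _, 0, zero_mem _, zero_mem _, 0, 0, zero_mem _, by simp,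
        fun h => absurd h hI⟩
  choose A hA A' hA' hAd' k k0 hk0 hkk hv using this
  have h1 : evf S c (fun I => A I + A' I) = 0 := by
    rw [← h0]
    exact (evf_congr fun I hI => (hv I hI).1).symm
  have h2 := eq_zero_of_artSpan_of_evf hc (fun I _ => add_mem (hA I) (hA' I)) h1
  intro I hI
  refine ⟨k0 I, hk0 I, ?_⟩
  have h3 := h2 I hI
  have h4 := add_mem (sub_mem (hv I hI).2 (hAd' I)) (hkk I)
  convert h4 using 1
  linear_combination h3

end Degree

section Families

variable {n : ℕ}

/-- The map `ℂ[z] → ℂ[x,y]` sending `z_l` to `x_l` for `l ∈ I` and to `y_l` otherwise. -/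
def blockIncl (I : Finset (Fin n)) : PZ n →ₐ[ℂ] PXY n :=
  rename fun l => if l ∈ I then Sum.inl l else Sum.inr l

/-- The map `ℂ[x,y] → ℂ[z]` killing `x_l` for `l ∉ I` and `y_l` for `l ∈ I`. -/
def blockRes (I : Finset (Fin n)) : PXY n →ₐ[ℂ] PZ n :=
  aeval (Sum.elim (fun l => if l ∈ I then X l else 0) fun l => if l ∈ I then 0 else X l)

/-- The ideal generated by the relations of `Rn` and the square-free `x`-monomials of
degree greater than `p`. -/
def Jid (n p : ℕ) : Ideal (PXY n) :=
  RingHom.ker (kap n) ⊔ Ideal.span (xmon '' {J : Finset (Fin n) | p < J.card})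

lemma mem_Jid_of_kap {p : ℕ} {f : PXY n} (hf : kap n f = 0) : f ∈ Jid n p :=
  Ideal.mem_sup_left hf

lemma xmon_mem_Jid {p : ℕ} {J : Finset (Fin n)} (hJ : p < J.card) : xmon J ∈ Jid n p :=
  Ideal.mem_sup_right (Ideal.subset_span ⟨J, hJ, rfl⟩)

lemma Jid_induction {p : ℕ} {P : PXY n → Prop} (hk : ∀ f, kap n f = 0 → P f)
    (hx : ∀ J : Finset (Fin n), p < J.card → ∀ g, P (xmon J * g))
    (hadd : ∀ f g, P f → P g → P (f + g)) {f : PXY n} (hf : f ∈ Jid n p) : P f := by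
  obtain ⟨a, ha, b, hb, rfl⟩ := Submodule.mem_sup.1 hf
  refine hadd _ _ (hk _ ha) ?_
  have : ∀ g, P (b * g) := by
    clear hf
    induction hb using Submodule.span_induction with
    | mem x h =>
      obtain ⟨J, hJ, rfl⟩ := h
      exact hx J hJ
    | zero => intro g; rw [zero_mul]; exact hk _ (map_zero _)
    | add x y _ _ h1 h2 => intro g; rw [add_mul]; exact hadd _ _ (h1 g) (h2 g)
    | smul c x _ h => intro g; rw [smul_eq_mul, mul_comm c, mul_assoc]; exact h _
  simpa using this 1

lemma dlt_eq_zero_of_mem_Jid {p : ℕ} (hp : p < n) {f : PXY n} (hf : f ∈ Jid n p) :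
    dlt n p f = 0 :=
  Jid_induction (P := fun f => dlt n p f = 0) (fun _ h => dlt_eq_zero_of_kap hp h)
    (fun _ hJ g => dlt_xmon_mul hJ g) (fun f g hf hg => by rw [map_add, hf, hg, add_zero]) hf

lemma xmon_mul_X_sub_mem_Jid (I : Finset (Fin n)) (s : Fin n ⊕ Fin n) :
    xmon I * (X s - blockIncl I (blockRes I (X s))) ∈ Jid n I.card := by
  rcases s with l | l
  · by_cases h : l ∈ I
    · simp [blockRes, blockIncl, h]
    · have : xmon I * (X (Sum.inl l) - blockIncl I (blockRes I (X (Sum.inl l))))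
          = xmon (insert l I) := by
        simp [blockRes, h, xmon, Finset.prod_insert h, mul_comm]
      rw [this]
      exact xmon_mem_Jid (by rw [Finset.card_insert_of_notMem h]; exact Nat.lt_succ_self _)
  · by_cases h : l ∈ I
    · have : xmon I * (X (Sum.inr l) - blockIncl I (blockRes I (X (Sum.inr l))))
          = X (Sum.inl l) * X (Sum.inr l) * xmon (I.erase l) := by
        simp only [blockRes, aeval_X, Sum.elim_inr, if_pos h, map_zero, sub_zero, xmon]
        rw [← Finset.mul_prod_erase I _ h]
        ring
      rw [this]
      exact mem_Jid_of_kap (kap_mul_eq_zero (kap_xy l) _)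
    · simp [blockRes, blockIncl, h]

lemma xmon_mul_sub_mem_Jid (I : Finset (Fin n)) (h : PXY n) :
    xmon I * (h - blockIncl I (blockRes I h)) ∈ Jid n I.card := by
  induction h using MvPolynomial.induction_on with
  | C a => simp [← MvPolynomial.algebraMap_eq]
  | add f g hf hg =>
    convert add_mem hf hg using 1
    rw [map_add, map_add]; ring
  | mul_X f s hf =>
    convert add_mem (Ideal.mul_mem_right (X s) _ hf)
      (Ideal.mul_mem_right (blockIncl I (blockRes I f)) _ (xmon_mul_X_sub_mem_Jid I s)) using 1
    rw [map_mul, map_mul]; ring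

lemma aeval_eS_univ (J : Finset (Fin n)) (j : ℕ) :
    aeval (fun l => if l ∈ J then (X l : PZ n) else 0) (eS (Finset.univ : Finset (Fin n)) j)
      = eS J j := by
  simp only [eS, map_sum, map_prod, aeval_X]
  symm
  refine Finset.sum_subset_zero_on_sdiff
    (Finset.powersetCard_mono (Finset.subset_univ J)) (fun K hK => ?_) (fun K hK => ?_)
  · rw [Finset.mem_sdiff, Finset.mem_powersetCard, Finset.mem_powersetCard] at hK
    have : ¬ K ⊆ J := fun h => hK.2 ⟨h, hK.1.2⟩
    obtain ⟨k, hk, hkJ⟩ := Finset.not_subset.1 this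
    exact Finset.prod_eq_zero hk (if_neg hkJ)
  · refine Finset.prod_congr rfl fun k hk => ?_
    rw [if_pos ((Finset.mem_powersetCard.1 hK).1 hk)]

lemma kap_rename_eS (i : Fin n → Fin n ⊕ Fin n)
    (hi : ∀ (σ : Equiv.Perm (Fin n)) (l : Fin n), Sum.map ⇑σ ⇑σ (i l) = i (σ l))
    {j : ℕ} (hj : 0 < j) :
    kap n (rename i (eS (Finset.univ : Finset (Fin n)) j)) = 0 := by
  refine kap_eq_zero_of_invariant _ (fun σ => ?_) ?_
  · have h1 : eS (Finset.univ : Finset (Fin n)) j = rename σ (eS Finset.univ j) := by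
      rw [rename_eS, Finset.map_univ_equiv]
    conv_rhs => rw [h1]
    rw [pact, rename_rename, rename_rename]
    congr 2
    funext l
    exact hi σ l
  · rw [constantCoeff_rename, eS, map_sum]
    refine Finset.sum_eq_zero fun K hK => ?_
    obtain ⟨k, hk⟩ : K.Nonempty := Finset.card_pos.1 (by
      rw [(Finset.mem_powersetCard.1 hK).2]; exact hj)
    rw [map_prod]
    exact Finset.prod_eq_zero hk (constantCoeff_X (R := ℂ) k)

lemma kap_rename_inl_eS {j : ℕ} (hj : 0 < j) :
    kap n (rename Sum.inl (eS (Finset.univ : Finset (Fin n)) j)) = 0 :=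
  kap_rename_eS _ (fun _ _ => rfl) hj

lemma kap_rename_inr_eS {j : ℕ} (hj : 0 < j) :
    kap n (rename Sum.inr (eS (Finset.univ : Finset (Fin n)) j)) = 0 :=
  kap_rename_eS _ (fun _ _ => rfl) hj

lemma xmon_mul_blockIncl_gen_mem (I : Finset (Fin n)) (x : Fin n × Bool) :
    xmon I * blockIncl I (gen I x) ∈ Jid n I.card := by
  obtain ⟨f, hf, hfg⟩ : ∃ f : PXY n, kap n f = 0 ∧ blockRes I f = gen I x := by
    obtain ⟨j, b⟩ := x
    cases b
    · refine ⟨_, kap_rename_inr_eS (Nat.succ_pos j), ?_⟩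
      rw [gen, blockRes, aeval_rename]
      refine Eq.trans ?_ (aeval_eS_univ _ _)
      congr 2
      funext l
      by_cases h : l ∈ I <;> simp [h]
    · refine ⟨_, kap_rename_inl_eS (Nat.succ_pos j), ?_⟩
      rw [gen, blockRes, aeval_rename]
      exact aeval_eS_univ _ _
  have h1 := xmon_mul_sub_mem_Jid I f
  rw [hfg] at h1
  have h2 : xmon I * f ∈ Jid n I.card := Ideal.mul_mem_left _ _ (mem_Jid_of_kap hf)
  convert sub_mem h2 h1 using 1
  ring

lemma xmon_mul_blockIncl_mem {I : Finset (Fin n)} {k : PZ n} (hk : k ∈ KI I) :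
    xmon I * blockIncl I k ∈ Jid n I.card := by
  obtain ⟨b, rfl⟩ := Ideal.mem_span_range_iff_exists_fun.1 hk
  rw [map_sum, Finset.mul_sum]
  refine Ideal.sum_mem _ fun x _ => ?_
  rw [map_mul, mul_left_comm]
  exact Ideal.mul_mem_left _ _ (xmon_mul_blockIncl_gen_mem I x)

/-- The element of `Rn` represented by a family. -/
def qF (n : ℕ) : Fam n →ₗ[ℂ] Rn n where
  toFun u := ∑ I, kap n (xmon I * blockIncl I (u I))
  map_add' u v := by
    rw [← Finset.sum_add_distrib]
    refine Finset.sum_congr rfl fun I _ => ?_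
    rw [Pi.add_apply, map_add, mul_add, map_add]
  map_smul' c u := by
    rw [RingHom.id_apply, Finset.smul_sum]
    refine Finset.sum_congr rfl fun I _ => ?_
    rw [Pi.smul_apply, map_smul, mul_smul_comm, map_smul]

lemma qF_apply (u : Fam n) : qF n u = ∑ I, kap n (xmon I * blockIncl I (u I)) := rfl

lemma qF_single (I : Finset (Fin n)) (f : PZ n) :
    qF n (Pi.single I f) = kap n (xmon I * blockIncl I f) := by
  rw [qF_apply, Finset.sum_eq_single I]
  · rw [Pi.single_eq_same]
  · intro J _ hJ
    rw [Pi.single_eq_of_ne hJ, map_zero, mul_zero, map_zero]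
  · intro h
    exact absurd (Finset.mem_univ _) h

/-- Families supported on blocks with at least `p` elements. -/
def famGE (n p : ℕ) : Submodule ℂ (Fam n) where
  carrier := {u | ∀ I : Finset (Fin n), I.card < p → u I = 0}
  zero_mem' := fun _ _ => rfl
  add_mem' := fun {u v} hu hv I hI => by rw [Pi.add_apply, hu I hI, hv I hI, add_zero]
  smul_mem' := fun c u hu I hI => by rw [Pi.smul_apply, hu I hI, smul_zero]

lemma famGE_anti {p q : ℕ} (h : p ≤ q) : famGE n q ≤ famGE n p :=
  fun _ hu I hI => hu I (hI.trans_le h)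

/-- The image of `famGE n p` in `Rn n`. -/
def QGE (n p : ℕ) : Submodule ℂ (Rn n) := (famGE n p).map (qF n)

lemma QGE_anti {p q : ℕ} (h : p ≤ q) : QGE n q ≤ QGE n p := Submodule.map_mono (famGE_anti h)

lemma kap_mem_QGE_of_Jid {p : ℕ}
    (h : ∀ I : Finset (Fin n), p < I.card → ∀ g, kap n (xmon I * g) ∈ QGE n (p + 1))
    {f : PXY n} (hf : f ∈ Jid n p) : kap n f ∈ QGE n (p + 1) :=
  Jid_induction (P := fun f => kap n f ∈ QGE n (p + 1))
    (fun _ h => by rw [h]; exact zero_mem _) h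
    (fun f g hf hg => by rw [map_add]; exact add_mem hf hg) hf

lemma kap_xmon_mul_mem_QGE (p : ℕ) (I : Finset (Fin n)) (hI : p ≤ I.card) (g : PXY n) :
    kap n (xmon I * g) ∈ QGE n p := by
  obtain ⟨m, hm⟩ : ∃ m, n + 1 ≤ p + m := ⟨n + 1, by omega⟩
  induction m generalizing p I g with
  | zero => exact absurd (card_le_fin I) (by omega)
  | succ m ih =>
    have ih' : ∀ I : Finset (Fin n), p < I.card → ∀ g, kap n (xmon I * g) ∈ QGE n (p + 1) :=
      fun I hI g => ih (p + 1) I hI g (by omega)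
    rcases hI.lt_or_eq with h | h
    · exact QGE_anti (Nat.le_succ p) (ih' I h g)
    · have h1 := xmon_mul_sub_mem_Jid I g
      rw [← h] at h1
      have h2 := QGE_anti (Nat.le_succ p) (kap_mem_QGE_of_Jid ih' h1)
      have h3 : kap n (xmon I * blockIncl I (blockRes I g)) ∈ QGE n p := by
        refine ⟨Pi.single I (blockRes I g), fun J hJ => ?_, qF_single _ _⟩
        rw [Pi.single_eq_of_ne]
        rintro rfl
        omega
      convert add_mem h2 h3 using 1
      rw [← map_add]
      congr 1
      ring

lemma kap_mem_QGE {p : ℕ} {f : PXY n} (hf : f ∈ Jid n p) : kap n f ∈ QGE n (p + 1) :=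
  kap_mem_QGE_of_Jid (fun I hI g => kap_xmon_mul_mem_QGE _ I hI g) hf

lemma qF_surjective : Function.Surjective (qF n) := by
  intro r
  obtain ⟨f, rfl⟩ := kap_surjective r
  have := kap_xmon_mul_mem_QGE 0 ∅ (Nat.zero_le _) f
  rw [xmon, Finset.prod_empty, one_mul] at this
  obtain ⟨u, -, hu⟩ := this
  exact ⟨u, hu⟩

/-- The family of restrictions of `h` to the blocks of size `p`. -/
def resFam (p : ℕ) : PXY n →ₗ[ℂ] Fam n where
  toFun h := fun I => if I.card = p then blockRes I h else 0
  map_add' f g := by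
    funext I
    by_cases hI : I.card = p <;> simp [hI]
  map_smul' c f := by
    funext I
    by_cases hI : I.card = p <;> simp [hI]

lemma resFam_apply (p : ℕ) (h : PXY n) (I : Finset (Fin n)) :
    resFam p h I = if I.card = p then blockRes I h else 0 := rfl

lemma rename_inl_eS_univ (p : ℕ) :
    rename Sum.inl (eS (Finset.univ : Finset (Fin n)) p)
      = ∑ I ∈ Finset.univ.filter fun I : Finset (Fin n) => I.card = p, (xmon I : PXY n) := by
  rw [eS, map_sum, Finset.powersetCard_eq_filter, Finset.powerset_univ]
  refine Finset.sum_congr rfl fun K _ => ?_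
  rw [map_prod, xmon]
  exact Finset.prod_congr rfl fun k _ => rename_X _ _

lemma qF_resFam_mem {p : ℕ} (hp : 0 < p) (h : PXY n) : qF n (resFam p h) ∈ QGE n (p + 1) := by
  have h1 : qF n (resFam p h) = ∑ I ∈ Finset.univ.filter fun I : Finset (Fin n) => I.card = p,
      kap n (xmon I * blockIncl I (blockRes I h)) := by
    rw [qF_apply, Finset.sum_filter]
    refine Finset.sum_congr rfl fun I _ => ?_
    rw [resFam_apply]
    split_ifs
    · rfl
    · rw [map_zero, mul_zero, map_zero]
  have h2 : ∑ I ∈ Finset.univ.filter fun I : Finset (Fin n) => I.card = p, kap n (xmon I * h)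
      = 0 := by
    rw [← map_sum, ← Finset.sum_mul, ← rename_inl_eS_univ]
    exact kap_mul_eq_zero (kap_rename_inl_eS hp) h
  have h3 : qF n (resFam p h) = -∑ I ∈ Finset.univ.filter fun I : Finset (Fin n) => I.card = p,
      kap n (xmon I * (h - blockIncl I (blockRes I h))) := by
    rw [h1, ← sub_eq_zero, sub_neg_eq_add, ← h2, ← Finset.sum_add_distrib]
    refine Finset.sum_congr rfl fun I _ => ?_
    rw [← map_add]
    congr 1
    ring
  rw [h3]
  refine neg_mem (Submodule.sum_mem _ fun I hI => ?_)
  have := xmon_mul_sub_mem_Jid I h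
  rw [(Finset.mem_filter.1 hI).2] at this
  exact kap_mem_QGE this

lemma kap_xmon_univ_mul (hn : 0 < n) (g : PXY n) : kap n (xmon Finset.univ * g) = 0 := by
  refine kap_mul_eq_zero ?_ g
  have := kap_rename_inl_eS (n := n) hn
  rw [rename_inl_eS_univ, Finset.sum_eq_single Finset.univ] at this
  · exact this
  · intro J hJ hne
    refine absurd ?_ hne
    rw [← Finset.card_eq_iff_eq_univ, Fintype.card_fin]
    exact (Finset.mem_filter.1 hJ).2
  · intro h
    exact absurd (Finset.mem_filter.2 ⟨Finset.mem_univ _, by simp⟩) h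

lemma QGE_top (hn : 0 < n) : QGE n n = ⊥ := by
  rw [eq_bot_iff]
  rintro _ ⟨u, hu, rfl⟩
  rw [Submodule.mem_bot, qF_apply]
  refine Finset.sum_eq_zero fun I _ => ?_
  by_cases hI : I.card < n
  · rw [hu I hI, map_zero, mul_zero, map_zero]
  · have : I = Finset.univ := by
      rw [← Finset.card_eq_iff_eq_univ, Fintype.card_fin]
      have := card_le_fin I
      omega
    rw [this]
    exact kap_xmon_univ_mul hn _

lemma evf_resFam (S : Finset (Fin n)) (c : Fin n → ℂ) (h : PXY n) (σ : Equiv.Perm (Fin n)) :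
    evf S c (resFam S.card h) σ = eval (Sum.elim (fun l => if σ⁻¹ l ∈ S then c (σ⁻¹ l) else 0)
      fun l => if σ⁻¹ l ∈ S then 0 else c (σ⁻¹ l)) h := by
  rw [evf_apply, resFam_apply, if_pos (Finset.card_map _), blockRes]
  have : ((aeval (R := ℂ) (c ∘ ⇑σ⁻¹)).comp (aeval (Sum.elim
      (fun l => if l ∈ S.map σ.toEmbedding then (X l : PZ n) else 0)
      fun l => if l ∈ S.map σ.toEmbedding then 0 else X l)))
      = aeval (Sum.elim (fun l => if σ⁻¹ l ∈ S then c (σ⁻¹ l) else 0)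
      fun l => if σ⁻¹ l ∈ S then 0 else c (σ⁻¹ l)) := by
    have hm : ∀ l, l ∈ S.map σ.toEmbedding ↔ σ⁻¹ l ∈ S := fun l => Finset.mem_map_equiv
    ext s
    rcases s with l | l
    · by_cases hl : σ⁻¹ l ∈ S
      · rw [AlgHom.comp_apply, aeval_X, aeval_X, Sum.elim_inl, Sum.elim_inl, if_pos hl,
          if_pos ((hm l).2 hl), aeval_X]; rfl
      · rw [AlgHom.comp_apply, aeval_X, aeval_X, Sum.elim_inl, Sum.elim_inl, if_neg hl,
          if_neg (fun h => hl ((hm l).1 h)), map_zero]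
    · by_cases hl : σ⁻¹ l ∈ S
      · rw [AlgHom.comp_apply, aeval_X, aeval_X, Sum.elim_inr, Sum.elim_inr, if_pos hl,
          if_pos ((hm l).2 hl), map_zero]
      · rw [AlgHom.comp_apply, aeval_X, aeval_X, Sum.elim_inr, Sum.elim_inr, if_neg hl,
          if_neg (fun h => hl ((hm l).1 h)), aeval_X]; rfl
  have h2 := DFunLike.congr_fun this h
  rw [AlgHom.comp_apply, aeval_eq_eval, aeval_eq_eval] at h2
  exact h2

lemma evf_resFam_mul_swap (S : Finset (Fin n)) (c : Fin n → ℂ) {a b : Fin n} (ha : c a = 0)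
    (hb : c b = 0) (h : PXY n) (σ : Equiv.Perm (Fin n)) :
    evf S c (resFam S.card h) (σ * Equiv.swap a b) = evf S c (resFam S.card h) σ := by
  have key : ∀ f : Fin n → ℂ, f a = f b → ∀ l, f ((σ * Equiv.swap a b)⁻¹ l) = f (σ⁻¹ l) := by
    intro f hf l
    rw [mul_inv_rev, Equiv.swap_inv, Equiv.Perm.mul_apply]
    rcases eq_or_ne (σ⁻¹ l) a with h1 | h1
    · rw [h1, Equiv.swap_apply_left, hf]
    rcases eq_or_ne (σ⁻¹ l) b with h2 | h2
    · rw [h2, Equiv.swap_apply_right, hf]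
    rw [Equiv.swap_apply_of_ne_of_ne h1 h2]
  rw [evf_resFam, evf_resFam]
  congr 2
  · funext s
    rcases s with l | l
    · exact key (fun t => if t ∈ S then c t else 0) (by simp [ha, hb]) l
    · exact key (fun t => if t ∈ S then 0 else c t) (by simp [ha, hb]) l

/-- The action of a permutation on families. -/
def famAct (α : Equiv.Perm (Fin n)) : Fam n →ₗ[ℂ] Fam n where
  toFun u := fun I => rename α (u (I.map (α⁻¹).toEmbedding))
  map_add' u v := by funext I; simp
  map_smul' a u := by funext I; simp

lemma famAct_apply (α : Equiv.Perm (Fin n)) (u : Fam n) (I : Finset (Fin n)) :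
    famAct α u I = rename α (u (I.map (α⁻¹).toEmbedding)) := rfl

lemma map_mul_toEmbedding (α σ : Equiv.Perm (Fin n)) (S : Finset (Fin n)) :
    (S.map σ.toEmbedding).map α.toEmbedding = S.map (α * σ).toEmbedding := by
  rw [Finset.map_map]; rfl

lemma map_one_toEmbedding (S : Finset (Fin n)) :
    S.map (1 : Equiv.Perm (Fin n)).toEmbedding = S := Finset.map_refl

lemma evf_famAct (S : Finset (Fin n)) (c : Fin n → ℂ) (α : Equiv.Perm (Fin n)) (u : Fam n)
    (σ : Equiv.Perm (Fin n)) : evf S c (famAct α u) σ = evf S c u (α⁻¹ * σ) := by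
  rw [evf_apply, evf_apply, famAct_apply, eval_rename, map_mul_toEmbedding, mul_inv_rev, inv_inv]
  rfl

lemma pact_blockIncl (α : Equiv.Perm (Fin n)) (K : Finset (Fin n)) (f : PZ n) :
    pact α (blockIncl K f) = blockIncl (K.map α.toEmbedding) (rename α f) := by
  rw [pact, blockIncl, blockIncl, rename_rename, rename_rename]
  congr 2
  funext l
  by_cases h : l ∈ K <;> simp [h]

lemma qF_famAct (α : Equiv.Perm (Fin n)) (u : Fam n) : qF n (famAct α u) = permR n α (qF n u) := by
  rw [qF_apply, qF_apply, map_sum]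
  symm
  refine Fintype.sum_equiv (Equiv.finsetCongr α) _ _ fun K => ?_
  rw [permR_kap, map_mul, pact_xmon, pact_blockIncl, famAct_apply, Equiv.finsetCongr_apply,
    map_mul_toEmbedding, inv_mul_cancel, map_one_toEmbedding]

lemma map_X_pow_eq_zero {A : Type} [CommRing A] [Algebra ℂ A] (f : PXY n →ₐ[ℂ] A)
    (hf : ∀ p, (∀ σ, pact σ p = p) → constantCoeff p = 0 → f p = 0) (s : Fin n ⊕ Fin n) :
    f (X s) ^ n = 0 := by
  obtain ⟨i, l, hi, rfl⟩ : ∃ (i : Fin n → Fin n ⊕ Fin n) (l : Fin n),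
      (∀ (σ : Equiv.Perm (Fin n)) (l : Fin n), Sum.map ⇑σ ⇑σ (i l) = i (σ l)) ∧ s = i l := by
    rcases s with l | l
    · exact ⟨Sum.inl, l, fun _ _ => rfl, rfl⟩
    · exact ⟨Sum.inr, l, fun _ _ => rfl, rfl⟩
  let P : Polynomial (PXY n) := ∏ m : Fin n, (Polynomial.X - Polynomial.C (X (i m)))
  have hinv : ∀ σ, P.map ((pact σ : PXY n →ₐ[ℂ] PXY n) : PXY n →+* PXY n) = P := by
    intro σ
    simp only [P, Polynomial.map_prod, Polynomial.map_sub, Polynomial.map_X, Polynomial.map_C]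
    refine Fintype.prod_equiv σ _ _ fun m => ?_
    simp [pact, hi]
  have hconst : P.map (constantCoeff : PXY n →+* ℂ) = Polynomial.X ^ n := by
    simp [P, Polynomial.map_prod]
  have hmap : P.map (f : PXY n →+* A) = Polynomial.X ^ n := by
    ext j
    rw [Polynomial.coeff_map, Polynomial.coeff_X_pow]
    have h1 : ∀ σ, pact σ (P.coeff j) = P.coeff j := fun σ => by
      conv_rhs => rw [← hinv σ, Polynomial.coeff_map]
      rfl
    have h2 : constantCoeff (P.coeff j) = if j = n then 1 else 0 := by
      rw [← Polynomial.coeff_map, hconst, Polynomial.coeff_X_pow]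
    have h3 : f (P.coeff j - C (constantCoeff (P.coeff j))) = 0 := by
      refine hf _ (fun σ => ?_) ?_
      · rw [map_sub, h1, pact, rename_C]
      · rw [map_sub, constantCoeff_C, sub_self]
    rw [map_sub, sub_eq_zero] at h3
    refine h3.trans ?_
    rw [h2]
    split_ifs
    · rw [C_1, map_one]
    · rw [C_0, map_zero]
  have h4 : P.eval (X (i l)) = 0 := by
    rw [Polynomial.eval_prod]
    exact Finset.prod_eq_zero (Finset.mem_univ l) (by simp)
  have h5 := Polynomial.eval_map_apply (p := P) (f := (f : PXY n →+* A)) (X (i l))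
  rw [hmap, h4, map_zero, Polynomial.eval_pow, Polynomial.eval_X] at h5
  exact h5

lemma kap_X_pow (s : Fin n ⊕ Fin n) : kap n (X s) ^ n = 0 :=
  map_X_pow_eq_zero (A := Rn n) (kap n) kap_eq_zero_of_invariant s

lemma finite_of_surjective_of_pow {s A : Type} [Finite s] [CommRing A] [Algebra ℂ A]
    (f : MvPolynomial s ℂ →ₐ[ℂ] A) (hf : Function.Surjective f) {m : ℕ} (hm : 0 < m)
    (h : ∀ i, f (X i) ^ m = 0) : Module.Finite ℂ A := by
  have h1 : Algebra.IsIntegral ℂ A := by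
    refine ⟨fun r => ?_⟩
    obtain ⟨g, rfl⟩ := hf r
    induction g using MvPolynomial.induction_on with
    | C a =>
      rw [← MvPolynomial.algebraMap_eq, AlgHom.commutes]
      exact isIntegral_algebraMap
    | add f g hf hg => rw [map_add]; exact hf.add hg
    | mul_X g i hg =>
      rw [map_mul]
      refine hg.mul (IsIntegral.of_pow hm ?_)
      rw [h]
      exact isIntegral_zero
  have h2 : Algebra.FiniteType ℂ A := Algebra.FiniteType.of_surjective f hf
  exact Algebra.IsIntegral.finite

lemma finiteDimensional_Rn (hn : 0 < n) : FiniteDimensional ℂ (Rn n) :=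
  finite_of_surjective_of_pow (A := Rn n) (kap n) kap_surjective hn kap_X_pow

end Families

section Pairing

variable {n : ℕ}

lemma degree_eq_of_dlt_monomial_ne_zero {p : ℕ} {s : Fin n ⊕ Fin n →₀ ℕ}
    (h : dlt n p (monomial s 1) ≠ 0) : s.degree = (wexp n p).degree := by
  obtain ⟨σ, h1, h2⟩ := exists_of_dlt_monomial_ne_zero h
  rw [Finsupp.degree_eq_sum, Finsupp.degree_eq_sum, Fintype.sum_sum_type, Fintype.sum_sum_type]
  congr 1
  · rw [← Equiv.sum_comp σ fun i => wexp n p (Sum.inl i)]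
    exact Finset.sum_congr rfl fun i _ => h1 i
  · rw [← Equiv.sum_comp σ fun i => wexp n p (Sum.inr i)]
    exact Finset.sum_congr rfl fun i _ => h2 i

lemma dlt_eq_zero_of_isHomogeneous {p m : ℕ} {f : PXY n} (hf : f.IsHomogeneous m)
    (hm : m ≠ (wexp n p).degree) : dlt n p f = 0 := by
  rw [← support_sum_monomial_coeff f, map_sum]
  refine Finset.sum_eq_zero fun s hs => ?_
  rw [show monomial s (coeff s f) = coeff s f • monomial s (1 : ℂ) by
    rw [smul_monomial, smul_eq_mul, mul_one], map_smul, smul_eq_mul, mul_eq_zero]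
  right
  by_contra h
  refine hm ?_
  rw [← degree_eq_of_dlt_monomial_ne_zero h]
  by_contra hne
  exact mem_support_iff.1 hs (hf.coeff_eq_zero (fun h => hne h.symm))

lemma hmon_isHomogeneous (x : Idx n) : (hmon x).IsHomogeneous (∑ l, x.2 l) := by
  refine isHomogeneous_monomial _ ?_
  rw [Finsupp.degree_eq_sum, Fintype.sum_sum_type, ← Finset.sum_add_distrib]
  refine Finset.sum_congr rfl fun l _ => ?_
  rw [ex_inl, ex_inr]
  split_ifs <;> simp

lemma blockRes_isHomogeneous (I : Finset (Fin n)) {f : PXY n} {m : ℕ} (hf : f.IsHomogeneous m) :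
    (blockRes I f).IsHomogeneous m := by
  have := hf.aeval (n := 1) (Sum.elim (fun l => if l ∈ I then (X l : PZ n) else 0)
    fun l => if l ∈ I then 0 else X l) (fun s => by
      rcases s with l | l
      · by_cases h : l ∈ I
        · simpa [h] using isHomogeneous_X ℂ l
        · simpa [h] using isHomogeneous_zero _ _ _
      · by_cases h : l ∈ I
        · simpa [h] using isHomogeneous_zero _ _ _
        · simpa [h] using isHomogeneous_X ℂ l)
  rwa [one_mul] at this

lemma blockIncl_isHomogeneous (I : Finset (Fin n)) {f : PZ n} {m : ℕ} (hf : f.IsHomogeneous m) :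
    (blockIncl I f).IsHomogeneous m := hf.rename_isHomogeneous

lemma fmon_isHomogeneous (x : Idx n) :
    (fmon x).IsHomogeneous (ex x.1 fun l => Wt x.1 l - x.2 l).degree :=
  isHomogeneous_monomial _ rfl

lemma degree_fmon_add {x : Idx n} (hx : ∀ l, x.2 l ≤ rk x.1 l) :
    (ex x.1 fun l => Wt x.1 l - x.2 l).degree + ∑ l, x.2 l = (wexp n x.1.card).degree := by
  by_contra h
  exact dlt_diag hx (dlt_eq_zero_of_isHomogeneous
    ((fmon_isHomogeneous x).mul (hmon_isHomogeneous x)) h)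

lemma dlt_fmon_mul_eq_zero {x : Idx n} (hx : ∀ l, x.2 l ≤ rk x.1 l) {g : PZ n}
    (hg : g ∈ degLT n (∑ l, x.2 l)) : dlt n x.1.card (fmon x * blockIncl x.1 g) = 0 := by
  rw [← support_sum_monomial_coeff g, map_sum, Finset.mul_sum, map_sum]
  refine Finset.sum_eq_zero fun s hs => ?_
  refine dlt_eq_zero_of_isHomogeneous ((fmon_isHomogeneous x).mul
    (blockIncl_isHomogeneous x.1 (isHomogeneous_monomial (coeff s g) rfl))) ?_
  have h1 : s.degree < ∑ l, x.2 l := by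
    by_contra h
    exact mem_support_iff.1 hs (hg s (not_lt.1 h))
  have h2 := degree_fmon_add hx
  omega

lemma fmon_eq_mul {x : Idx n} (hx : ∀ l, x.2 l ≤ rk x.1 l) :
    ∃ z : PZ n, fmon x = xmon x.1 * blockIncl x.1 z := by
  refine ⟨zmon fun l => rk x.1 l - x.2 l, ?_⟩
  rw [fmon, monomial_eq, C_1, one_mul, zmon, map_prod, xmon, ← Finset.prod_filter_mul_prod_filter_not
    Finset.univ (· ∈ x.1), ← mul_assoc, Finset.filter_mem_eq_inter, Finset.univ_inter,
    ← Finset.prod_mul_distrib, Finsupp.prod_fintype _ _ fun _ => pow_zero _,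
    Fintype.prod_sum_type, ← Finset.prod_filter_mul_prod_filter_not
    Finset.univ (· ∈ x.1)  fun l => X (Sum.inl l) ^ _, ← Finset.prod_filter_mul_prod_filter_not
    Finset.univ (· ∈ x.1)  fun l => X (Sum.inr l) ^ _, Finset.filter_mem_eq_inter,
    Finset.univ_inter]
  have e1 : ∏ l ∈ Finset.univ.filter (fun l => ¬ l ∈ x.1),
      (X (Sum.inl l) : PXY n) ^ (ex x.1 (fun l => Wt x.1 l - x.2 l) (Sum.inl l)) = 1 := by
    refine Finset.prod_eq_one fun l hl => ?_
    rw [ex_inl, if_neg (Finset.mem_filter.1 hl).2, pow_zero]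
  have e2 : ∏ l ∈ x.1,
      (X (Sum.inr l) : PXY n) ^ (ex x.1 (fun l => Wt x.1 l - x.2 l) (Sum.inr l)) = 1 := by
    refine Finset.prod_eq_one fun l hl => ?_
    rw [ex_inr, if_pos hl, pow_zero]
  rw [e1, e2, mul_one, one_mul]
  congr 1
  · refine Finset.prod_congr rfl fun l hl => ?_
    rw [ex_inl, if_pos hl, map_pow, blockIncl, rename_X, if_pos hl, ← pow_succ', Wt, if_pos hl]
    congr 1
    have := hx l
    omega
  · refine Finset.prod_congr rfl fun l hl => ?_
    have hl := (Finset.mem_filter.1 hl).2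
    rw [ex_inr, if_neg hl, map_pow, blockIncl, rename_X, if_neg hl, Wt, if_neg hl, add_zero]

lemma dlt_fmon_mul_KI {x : Idx n} (hn : x.1.card < n) (hx : ∀ l, x.2 l ≤ rk x.1 l) {k : PZ n}
    (hk : k ∈ KI x.1) : dlt n x.1.card (fmon x * blockIncl x.1 k) = 0 := by
  obtain ⟨z, hz⟩ := fmon_eq_mul hx
  rw [hz, mul_right_comm]
  exact dlt_eq_zero_of_mem_Jid hn (Ideal.mul_mem_right _ _ (xmon_mul_blockIncl_mem hk))

lemma dlt_fmon_mul_blockRes {x : Idx n} (hn : x.1.card < n) (hx : ∀ l, x.2 l ≤ rk x.1 l)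
    (h : PXY n) : dlt n x.1.card (fmon x * blockIncl x.1 (blockRes x.1 h))
      = dlt n x.1.card (fmon x * h) := by
  obtain ⟨z, hz⟩ := fmon_eq_mul hx
  rw [eq_comm, ← sub_eq_zero, ← map_sub, ← mul_sub, hz, mul_right_comm]
  exact dlt_eq_zero_of_mem_Jid hn (Ideal.mul_mem_right _ _ (xmon_mul_sub_mem_Jid x.1 h))

lemma coeff_eq_zero_of_evf_eq_sum {S : Finset (Fin n)} {c : Fin n → ℂ} (hc : SepOn S c)
    (hS : S.card < n) {d : ℕ} {u : Fam n} (hu : ∀ I, I.card = S.card → u I ∈ degLT n d)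
    (cf : Idx n → ℂ)
    (h : evf S c u = ∑ x ∈ AA n S.card, cf x • evf S c (resFam S.card (hmon x))) :
    ∀ x ∈ AA n S.card, d ≤ ∑ l, x.2 l → cf x = 0 := by
  classical
  by_contra! hcon
  obtain ⟨x1, hx1, hdx1, hcx1⟩ := hcon
  let A := (AA n S.card).filter fun x => cf x ≠ 0
  obtain ⟨x2, hx2, hmax⟩ := A.exists_max_image (fun x => ∑ l, x.2 l)
    ⟨x1, Finset.mem_filter.2 ⟨hx1, hcx1⟩⟩
  obtain ⟨x0, hx0, hmin⟩ := (A.filter fun x => ∑ l, x.2 l = ∑ l, x2.2 l).exists_min_image key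
    ⟨x2, Finset.mem_filter.2 ⟨hx2, rfl⟩⟩
  obtain ⟨hx0A, hx0d⟩ := Finset.mem_filter.1 hx0
  obtain ⟨hx0AA, hcx0⟩ := Finset.mem_filter.1 hx0A
  obtain ⟨h0card, h0rk, h0good⟩ := mem_AA.1 hx0AA
  have hmax' : ∀ x ∈ AA n S.card, cf x ≠ 0 → ∑ l, x.2 l ≤ ∑ l, x0.2 l := fun x hx hcx => by
    rw [hx0d]; exact hmax x (Finset.mem_filter.2 ⟨hx, hcx⟩)
  have hd0 : d ≤ ∑ l, x0.2 l := hdx1.trans (hmax' x1 hx1 hcx1)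
  have hres : ∀ x ∈ AA n S.card, ∀ I, cf x • resFam S.card (hmon x) I
      ∈ degLT n (∑ l, x0.2 l + 1) := by
    intro x hx I
    by_cases hcx : cf x = 0
    · rw [hcx, zero_smul]; exact zero_mem _
    · refine Submodule.smul_mem _ _ ?_
      rw [resFam_apply]
      split_ifs
      · exact homogeneous_mem_degLT (blockRes_isHomogeneous I (hmon_isHomogeneous x))
          (Nat.lt_succ_of_le (hmax' x hx hcx))
      · exact zero_mem _
  obtain ⟨k0, hk0, hlow⟩ := mem_KI_sup_degLT_of_evf hc (d := ∑ l, x0.2 l)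
    (v := u - ∑ x ∈ AA n S.card, cf x • resFam S.card (hmon x)) (fun I hI => by
      rw [Pi.sub_apply, Finset.sum_apply]
      exact sub_mem (degLT_mono (hd0.trans (Nat.le_succ _)) (hu I hI))
        (Submodule.sum_mem _ fun x hx => hres x hx I))
    (by rw [map_sub, map_sum, h, sub_eq_zero]; simp only [map_smul]) x0.1 h0card
  let φ : PZ n →ₗ[ℂ] ℂ := (dlt n x0.1.card).comp
    ((LinearMap.mulLeft ℂ (fmon x0)).comp (blockIncl x0.1).toLinearMap)
  have hφ : ∀ g, φ g = dlt n x0.1.card (fmon x0 * blockIncl x0.1 g) := fun g => rfl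
  have hn0 : x0.1.card < n := h0card ▸ hS
  have h1 : φ ((u - ∑ x ∈ AA n S.card, cf x • resFam S.card (hmon x)) x0.1) = 0 := by
    have h2 := dlt_fmon_mul_eq_zero h0rk hlow
    rw [← hφ, map_sub, sub_eq_zero] at h2
    rw [h2, hφ]
    exact dlt_fmon_mul_KI hn0 h0rk hk0
  rw [Pi.sub_apply, map_sub, hφ (u x0.1),
    dlt_fmon_mul_eq_zero h0rk (degLT_mono hd0 (hu x0.1 h0card)), zero_sub, neg_eq_zero,
    Finset.sum_apply, map_sum, Finset.sum_eq_single x0] at h1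
  · rw [Pi.smul_apply, map_smul, smul_eq_mul, resFam_apply, if_pos h0card, hφ,
      dlt_fmon_mul_blockRes hn0 h0rk] at h1
    exact (mul_eq_zero.1 h1).elim hcx0 (dlt_diag h0rk)
  · intro x hx hne
    rw [Pi.smul_apply, map_smul, smul_eq_mul, mul_eq_zero]
    by_contra! hcon
    obtain ⟨hcx, hpx⟩ := hcon
    rcases (hmax' x hx hcx).lt_or_eq with hlt | heq
    · refine hpx ?_
      rw [hφ]
      refine dlt_fmon_mul_eq_zero h0rk ?_
      rw [resFam_apply, if_pos h0card]
      exact homogeneous_mem_degLT (blockRes_isHomogeneous _ (hmon_isHomogeneous x)) hlt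
    · rw [resFam_apply, if_pos h0card, hφ, dlt_fmon_mul_blockRes hn0 h0rk, h0card,
        ← (mem_AA.1 hx).1] at hpx
      rcases key_lt_of_dlt_ne_zero h0rk (mem_AA.1 hx).2.2 hpx with h3 | h3
      · exact hne h3
      · exact absurd (hmin x (Finset.mem_filter.2 ⟨Finset.mem_filter.2 ⟨hx, hcx⟩,
          heq.trans hx0d⟩)) (not_le.2 h3)
  · exact fun h => absurd hx0AA h

end Pairing

section Involution

variable {α : Type}

/-- Functions antisymmetric under `t`. -/
def antiSub (t : α → α) : Submodule ℂ (α → ℂ) where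
  carrier := {f | ∀ x, f (t x) = -f x}
  zero_mem' := fun _ => by simp
  add_mem' := fun {f g} hf hg x => by rw [Pi.add_apply, hf x, hg x, Pi.add_apply]; ring
  smul_mem' := fun c f hf x => by rw [Pi.smul_apply, hf x, Pi.smul_apply, smul_neg]

/-- Functions symmetric under `t`. -/
def symSub (t : α → α) : Submodule ℂ (α → ℂ) where
  carrier := {f | ∀ x, f (t x) = f x}
  zero_mem' := fun _ => by simp
  add_mem' := fun {f g} hf hg x => by rw [Pi.add_apply, hf x, hg x, Pi.add_apply]
  smul_mem' := fun c f hf x => by rw [Pi.smul_apply, hf x, Pi.smul_apply]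

lemma mem_antiSub {t : α → α} {f : α → ℂ} : f ∈ antiSub t ↔ ∀ x, f (t x) = -f x := Iff.rfl

lemma mem_symSub {t : α → α} {f : α → ℂ} : f ∈ symSub t ↔ ∀ x, f (t x) = f x := Iff.rfl

variable [Fintype α]

lemma finrank_antiSub {t : α → α} (ht : ∀ x, t (t x) = x) (P : α → Prop) [DecidablePred P]
    (h1 : ∀ x, P x → ¬ P (t x)) (h2 : ∀ x, ¬ P x → ¬ P (t x) → t x = x) :
    Module.finrank ℂ (antiSub t) = (Finset.univ.filter P).card := by
  let L : antiSub t →ₗ[ℂ] ({x // P x} → ℂ) :=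
    (LinearMap.funLeft ℂ ℂ (Subtype.val : {x // P x} → α)).comp (antiSub t).subtype
  have hL : ∀ f x, L f x = f.1 x.1 := fun _ _ => rfl
  have hb : Function.Bijective L := by
    constructor
    · rw [injective_iff_map_eq_zero]
      intro f hf
      ext x
      have hP : ∀ x, P x → f.1 x = 0 := fun x hx => congrFun hf ⟨x, hx⟩
      change f.1 x = 0
      by_cases hx : P x
      · exact hP x hx
      by_cases hx' : P (t x)
      · have := f.2 x
        rw [hP _ hx'] at this
        exact neg_eq_zero.1 this.symm
      · have := f.2 x
        rw [h2 x hx hx'] at this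
        exact self_eq_neg.1 this
    · intro g
      refine ⟨⟨fun x => if h : P x then g ⟨x, h⟩ else if h' : P (t x) then -g ⟨t x, h'⟩ else 0,
        fun x => ?_⟩, ?_⟩
      · by_cases hx : P x
        · simp [hx, h1 x hx, ht]
        · by_cases hx' : P (t x)
          · simp [hx, hx']
          · simp [hx, hx', ht]
      · funext x
        rw [hL]
        exact dif_pos x.2
  rw [(LinearEquiv.ofBijective L hb).finrank_eq, Module.finrank_fintype_fun_eq_card,
    Fintype.card_subtype]

lemma finrank_symSub_add {t : α → α} (ht : ∀ x, t (t x) = x) :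
    Module.finrank ℂ (antiSub t) + Module.finrank ℂ (symSub t) = Fintype.card α := by
  let D : (α → ℂ) →ₗ[ℂ] (α → ℂ) := LinearMap.id - LinearMap.funLeft ℂ ℂ t
  have hD : ∀ f x, D f x = f x - f (t x) := fun _ _ => rfl
  have hk : LinearMap.ker D = symSub t := by
    ext f
    rw [LinearMap.mem_ker, mem_symSub, funext_iff]
    refine forall_congr' fun x => ?_
    rw [hD, Pi.zero_apply, sub_eq_zero, eq_comm]
  have hr : LinearMap.range D = antiSub t := by
    ext f
    constructor
    · rintro ⟨g, rfl⟩ x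
      rw [hD, hD, ht]
      ring
    · intro hf
      refine ⟨(1 / 2 : ℂ) • f, funext fun x => ?_⟩
      rw [hD, Pi.smul_apply, Pi.smul_apply, hf x, smul_eq_mul, smul_eq_mul]
      ring
  rw [← hk, ← hr, LinearMap.finrank_range_add_finrank_ker, Module.finrank_fintype_fun_eq_card]

lemma two_mul_card_filter_add {t : α → α} (ht : ∀ x, t (t x) = x) (P : α → Prop)
    [DecidablePred P] [DecidableEq α] (h1 : ∀ x, P x → ¬ P (t x))
    (h2 : ∀ x, ¬ P x → ¬ P (t x) → t x = x) :
    2 * (Finset.univ.filter P).card + (Finset.univ.filter fun x => t x = x).card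
      = Fintype.card α := by
  have e : (Finset.univ.filter fun x => P (t x)).card = (Finset.univ.filter P).card := by
    refine Finset.card_bij' (fun x _ => t x) (fun x _ => t x) ?_ ?_ (fun x _ => ht x)
      (fun x _ => ht x)
    · intro x hx; simpa using hx
    · intro x hx; simpa [ht] using hx
  have hu : (Finset.univ : Finset α) = Finset.univ.filter P ∪
      ((Finset.univ.filter fun x => P (t x)) ∪ Finset.univ.filter fun x => t x = x) := by
    ext x
    simp only [Finset.mem_univ, Finset.mem_union, Finset.mem_filter, true_and, true_iff]
    by_contra! h
    exact h.2.2 (h2 x h.1 h.2.1)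
  rw [← Finset.card_univ, hu, Finset.card_union_of_disjoint, Finset.card_union_of_disjoint, e]
  · rw [← hu]; ring
  · rw [Finset.disjoint_left]
    intro x hx hx'
    simp only [Finset.mem_filter, Finset.mem_univ, true_and] at hx hx'
    rw [hx'] at hx
    exact h1 x hx (by rwa [hx'])
  · rw [Finset.disjoint_left]
    intro x hx hx'
    simp only [Finset.mem_filter, Finset.mem_univ, true_and, Finset.mem_union] at hx hx'
    rcases hx' with h | h
    · exact h1 x hx h
    · exact h1 x hx (by rwa [h])

end Involution

section Reduction

variable {n : ℕ}

/-- Right multiplication by a transposition. -/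
def rsw (a b : Fin n) (σ : Equiv.Perm (Fin n)) : Equiv.Perm (Fin n) := σ * Equiv.swap a b

lemma rsw_rsw (a b : Fin n) (σ : Equiv.Perm (Fin n)) : rsw a b (rsw a b σ) = σ := by
  rw [rsw, rsw, mul_assoc, Equiv.swap_mul_self, mul_one]

lemma two_mul_finrank_antiSub_rsw {a b : Fin n} (hab : a ≠ b) :
    2 * Module.finrank ℂ (antiSub (rsw a b)) = n.factorial := by
  have h1 : ∀ σ : Equiv.Perm (Fin n), σ a < σ b → ¬ rsw a b σ a < rsw a b σ b := by
    intro σ h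
    simpa [rsw] using h.le
  have h2 : ∀ σ : Equiv.Perm (Fin n), ¬ σ a < σ b → ¬ rsw a b σ a < rsw a b σ b →
      rsw a b σ = σ := by
    intro σ h h'
    simp only [rsw, Equiv.Perm.mul_apply, Equiv.swap_apply_left, Equiv.swap_apply_right] at h'
    exact absurd (σ.injective (le_antisymm (not_lt.1 h') (not_lt.1 h))) hab
  rw [finrank_antiSub (rsw_rsw a b) (fun σ => σ a < σ b) h1 h2]
  have := two_mul_card_filter_add (rsw_rsw a b) (fun σ => σ a < σ b) h1 h2
  have hfix : (Finset.univ.filter fun σ => rsw a b σ = σ) = ∅ := by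
    refine Finset.filter_eq_empty_iff.2 fun {σ} _ h => ?_
    rw [rsw, mul_eq_left, Equiv.swap_eq_one_iff] at h
    exact hab h
  rwa [Fintype.card_perm, Fintype.card_fin, hfix, Finset.card_empty, add_zero] at this

lemma two_mul_finrank_symSub_rsw {a b : Fin n} (hab : a ≠ b) :
    2 * Module.finrank ℂ (symSub (rsw a b)) = n.factorial := by
  have h1 := two_mul_finrank_antiSub_rsw hab
  have h2 := finrank_symSub_add (rsw_rsw a b)
  rw [Fintype.card_perm, Fintype.card_fin] at h2
  omega

lemma symSub_le_span {S : Finset (Fin n)} {c : Fin n → ℂ} (hc : SepOn S c) (hS : S.card < n)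
    {a b : Fin n} (hab : a ≠ b) (ha : c a = 0) (hb : c b = 0) :
    symSub (rsw a b) ≤ Submodule.span ℂ
      ((fun x => evf S c (resFam S.card (hmon x))) '' (AA n S.card : Set (Idx n))) := by
  set f : AA n S.card → (Equiv.Perm (Fin n) → ℂ) :=
    fun x => evf S c (resFam S.card (hmon (x : Idx n))) with hf
  have hli : LinearIndependent ℂ f := by
    rw [Fintype.linearIndependent_iff]
    intro g hg x
    let cf : Idx n → ℂ := fun x => if h : x ∈ AA n S.card then g ⟨x, h⟩ else 0
    have h1 := coeff_eq_zero_of_evf_eq_sum hc hS (d := 0) (u := 0) (fun _ _ => zero_mem _) cf (by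
      rw [map_zero, ← Finset.sum_coe_sort, ← hg]
      refine Finset.sum_congr rfl fun x _ => ?_
      simp [cf, hf]) x x.2 (Nat.zero_le _)
    simpa [cf] using h1
  have hrange : (fun x => evf S c (resFam S.card (hmon x))) '' (AA n S.card : Set (Idx n))
      = Set.range f := by
    rw [Set.image_eq_range]; rfl
  rw [hrange]
  refine (Submodule.eq_of_le_of_finrank_le ?_ ?_).ge
  · rw [Submodule.span_le]
    rintro _ ⟨x, rfl⟩ σ
    exact evf_resFam_mul_swap S c ha hb _ σ
  · rw [finrank_span_eq_card hli, Fintype.card_coe]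
    have h1 := two_mul_finrank_symSub_rsw hab
    have h2 := factorial_le_two_mul_card_AA (n := n) (p := S.card) (by omega) hS.le
    omega

lemma exists_lower_of_evf_eq_zero {S : Finset (Fin n)} {c : Fin n → ℂ} (hc : SepOn S c) {d : ℕ}
    {u : Fam n} (hu : u ∈ famGE n S.card) (hd : ∀ I, I.card = S.card → u I ∈ degLT n (d + 1))
    (h0 : evf S c u = 0) :
    ∃ v ∈ famGE n S.card, (∀ I, I.card = S.card → v I ∈ degLT n d) ∧
      qF n u - qF n v ∈ QGE n (S.card + 1) := by
  have : ∀ I : Finset (Fin n), ∃ k0 ∈ KI I, (I.card = S.card → u I - k0 ∈ degLT n d) ∧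
      (I.card ≠ S.card → k0 = 0) := by
    intro I
    by_cases hI : I.card = S.card
    · obtain ⟨k0, h1, h2⟩ := mem_KI_sup_degLT_of_evf hc hd h0 I hI
      exact ⟨k0, h1, fun _ => h2, fun h => absurd hI h⟩
    · exact ⟨0, zero_mem _, fun h => absurd h hI, fun _ => rfl⟩
  choose k0 hk hlow hk0 using this
  refine ⟨u - k0, fun I hI => ?_, hlow, ?_⟩
  · rw [Pi.sub_apply, hu I hI, hk0 I hI.ne, sub_zero]
  · rw [← map_sub, sub_sub_cancel, qF_apply]
    refine Submodule.sum_mem _ fun I _ => ?_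
    by_cases hI : I.card = S.card
    · have := kap_mem_QGE (xmon_mul_blockIncl_mem (hk I))
      rwa [hI] at this
    · rw [hk0 I hI, map_zero, mul_zero, map_zero]
      exact zero_mem _

lemma exists_lower_of_evf_symm {S : Finset (Fin n)} {c : Fin n → ℂ} (hc : SepOn S c)
    (hS0 : 0 < S.card) (hS : S.card < n) {a b : Fin n} (hab : a ≠ b) (ha : c a = 0) (hb : c b = 0)
    {d : ℕ} {u : Fam n} (hu : u ∈ famGE n S.card)
    (hd : ∀ I, I.card = S.card → u I ∈ degLT n (d + 1)) (h0 : evf S c u ∈ symSub (rsw a b)) :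
    ∃ v ∈ famGE n S.card, (∀ I, I.card = S.card → v I ∈ degLT n d) ∧
      qF n u - qF n v ∈ QGE n (S.card + 1) := by
  obtain ⟨cf, hcf⟩ := (Submodule.mem_span_image_finset_iff_exists_fun' ℂ).1
    (symSub_le_span hc hS hab ha hb h0)
  have hz := coeff_eq_zero_of_evf_eq_sum hc hS hd cf hcf.symm
  let w : Fam n := ∑ x ∈ AA n S.card, cf x • resFam S.card (hmon x)
  have hwapp : ∀ I, w I = ∑ x ∈ AA n S.card, cf x • resFam S.card (hmon x) I := fun I => by
    simp only [w, Finset.sum_apply, Pi.smul_apply]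
  have hw : qF n w ∈ QGE n (S.card + 1) := by
    rw [map_sum]
    refine Submodule.sum_mem _ fun x _ => ?_
    rw [map_smul]
    exact Submodule.smul_mem _ _ (qF_resFam_mem hS0 _)
  obtain ⟨v, hv, hvd, hq⟩ := exists_lower_of_evf_eq_zero hc (u := u - w) (d := d) (fun I hI => by
      rw [Pi.sub_apply, hu I hI, hwapp, zero_sub, neg_eq_zero]
      refine Finset.sum_eq_zero fun x _ => ?_
      rw [resFam_apply, if_neg hI.ne, smul_zero]) (fun I hI => by
      rw [Pi.sub_apply, hwapp]
      refine sub_mem (hd I hI) (Submodule.sum_mem _ fun x hx => ?_)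
      by_cases hcx : cf x = 0
      · rw [hcx, zero_smul]; exact zero_mem _
      · refine Submodule.smul_mem _ _ ?_
        rw [resFam_apply, if_pos hI]
        refine homogeneous_mem_degLT (blockRes_isHomogeneous I (hmon_isHomogeneous x)) ?_
        by_contra hlt
        exact hcx (hz x hx (not_lt.1 hlt)))
    (by
      rw [map_sub, map_sum, ← hcf, sub_eq_zero]
      simp only [map_smul])
  refine ⟨v, hv, hvd, ?_⟩
  have := add_mem hq hw
  rw [map_sub] at this
  convert this using 1
  abel

end Reduction

section Chain

open Module

lemma finrank_map_mkQ_add {X : Type} [AddCommGroup X] [Module ℂ X] [FiniteDimensional ℂ X]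
    {N M : Submodule ℂ X} (h : N ≤ M) : finrank ℂ (M.map N.mkQ) + finrank ℂ N = finrank ℂ M := by
  have h1 := LinearMap.finrank_range_add_finrank_ker (N.mkQ.domRestrict M)
  have h2 : LinearMap.range (N.mkQ.domRestrict M) = M.map N.mkQ := by
    rw [LinearMap.domRestrict, LinearMap.range_comp, Submodule.range_subtype]
  have h3 : LinearMap.ker (N.mkQ.domRestrict M) = N.comap M.subtype := by
    rw [LinearMap.domRestrict, LinearMap.ker_comp, Submodule.ker_mkQ]
  rw [h2, h3, (Submodule.comapSubtypeEquivOfLe h).finrank_eq] at h1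
  exact h1

variable {U R T : Type} [AddCommGroup U] [Module ℂ U] [AddCommGroup R] [Module ℂ R]
  [AddCommGroup T] [Module ℂ T] [FiniteDimensional ℂ T]

lemma finrank_range_le_of_ker_le {f : U →ₗ[ℂ] T} {g : U →ₗ[ℂ] R}
    (h : LinearMap.ker f ≤ LinearMap.ker g) :
    finrank ℂ (LinearMap.range g) ≤ finrank ℂ (LinearMap.range f) := by
  have e := f.quotKerEquivRange
  have : FiniteDimensional ℂ (U ⧸ LinearMap.ker f) := e.symm.finiteDimensional
  rw [← e.finrank_eq, ← Submodule.range_liftQ (LinearMap.ker f) g h]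
  exact LinearMap.finrank_range_le _

variable [FiniteDimensional ℂ R]

lemma finrank_map_step (q : U →ₗ[ℂ] R) (e : U →ₗ[ℂ] T) {A A' : Submodule ℂ U} (hA : A ≤ A')
    (h : ∀ u ∈ A', e u ∈ A.map e → q u ∈ A.map q) :
    finrank ℂ (A'.map q) + finrank ℂ (A.map e) ≤ finrank ℂ (A'.map e) + finrank ℂ (A.map q) := by
  have h1 := finrank_map_mkQ_add (Submodule.map_mono (f := q) hA)
  have h2 := finrank_map_mkQ_add (Submodule.map_mono (f := e) hA)
  have h3 := finrank_range_le_of_ker_le (f := ((A.map e).mkQ.comp e).domRestrict A')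
    (g := ((A.map q).mkQ.comp q).domRestrict A') (by
      rintro ⟨u, hu⟩ hk
      simp only [LinearMap.mem_ker, LinearMap.domRestrict_apply, LinearMap.comp_apply,
        Submodule.mkQ_apply, Submodule.Quotient.mk_eq_zero] at hk ⊢
      exact h u hu hk)
  rw [LinearMap.domRestrict, LinearMap.range_comp, Submodule.range_subtype, Submodule.map_comp,
    LinearMap.domRestrict, LinearMap.range_comp, Submodule.range_subtype, Submodule.map_comp] at h3
  omega

lemma finrank_map_chain_le (q : U →ₗ[ℂ] R) (e : U →ₗ[ℂ] T) (V : ℕ → Submodule ℂ U)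
    (hmono : ∀ s, V s ≤ V (s + 1)) (h0 : V 0 = ⊥)
    (h : ∀ s, ∀ u ∈ V (s + 1), e u ∈ (V s).map e → q u ∈ (V s).map q) (s : ℕ) :
    finrank ℂ ((V s).map q) ≤ finrank ℂ ((V s).map e) := by
  induction s with
  | zero => rw [h0, Submodule.map_bot, Submodule.map_bot, finrank_bot, finrank_bot]
  | succ s ih =>
    have := finrank_map_step q e (hmono s) (h s)
    omega

/-- Comparison of the images of compatible idempotents along a filtration. -/
lemma finrank_map_idempotent_le (q : U →ₗ[ℂ] R) (e : U →ₗ[ℂ] T) (V : ℕ → Submodule ℂ U)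
    (hmono : ∀ s, V s ≤ V (s + 1)) (h0 : V 0 = ⊥)
    (h : ∀ s, ∀ u ∈ V (s + 1), e u ∈ (V s).map e → q u ∈ (V s).map q)
    {m : ℕ} (hm : (V m).map q = ⊤) {W : Submodule ℂ T} (hW : ∀ u, e u ∈ W)
    (εU : U →ₗ[ℂ] U) (εR : R →ₗ[ℂ] R) (εT : T →ₗ[ℂ] T)
    (hq : ∀ u, q (εU u) = εR (q u)) (he : ∀ u, e (εU u) = εT (e u))
    (hε : ∀ u, εU (εU u) = εU u) (hV : ∀ s, ∀ u ∈ V s, εU u ∈ V s) :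
    finrank ℂ ((⊤ : Submodule ℂ R).map εR) ≤ finrank ℂ (W.map εT) := by
  have hsub : ∀ s, (V s).map εU ≤ V s := by
    rintro s _ ⟨u, hu, rfl⟩
    exact hV s u hu
  have h1 := finrank_map_chain_le q e (fun s => (V s).map εU)
    (fun s => Submodule.map_mono (hmono s)) (by rw [h0, Submodule.map_bot]) (by
      rintro s _ ⟨u, hu, rfl⟩ ⟨k, hk, hek⟩
      obtain ⟨w, hw, hqw⟩ := h s (εU u) (hV _ u hu) ⟨k, hsub s hk, hek⟩
      refine ⟨εU w, ⟨w, hw, rfl⟩, ?_⟩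
      rw [hq, hqw, ← hq, hε]) m
  have h2 : ((V m).map εU).map q = (⊤ : Submodule ℂ R).map εR := by
    rw [← hm, ← Submodule.map_comp, ← Submodule.map_comp]
    congr 1
    ext u
    exact hq u
  rw [h2] at h1
  refine h1.trans (Submodule.finrank_mono ?_)
  rintro _ ⟨_, ⟨u, _, rfl⟩, rfl⟩
  exact ⟨e u, hW u, (he u).symm⟩

lemma finrank_map_add_finrank_map_sub {ε : T →ₗ[ℂ] T} (hε : ∀ x, ε (ε x) = ε x)
    {W : Submodule ℂ T} (hW : ∀ x ∈ W, ε x ∈ W) :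
    finrank ℂ (W.map ε) + finrank ℂ (W.map (LinearMap.id - ε)) = finrank ℂ W := by
  rw [← Submodule.finrank_sup_add_finrank_inf_eq]
  have h1 : W.map ε ⊔ W.map (LinearMap.id - ε) = W := by
    refine le_antisymm (sup_le ?_ ?_) fun x hx => ?_
    · rintro _ ⟨x, hx, rfl⟩
      exact hW x hx
    · rintro _ ⟨x, hx, rfl⟩
      exact sub_mem hx (hW x hx)
    · exact Submodule.mem_sup.2 ⟨ε x, ⟨x, hx, rfl⟩, (LinearMap.id - ε : T →ₗ[ℂ] T) x, ⟨x, hx, rfl⟩,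
        by simp⟩
  have h2 : W.map ε ⊓ W.map (LinearMap.id - ε) = ⊥ := by
    rw [eq_bot_iff]
    rintro _ ⟨⟨x, _, rfl⟩, ⟨y, _, hy⟩⟩
    have h3 := congrArg ε hy
    simp only [LinearMap.sub_apply, LinearMap.id_apply, map_sub, hε, sub_self] at h3
    exact h3.symm
  rw [h1, h2, finrank_bot, add_zero]

variable {G : Type} [Fintype G]

/-- The average of a family of endomorphisms. -/
def avgL {X : Type} [AddCommGroup X] [Module ℂ X] (a : G → X →ₗ[ℂ] X) : X →ₗ[ℂ] X :=
  (Fintype.card G : ℂ)⁻¹ • ∑ g, a g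

lemma avgL_apply {X : Type} [AddCommGroup X] [Module ℂ X] (a : G → X →ₗ[ℂ] X) (x : X) :
    avgL a x = (Fintype.card G : ℂ)⁻¹ • ∑ g, a g x := by
  rw [avgL, LinearMap.smul_apply, LinearMap.sum_apply]

variable [Group G]

lemma avgL_eq_self {X : Type} [AddCommGroup X] [Module ℂ X] {a : G → X →ₗ[ℂ] X} {x : X}
    (hx : ∀ g, a g x = x) : avgL a x = x := by
  rw [avgL_apply, Finset.sum_congr rfl fun g _ => hx g, Finset.sum_const, Finset.card_univ,
    ← Nat.cast_smul_eq_nsmul ℂ, smul_smul, inv_mul_cancel₀, one_smul]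
  exact_mod_cast Fintype.card_ne_zero

lemma act_avgL {X : Type} [AddCommGroup X] [Module ℂ X] {a : G → X →ₗ[ℂ] X}
    (ha : ∀ g h x, a (g * h) x = a g (a h x)) (g : G) (x : X) : a g (avgL a x) = avgL a x := by
  rw [avgL_apply, map_smul, map_sum]
  congr 1
  exact Fintype.sum_equiv (Equiv.mulLeft g) _ _ fun h => (ha g h x).symm

/-- Equality of the dimensions of invariants, given equality of the total dimensions. -/
lemma finrank_invariants_eq (q : U →ₗ[ℂ] R) (e : U →ₗ[ℂ] T) (V : ℕ → Submodule ℂ U)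
    (hmono : ∀ s, V s ≤ V (s + 1)) (h0 : V 0 = ⊥)
    (h : ∀ s, ∀ u ∈ V (s + 1), e u ∈ (V s).map e → q u ∈ (V s).map q)
    {m : ℕ} (hm : (V m).map q = ⊤) {W : Submodule ℂ T} (hW : ∀ u, e u ∈ W)
    (aU : G → U →ₗ[ℂ] U) (aR : G → R →ₗ[ℂ] R) (aT : G → T →ₗ[ℂ] T)
    (hU : ∀ g h x, aU (g * h) x = aU g (aU h x)) (hR : ∀ g h x, aR (g * h) x = aR g (aR h x))
    (hT : ∀ g h x, aT (g * h) x = aT g (aT h x))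
    (hq : ∀ g u, q (aU g u) = aR g (q u)) (he : ∀ g u, e (aU g u) = aT g (e u))
    (hV : ∀ s, ∀ g, ∀ u ∈ V s, aU g u ∈ V s) (hWa : ∀ g, ∀ w ∈ W, aT g w ∈ W)
    (hdim : finrank ℂ W ≤ finrank ℂ R) {IR : Submodule ℂ R} (hIR : ∀ x, x ∈ IR ↔ ∀ g, aR g x = x)
    {IT : Submodule ℂ T} (hIT : ∀ x, x ∈ IT ↔ x ∈ W ∧ ∀ g, aT g x = x) :
    finrank ℂ IR = finrank ℂ IT := by
  have idem : ∀ {X : Type} [AddCommGroup X] [Module ℂ X] {a : G → X →ₗ[ℂ] X}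
      (_ : ∀ g h x, a (g * h) x = a g (a h x)) (x : X), avgL a (avgL a x) = avgL a x :=
    fun ha x => avgL_eq_self fun g => act_avgL ha g x
  have hq' : ∀ u, q (avgL aU u) = avgL aR (q u) := fun u => by
    rw [avgL_apply, avgL_apply, map_smul, map_sum, Finset.sum_congr rfl fun g _ => hq g u]
  have he' : ∀ u, e (avgL aU u) = avgL aT (e u) := fun u => by
    rw [avgL_apply, avgL_apply, map_smul, map_sum, Finset.sum_congr rfl fun g _ => he g u]
  have hV' : ∀ s, ∀ u ∈ V s, avgL aU u ∈ V s := fun s u hu => by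
    rw [avgL_apply]
    exact Submodule.smul_mem _ _ (Submodule.sum_mem _ fun g _ => hV s g u hu)
  have hW' : ∀ w ∈ W, avgL aT w ∈ W := fun w hw => by
    rw [avgL_apply]
    exact Submodule.smul_mem _ _ (Submodule.sum_mem _ fun g _ => hWa g w hw)
  have h1 := finrank_map_idempotent_le q e V hmono h0 h hm hW (avgL aU) (avgL aR) (avgL aT) hq' he'
    (idem hU) hV'
  have h2 := finrank_map_idempotent_le q e V hmono h0 h hm hW (LinearMap.id - avgL aU)
    (LinearMap.id - avgL aR) (LinearMap.id - avgL aT)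
    (fun u => by simp only [LinearMap.sub_apply, LinearMap.id_apply, map_sub, hq'])
    (fun u => by simp only [LinearMap.sub_apply, LinearMap.id_apply, map_sub, he'])
    (fun u => by simp only [LinearMap.sub_apply, LinearMap.id_apply, map_sub, idem hU]; abel)
    (fun s u hu => sub_mem hu (hV' s u hu))
  have h3 := finrank_map_add_finrank_map_sub (idem hR) (W := ⊤) fun _ _ => Submodule.mem_top
  have h4 := finrank_map_add_finrank_map_sub (idem hT) hW'
  rw [finrank_top] at h3
  have h5 : (⊤ : Submodule ℂ R).map (avgL aR) = IR := by
    ext x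
    rw [hIR]
    constructor
    · rintro ⟨y, _, rfl⟩ g
      exact act_avgL hR g y
    · exact fun hx => ⟨x, Submodule.mem_top, avgL_eq_self hx⟩
  have h6 : W.map (avgL aT) = IT := by
    ext x
    rw [hIT]
    constructor
    · rintro ⟨y, hy, rfl⟩
      exact ⟨hW' y hy, fun g => act_avgL hT g y⟩
    · exact fun hx => ⟨x, hx.1, avgL_eq_self hx.2⟩
  rw [h5, h6] at h1
  rw [h5] at h3
  rw [h6] at h4
  omega

end Chain

section Filtration

variable {n : ℕ}

lemma exists_slots {a b : Fin n} (hab : a ≠ b) (p : Fin n) :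
    ∃ (S : Finset (Fin n)) (c : Fin n → ℂ), S.card = p ∧ SepOn S c ∧
      ((p : ℕ) ≠ 0 → c a = 0 ∧ c b = 0) := by
  have hinj : Function.Injective fun s : Fin n => ((s : ℕ) : ℂ) + 1 := fun s t h => by
    have h' : ((s : ℕ) : ℂ) + 1 = ((t : ℕ) : ℂ) + 1 := h
    exact Fin.ext (by exact_mod_cast add_right_cancel h')
  by_cases hp : (p : ℕ) = 0
  · exact ⟨∅, fun s => ((s : ℕ) : ℂ) + 1, by rw [Finset.card_empty, hp], fun s t _ h => hinj h,
      fun h => absurd hp h⟩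
  · obtain ⟨S, hS1, hS2, hS3⟩ := Finset.exists_subsuperset_card_eq
      (s := {a}) (t := Finset.univ.erase b) (n := p)
      (fun s hs => by
        rw [Finset.mem_singleton.1 hs]
        exact Finset.mem_erase.2 ⟨hab, Finset.mem_univ _⟩)
      (by rw [Finset.card_singleton]; omega)
      (by rw [Finset.card_erase_of_mem (Finset.mem_univ _), Finset.card_univ, Fintype.card_fin]
          have := p.2
          omega)
    have haS : a ∈ S := hS1 (Finset.mem_singleton_self a)
    have hbS : b ∉ S := fun h => (Finset.mem_erase.1 (hS2 h)).1 rfl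
    have hne : ∀ s : Fin n, ((s : ℕ) : ℂ) + 1 ≠ 0 := fun s => Nat.cast_add_one_ne_zero _
    refine ⟨S, fun s => if s = a ∨ s = b then 0 else ((s : ℕ) : ℂ) + 1, hS3, ?_, fun _ => ?_⟩
    · intro s t hst h
      dsimp only at h
      split_ifs at h with h1 h2 h2
      · rcases h1 with rfl | rfl <;> rcases h2 with rfl | rfl
        · rfl
        · exact absurd (hst.1 haS) hbS
        · exact absurd (hst.2 haS) hbS
        · rfl
      · exact absurd h.symm (hne t)
      · exact absurd h (hne s)
      · exact hinj h
    · simp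

/-- Families whose member at a block of size `p` has degree less than `β p`. -/
def boundFam (n : ℕ) (β : ℕ → ℕ) : Submodule ℂ (Fam n) where
  carrier := {u | ∀ I : Finset (Fin n), u I ∈ degLT n (β I.card)}
  zero_mem' := fun _ => zero_mem _
  add_mem' := fun hu hv I => add_mem (hu I) (hv I)
  smul_mem' := fun c _ hu I => Submodule.smul_mem _ c (hu I)

lemma boundFam_mono {β β' : ℕ → ℕ} (h : ∀ p ≤ n, β p ≤ β' p) : boundFam n β ≤ boundFam n β' :=
  fun _ hu I => degLT_mono (h _ (card_le_fin I)) (hu I)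

lemma famAct_mem_boundFam {β : ℕ → ℕ} {u : Fam n} (hu : u ∈ boundFam n β)
    (α : Equiv.Perm (Fin n)) : famAct α u ∈ boundFam n β := fun I => by
  have h := rename_mem_degLT α (hu (I.map (α⁻¹).toEmbedding))
  rwa [Finset.card_map] at h

lemma exists_mem_boundFam (u : Fam n) : ∃ D, u ∈ boundFam n fun _ => D := by
  choose d hd using fun I => exists_mem_degLT (u I)
  exact ⟨Finset.univ.sup d, fun I => degLT_mono (Finset.le_sup (Finset.mem_univ I)) (hd I)⟩

lemma exists_QGE_eq (hn : 0 < n) (p : ℕ) :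
    ∃ D₀, ∀ D, D₀ ≤ D → QGE n p ≤ (famGE n p ⊓ boundFam n fun _ => D).map (qF n) := by
  have := finiteDimensional_Rn hn
  obtain ⟨s, hs⟩ := (IsNoetherian.noetherian (QGE n p) : (QGE n p).FG)
  have hex : ∀ x : s, ∃ u ∈ famGE n p, qF n u = x := fun x => by
    have : (x : Rn n) ∈ QGE n p := hs ▸ Submodule.subset_span x.2
    exact this
  choose u hu hux using hex
  choose d hd using fun x => exists_mem_boundFam (u x)
  refine ⟨Finset.univ.sup d, fun D hD => ?_⟩
  rw [← hs, Submodule.span_le]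
  intro x hx
  refine ⟨u ⟨x, hx⟩, ⟨hu _, ?_⟩, hux _⟩
  exact boundFam_mono (fun _ _ => (Finset.le_sup (Finset.mem_univ _)).trans hD) (hd _)

lemma exists_QGE_eq_all (hn : 0 < n) :
    ∃ D, ∀ p ≤ n, QGE n p ≤ (famGE n p ⊓ boundFam n fun _ => D).map (qF n) := by
  choose d hd using exists_QGE_eq hn
  exact ⟨(Finset.range (n + 1)).sup d, fun p hp =>
    hd p _ (Finset.le_sup (Finset.mem_range.2 (by omega)))⟩

/-- The degree bounds of the `s`-th step of the filtration of `Fam n`. -/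
def stepBound (n D s p : ℕ) : ℕ := min D (s - (n - p) * D)

lemma stepBound_mono (D s p : ℕ) : stepBound n D s p ≤ stepBound n D (s + 1) p := by
  unfold stepBound
  omega

lemma stepBound_zero (D p : ℕ) : stepBound n D 0 p = 0 := by
  simp [stepBound]

lemma stepBound_of_le {D s p : ℕ} (h : (n - p + 1) * D ≤ s) : stepBound n D s p = D := by
  rw [add_mul, one_mul] at h
  unfold stepBound
  omega

lemma stepBound_of_ge {D s p : ℕ} (h : s ≤ (n - p) * D) : stepBound n D s p = 0 := by
  unfold stepBound
  omega

/-- Dichotomy for a step of the filtration: the bounds do not change, or there is exactly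
one block size whose bound grows, the larger block sizes being full and the smaller ones empty. -/
lemma stepBound_cases (n D s : ℕ) :
    (∀ p ≤ n, stepBound n D (s + 1) p = stepBound n D s p) ∨
    ∃ p ≤ n, ∃ d, stepBound n D s p = d ∧ stepBound n D (s + 1) p = d + 1 ∧
      (∀ j ≤ n, p < j → stepBound n D s j = D) ∧ (∀ j < p, stepBound n D (s + 1) j = 0) := by
  by_cases hs : (n + 1) * D ≤ s
  · left
    intro p hp
    have h : (n - p + 1) * D ≤ s := (Nat.mul_le_mul_right D (by omega)).trans hs
    rw [stepBound_of_le h, stepBound_of_le (h.trans (Nat.le_succ s))]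
  · right
    have hD : 0 < D := by
      rcases Nat.eq_zero_or_pos D with h | h
      · subst h; simp at hs
      · exact h
    have hk : s / D < n + 1 := by
      rw [Nat.div_lt_iff_lt_mul hD]; omega
    have h1 := Nat.div_add_mod' s D
    have h2 := Nat.mod_lt s hD
    generalize s / D = k at hk h1
    generalize s % D = r at h1 h2
    refine ⟨n - k, by omega, r, ?_, ?_, fun j hj hpj => ?_, fun j hj => ?_⟩
    · rw [stepBound, show n - (n - k) = k by omega]
      omega
    · rw [stepBound, show n - (n - k) = k by omega]
      omega
    · exact stepBound_of_le ((Nat.mul_le_mul_right D (show n - j + 1 ≤ k by omega)).trans (by omega))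
    · refine stepBound_of_ge (le_trans ?_ (Nat.mul_le_mul_right D (?_ : k + 1 ≤ n - j)))
      · rw [add_mul, one_mul]; omega
      · omega

/-- The target of the evaluation of families at a block size. -/
def blockTarget (a b : Fin n) (p : Fin n) : Submodule ℂ (Equiv.Perm (Fin n) → ℂ) :=
  if (p : ℕ) = 0 then ⊤ else antiSub (rsw a b)

/-- Evaluation of families at the block size `p`, antisymmetrized if `p` is positive. -/
def evBlock (S : Fin n → Finset (Fin n)) (c : Fin n → Fin n → ℂ) (a b : Fin n) (p : Fin n) :
    Fam n →ₗ[ℂ] (Equiv.Perm (Fin n) → ℂ) :=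
  if (p : ℕ) = 0 then evf (S p) (c p)
  else (LinearMap.id - LinearMap.funLeft ℂ ℂ (rsw a b)).comp (evf (S p) (c p))

lemma evBlock_zero (S : Fin n → Finset (Fin n)) (c : Fin n → Fin n → ℂ) (a b : Fin n) {p : Fin n}
    (hp : (p : ℕ) = 0) (u : Fam n) : evBlock S c a b p u = evf (S p) (c p) u := by
  rw [evBlock, if_pos hp]

lemma evBlock_apply (S : Fin n → Finset (Fin n)) (c : Fin n → Fin n → ℂ) (a b : Fin n) {p : Fin n}
    (hp : (p : ℕ) ≠ 0) (u : Fam n) (σ : Equiv.Perm (Fin n)) :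
    evBlock S c a b p u σ = evf (S p) (c p) u σ - evf (S p) (c p) u (rsw a b σ) := by
  rw [evBlock, if_neg hp]
  rfl

lemma evBlock_mem (S : Fin n → Finset (Fin n)) (c : Fin n → Fin n → ℂ) (a b : Fin n) (p : Fin n)
    (u : Fam n) : evBlock S c a b p u ∈ blockTarget a b p := by
  by_cases hp : (p : ℕ) = 0
  · rw [blockTarget, if_pos hp]
    exact Submodule.mem_top
  · rw [blockTarget, if_neg hp, mem_antiSub]
    intro σ
    rw [evBlock_apply S c a b hp, evBlock_apply S c a b hp, rsw_rsw]
    ring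

lemma rsw_mul (a b : Fin n) (α σ : Equiv.Perm (Fin n)) : rsw a b (α * σ) = α * rsw a b σ :=
  mul_assoc _ _ _

lemma evBlock_famAct (S : Fin n → Finset (Fin n)) (c : Fin n → Fin n → ℂ) (a b : Fin n)
    (p : Fin n) (α : Equiv.Perm (Fin n)) (u : Fam n) (σ : Equiv.Perm (Fin n)) :
    evBlock S c a b p (famAct α u) σ = evBlock S c a b p u (α⁻¹ * σ) := by
  by_cases hp : (p : ℕ) = 0
  · rw [evBlock_zero S c a b hp, evBlock_zero S c a b hp, evf_famAct]
  · rw [evBlock_apply S c a b hp, evBlock_apply S c a b hp, evf_famAct, evf_famAct, rsw_mul]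

lemma mul_mem_blockTarget {a b p : Fin n} {f : Equiv.Perm (Fin n) → ℂ} (hf : f ∈ blockTarget a b p)
    (α : Equiv.Perm (Fin n)) : (fun σ => f (α * σ)) ∈ blockTarget a b p := by
  by_cases hp : (p : ℕ) = 0
  · rw [blockTarget, if_pos hp]
    exact Submodule.mem_top
  · rw [blockTarget, if_neg hp, mem_antiSub] at hf ⊢
    intro σ
    rw [← rsw_mul]
    exact hf _

lemma exists_lower_of_evBlock {S : Fin n → Finset (Fin n)} {c : Fin n → Fin n → ℂ} {a b : Fin n}
    (hab : a ≠ b) (hS : ∀ p, (S p).card = p) (hc : ∀ p, SepOn (S p) (c p))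
    (h0 : ∀ p : Fin n, (p : ℕ) ≠ 0 → c p a = 0 ∧ c p b = 0) (p : Fin n) {d : ℕ} {u : Fam n}
    (hu : u ∈ famGE n p) (hd : ∀ I, I.card = (p : ℕ) → u I ∈ degLT n (d + 1))
    (he : evBlock S c a b p u = 0) :
    ∃ v ∈ famGE n p, (∀ I, I.card = (p : ℕ) → v I ∈ degLT n d) ∧
      qF n u - qF n v ∈ QGE n (p + 1) := by
  rw [← hS p] at hu
  have hd' : ∀ I, I.card = (S p).card → u I ∈ degLT n (d + 1) := by rwa [hS p]
  have key : ∃ v ∈ famGE n (S p).card, (∀ I, I.card = (S p).card → v I ∈ degLT n d) ∧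
      qF n u - qF n v ∈ QGE n ((S p).card + 1) := by
    by_cases hp : (p : ℕ) = 0
    · rw [evBlock_zero S c a b hp] at he
      exact exists_lower_of_evf_eq_zero (hc p) hu hd' he
    · refine exists_lower_of_evf_symm (hc p) (by rw [hS p]; omega) (by rw [hS p]; exact p.2) hab
        (h0 p hp).1 (h0 p hp).2 hu hd' ?_
      rw [mem_symSub]
      intro σ
      have := congrFun he σ
      rw [evBlock_apply S c a b hp, Pi.zero_apply, sub_eq_zero] at this
      exact this.symm
  rwa [hS p] at key

/-- One step of the comparison of the filtrations. -/
lemma qF_mem_of_evBlock_eq_zero (hn : 0 < n) {S : Fin n → Finset (Fin n)}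
    {c : Fin n → Fin n → ℂ} {a b : Fin n}
    (hab : a ≠ b) (hS : ∀ p, (S p).card = p) (hc : ∀ p, SepOn (S p) (c p))
    (h0 : ∀ p : Fin n, (p : ℕ) ≠ 0 → c p a = 0 ∧ c p b = 0) {D : ℕ}
    (hD : ∀ p ≤ n, QGE n p ≤ (famGE n p ⊓ boundFam n fun _ => D).map (qF n)) (s : ℕ) {u : Fam n}
    (hu : u ∈ boundFam n (stepBound n D (s + 1))) (he : ∀ p, evBlock S c a b p u = 0) :
    qF n u ∈ (boundFam n (stepBound n D s)).map (qF n) := by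
  rcases stepBound_cases n D s with h | ⟨p, hp, d, h1, h2, h3, h4⟩
  · exact ⟨u, boundFam_mono (fun p hp => (h p hp).le) hu, rfl⟩
  have hu' : u ∈ famGE n p := fun I hI => by
    have := hu I
    rw [h4 _ hI] at this
    exact eq_zero_of_mem_degLT_zero this
  rcases hp.eq_or_lt with rfl | hpn
  · have : qF p u ∈ QGE p p := ⟨u, hu', rfl⟩
    rw [QGE_top hn, Submodule.mem_bot] at this
    rw [this]
    exact zero_mem _
  · obtain ⟨v, hv, hvd, hq⟩ := exists_lower_of_evBlock hab hS hc h0 ⟨p, hpn⟩ (d := d) hu'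
      (fun I hI => by
        have := hu I
        rwa [hI, h2] at this) (he _)
    let v0 : Fam n := fun I => if I.card = p then v I else 0
    have hvv : v - v0 ∈ famGE n (p + 1) := fun I hI => by
      rw [Pi.sub_apply]
      by_cases hIp : I.card = p
      · simp only [v0, if_pos hIp, sub_self]
      · simp only [v0, if_neg hIp, sub_zero]
        exact hv I (by change I.card < p; omega)
    have hq' : qF n u - qF n v0 ∈ QGE n (p + 1) := by
      have h5 : qF n (v - v0) ∈ QGE n (p + 1) := ⟨_, hvv, rfl⟩
      rw [map_sub] at h5
      have h6 := add_mem hq h5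
      rwa [sub_add_sub_cancel] at h6
    obtain ⟨w, ⟨hw1, hw2⟩, hw⟩ := hD (p + 1) hpn hq'
    refine ⟨v0 + w, fun I => add_mem ?_ ?_, ?_⟩
    · by_cases hIp : I.card = p
      · simp only [v0, if_pos hIp]
        rw [hIp, h1]
        exact hvd I hIp
      · simp only [v0, if_neg hIp]
        exact zero_mem _
    · by_cases hIp : I.card < p + 1
      · rw [hw1 I hIp]
        exact zero_mem _
      · rw [h3 _ (card_le_fin I) (by omega)]
        exact hw2 I
    · rw [map_add, hw, add_sub_cancel]

lemma boundFam_stepBound_zero (D : ℕ) : boundFam n (stepBound n D 0) = ⊥ := by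
  rw [eq_bot_iff]
  intro u hu
  rw [Submodule.mem_bot]
  funext I
  have := hu I
  rw [stepBound_zero] at this
  exact eq_zero_of_mem_degLT_zero this

lemma map_boundFam_stepBound_top {D : ℕ}
    (hD : ∀ p ≤ n, QGE n p ≤ (famGE n p ⊓ boundFam n fun _ => D).map (qF n)) :
    (boundFam n (stepBound n D ((n + 1) * D))).map (qF n) = ⊤ := by
  rw [eq_top_iff]
  intro x _
  obtain ⟨u, rfl⟩ := qF_surjective x
  obtain ⟨v, ⟨-, hv⟩, hvu⟩ := hD 0 (Nat.zero_le n)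
    (show qF n u ∈ QGE n 0 from ⟨u, fun I hI => absurd hI (Nat.not_lt_zero _), rfl⟩)
  refine ⟨v, boundFam_mono (fun p hp => ?_) hv, hvu⟩
  rw [stepBound_of_le (Nat.mul_le_mul_right D (by omega))]

end Filtration

section Invariants

open Module

variable {n : ℕ}

lemma finrank_fun_eq (ι X : Type) [Fintype ι] [AddCommGroup X] [Module ℂ X]
    [FiniteDimensional ℂ X] : finrank ℂ (ι → X) = Fintype.card ι * finrank ℂ X := by
  rw [Module.finrank_pi_fintype, Finset.sum_const, Finset.card_univ, smul_eq_mul]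

lemma sum_fin_ite (hn : 0 < n) (A B : ℕ) :
    ∑ p : Fin n, (if (p : ℕ) = 0 then A else B) = A + (n - 1) * B := by
  obtain ⟨m, rfl⟩ : ∃ m, n = m + 1 := ⟨n - 1, by omega⟩
  rw [Fin.sum_univ_succ]
  simp

/-- Tensors indexed by maps `Fin n → Fin (r + 1)` with values in `X`, with `σ` acting on the
indices and by `f` on the values. -/
def diagAct {X : Type} [AddCommGroup X] [Module ℂ X] (r : ℕ) (σ : Equiv.Perm (Fin n))
    (f : X →ₗ[ℂ] X) : ((Fin n → Fin (r + 1)) → X) →ₗ[ℂ] ((Fin n → Fin (r + 1)) → X) where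
  toFun F := fun φ => f (F (φ ∘ ⇑σ))
  map_add' F G := by funext φ; simp
  map_smul' c F := by funext φ; simp

lemma diagAct_apply {X : Type} [AddCommGroup X] [Module ℂ X] (r : ℕ) (σ : Equiv.Perm (Fin n))
    (f : X →ₗ[ℂ] X) (F : (Fin n → Fin (r + 1)) → X) (φ : Fin n → Fin (r + 1)) :
    diagAct r σ f F φ = f (F (φ ∘ ⇑σ)) := rfl

lemma diagAct_mul {X : Type} [AddCommGroup X] [Module ℂ X] (r : ℕ)
    {f : Equiv.Perm (Fin n) → X →ₗ[ℂ] X} (hf : ∀ g h x, f (g * h) x = f g (f h x))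
    (g h : Equiv.Perm (Fin n)) (F : (Fin n → Fin (r + 1)) → X) :
    diagAct r (g * h) (f (g * h)) F = diagAct r g (f g) (diagAct r h (f h) F) := by
  funext φ
  exact hf g h _

/-- The pointwise extension of a linear map. -/
def pointwise {X Y : Type} [AddCommGroup X] [Module ℂ X] [AddCommGroup Y] [Module ℂ Y] (ι : Type)
    (f : X →ₗ[ℂ] Y) : (ι → X) →ₗ[ℂ] (ι → Y) :=
  f.compLeft ι

lemma map_pointwise {X Y : Type} [AddCommGroup X] [Module ℂ X] [AddCommGroup Y] [Module ℂ Y]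
    {ι : Type} (f : X →ₗ[ℂ] Y) (A : Submodule ℂ X) {y : ι → Y} :
    y ∈ (Submodule.pi Set.univ fun _ : ι => A).map (pointwise ι f) ↔ ∀ i, y i ∈ A.map f := by
  constructor
  · rintro ⟨x, hx, rfl⟩ i
    exact ⟨x i, hx i (Set.mem_univ i), rfl⟩
  · intro h
    choose x hx hxy using h
    exact ⟨x, fun i _ => hx i, funext hxy⟩

/-- Left translation of functions on the symmetric group. -/
def translateL (α : Equiv.Perm (Fin n)) :
    (Fin n → Equiv.Perm (Fin n) → ℂ) →ₗ[ℂ] (Fin n → Equiv.Perm (Fin n) → ℂ) where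
  toFun t := fun p σ => t p (α⁻¹ * σ)
  map_add' _ _ := rfl
  map_smul' _ _ := rfl

lemma translateL_apply (α : Equiv.Perm (Fin n)) (t : Fin n → Equiv.Perm (Fin n) → ℂ) (p : Fin n)
    (σ : Equiv.Perm (Fin n)) : translateL α t p σ = t p (α⁻¹ * σ) := rfl

lemma translateL_mul (α β : Equiv.Perm (Fin n)) (t : Fin n → Equiv.Perm (Fin n) → ℂ) :
    translateL (α * β) t = translateL α (translateL β t) := by
  funext p σ
  simp only [translateL_apply, mul_inv_rev, mul_assoc]

/-- Tensors with values in the targets of the evaluation maps. -/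
def targetIncl (r : ℕ) (a b : Fin n) :
    ((Fin n → Fin (r + 1)) → ∀ p : Fin n, blockTarget a b p) →ₗ[ℂ]
      ((Fin n → Fin (r + 1)) → Fin n → Equiv.Perm (Fin n) → ℂ) where
  toFun w := fun φ p => w φ p
  map_add' _ _ := rfl
  map_smul' _ _ := rfl

lemma mem_range_targetIncl {r : ℕ} {a b : Fin n}
    {w : (Fin n → Fin (r + 1)) → Fin n → Equiv.Perm (Fin n) → ℂ} :
    w ∈ LinearMap.range (targetIncl r a b) ↔ ∀ φ p, w φ p ∈ blockTarget a b p := by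
  constructor
  · rintro ⟨v, rfl⟩ φ p
    exact (v φ p).2
  · exact fun h => ⟨fun φ p => ⟨w φ p, h φ p⟩, rfl⟩

/-- Tensors in `V^{⊗n}`, antisymmetric in the factors `a` and `b` if `p` is positive. -/
def tensorTarget (r : ℕ) (a b : Fin n) (p : Fin n) : Submodule ℂ ((Fin n → Fin (r + 1)) → ℂ) :=
  if (p : ℕ) = 0 then ⊤ else antiSub fun φ => φ ∘ ⇑(Equiv.swap a b)

lemma mem_tensorTarget {r : ℕ} {a b p : Fin n} (hp : (p : ℕ) ≠ 0)
    {f : (Fin n → Fin (r + 1)) → ℂ} :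
    f ∈ tensorTarget r a b p ↔ ∀ φ, f (φ ∘ ⇑(Equiv.swap a b)) = -f φ := by
  rw [tensorTarget, if_neg hp]
  exact mem_antiSub

/-- The invariant tensor determined by its values at the identity permutation. -/
def invIncl (r : ℕ) (a b : Fin n) : (∀ p : Fin n, tensorTarget r a b p) →ₗ[ℂ]
    ((Fin n → Fin (r + 1)) → Fin n → Equiv.Perm (Fin n) → ℂ) where
  toFun γ := fun φ p σ => (γ p : (Fin n → Fin (r + 1)) → ℂ) (φ ∘ ⇑σ)
  map_add' _ _ := rfl
  map_smul' _ _ := rfl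

lemma invIncl_apply {r : ℕ} {a b : Fin n} (γ : ∀ p : Fin n, tensorTarget r a b p)
    (φ : Fin n → Fin (r + 1)) (p : Fin n) (σ : Equiv.Perm (Fin n)) :
    invIncl r a b γ φ p σ = (γ p : (Fin n → Fin (r + 1)) → ℂ) (φ ∘ ⇑σ) := rfl

lemma invIncl_injective (r : ℕ) (a b : Fin n) : Function.Injective (invIncl r a b) := by
  intro γ γ' h
  funext p
  refine Subtype.ext (funext fun φ => ?_)
  exact congrFun (congrFun (congrFun h φ) p) 1

lemma mem_range_invIncl {r : ℕ} {a b : Fin n}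
    {w : (Fin n → Fin (r + 1)) → Fin n → Equiv.Perm (Fin n) → ℂ} :
    w ∈ LinearMap.range (invIncl r a b) ↔ w ∈ LinearMap.range (targetIncl r a b) ∧
      ∀ α, diagAct r α (translateL α) w = w := by
  rw [mem_range_targetIncl]
  constructor
  · rintro ⟨γ, rfl⟩
    refine ⟨fun φ p => ?_, fun α => ?_⟩
    · have hγ := (γ p).2
      by_cases hp : (p : ℕ) = 0
      · rw [blockTarget, if_pos hp]
        exact Submodule.mem_top
      · rw [mem_tensorTarget hp] at hγ
        rw [blockTarget, if_neg hp, mem_antiSub]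
        exact fun σ => hγ (φ ∘ ⇑σ)
    · funext φ p σ
      rw [diagAct_apply, translateL_apply, invIncl_apply, invIncl_apply]
      have : (φ ∘ ⇑α) ∘ ⇑(α⁻¹ * σ) = φ ∘ ⇑σ := by
        funext i
        change φ ((α * (α⁻¹ * σ)) i) = φ (σ i)
        rw [mul_inv_cancel_left]
      rw [this]
  · rintro ⟨h1, h2⟩
    have h3 : ∀ φ p (σ : Equiv.Perm (Fin n)), w (φ ∘ ⇑σ) p 1 = w φ p σ := fun φ p σ => by
      have := congrFun (congrFun (congrFun (h2 σ) φ) p) σ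
      rwa [diagAct_apply, translateL_apply, inv_mul_cancel] at this
    refine ⟨fun p => ⟨fun φ => w φ p 1, ?_⟩, ?_⟩
    · by_cases hp : (p : ℕ) = 0
      · rw [tensorTarget, if_pos hp]
        exact Submodule.mem_top
      · rw [mem_tensorTarget hp]
        intro φ
        have h4 := h1 φ p
        rw [blockTarget, if_neg hp, mem_antiSub] at h4
        rw [h3, ← h4 1, rsw, one_mul]
    · funext φ p σ
      exact h3 φ p σ

lemma card_swap_fixed (r : ℕ) {a b : Fin n} (hab : a ≠ b) :
    (Finset.univ.filter fun φ : Fin n → Fin (r + 1) => φ ∘ ⇑(Equiv.swap a b) = φ).card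
      = (r + 1) ^ (n - 1) := by
  have hfix : ∀ φ : Fin n → Fin (r + 1), φ ∘ ⇑(Equiv.swap a b) = φ ↔ φ a = φ b := by
    intro φ
    constructor
    · intro h
      have := congrFun h b
      rwa [Function.comp_apply, Equiv.swap_apply_right] at this
    · intro h
      funext i
      rw [Function.comp_apply]
      by_cases hia : i = a
      · rw [hia, Equiv.swap_apply_left, h]
      · by_cases hib : i = b
        · rw [hib, Equiv.swap_apply_right, h]
        · rw [Equiv.swap_apply_of_ne_of_ne hia hib]
  have e : {φ : Fin n → Fin (r + 1) // φ ∘ ⇑(Equiv.swap a b) = φ} ≃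
      ({i : Fin n // i ≠ b} → Fin (r + 1)) :=
    { toFun := fun φ i => φ.1 i
      invFun := fun g => ⟨fun i => if h : i ≠ b then g ⟨i, h⟩ else g ⟨a, hab⟩, by
        rw [hfix]
        simp [hab]⟩
      left_inv := fun φ => by
        refine Subtype.ext (funext fun i => ?_)
        by_cases h : i = b
        · subst h
          simpa using (hfix _).1 φ.2
        · simp [h]
      right_inv := fun g => by
        funext i
        simp [i.2] }
  rw [← Fintype.card_subtype, Fintype.card_congr e, Fintype.card_fun, Fintype.card_fin,
    Fintype.card_subtype_compl, Fintype.card_subtype_eq, Fintype.card_fin]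

lemma two_mul_finrank_antiSub_comp_swap (r : ℕ) {a b : Fin n} (hab : a ≠ b) :
    2 * finrank ℂ (antiSub fun φ : Fin n → Fin (r + 1) => φ ∘ ⇑(Equiv.swap a b))
      + (r + 1) ^ (n - 1) = (r + 1) ^ n := by
  have ht : ∀ φ : Fin n → Fin (r + 1), (φ ∘ ⇑(Equiv.swap a b)) ∘ ⇑(Equiv.swap a b) = φ :=
    fun φ => by
      funext i
      simp
  have h1 : ∀ φ : Fin n → Fin (r + 1), φ a < φ b →
      ¬ (φ ∘ ⇑(Equiv.swap a b)) a < (φ ∘ ⇑(Equiv.swap a b)) b := fun φ h => by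
    simpa using h.le
  have h2 : ∀ φ : Fin n → Fin (r + 1), ¬ φ a < φ b →
      ¬ (φ ∘ ⇑(Equiv.swap a b)) a < (φ ∘ ⇑(Equiv.swap a b)) b →
      φ ∘ ⇑(Equiv.swap a b) = φ := fun φ h h' => by
    simp only [Function.comp_apply, Equiv.swap_apply_left, Equiv.swap_apply_right, not_lt] at h h'
    have hφ := le_antisymm h' h
    funext i
    rw [Function.comp_apply]
    by_cases hia : i = a
    · rw [hia, Equiv.swap_apply_left, hφ]
    · by_cases hib : i = b
      · rw [hib, Equiv.swap_apply_right, hφ]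
      · rw [Equiv.swap_apply_of_ne_of_ne hia hib]
  have h3 := two_mul_card_filter_add (α := Fin n → Fin (r + 1))
    (t := fun φ => φ ∘ ⇑(Equiv.swap a b)) ht (fun φ => φ a < φ b) h1 h2
  rw [card_swap_fixed r hab, Fintype.card_fun, Fintype.card_fin, Fintype.card_fin] at h3
  rw [finrank_antiSub ht (fun φ => φ a < φ b) h1 h2]
  exact h3

lemma finrank_range_invIncl (hn : 0 < n) (r : ℕ) (a b : Fin n) :
    finrank ℂ (LinearMap.range (invIncl r a b)) = (r + 1) ^ n + (n - 1) *
      finrank ℂ (antiSub fun φ : Fin n → Fin (r + 1) => φ ∘ ⇑(Equiv.swap a b)) := by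
  rw [LinearMap.finrank_range_of_inj (invIncl_injective r a b), Module.finrank_pi_fintype,
    ← sum_fin_ite hn]
  refine Finset.sum_congr rfl fun p _ => ?_
  split_ifs with hp
  · rw [tensorTarget, if_pos hp, finrank_top, Module.finrank_fintype_fun_eq_card, Fintype.card_fun,
      Fintype.card_fin, Fintype.card_fin]
  · rw [tensorTarget, if_neg hp]

lemma finrank_range_targetIncl_le (hn : 0 < n) (r : ℕ) {a b : Fin n} (hab : a ≠ b) :
    finrank ℂ (LinearMap.range (targetIncl r a b)) ≤
      finrank ℂ ((Fin n → Fin (r + 1)) → Rn n) := by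
  have := finiteDimensional_Rn hn
  refine (LinearMap.finrank_range_le _).trans ?_
  rw [finrank_fun_eq, finrank_fun_eq _ (Rn n)]
  refine Nat.mul_le_mul_left _ ((?_ : _ ≤ (AAll n).card).trans card_AAll_le_finrank)
  have h1 : finrank ℂ (∀ p : Fin n, blockTarget a b p)
      = n.factorial + (n - 1) * finrank ℂ (antiSub (rsw a b)) := by
    rw [Module.finrank_pi_fintype, ← sum_fin_ite hn]
    refine Finset.sum_congr rfl fun p _ => ?_
    split_ifs with hp
    · rw [blockTarget, if_pos hp, finrank_top, Module.finrank_fintype_fun_eq_card,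
        Fintype.card_perm, Fintype.card_fin]
    · rw [blockTarget, if_neg hp]
  have h2 := two_mul_finrank_antiSub_rsw hab
  have h3 := two_mul_card_AAll hn
  have h4 : 2 * ((n - 1) * finrank ℂ (antiSub (rsw a b))) = (n - 1) * n.factorial := by
    rw [← h2]; ring
  omega

lemma permR_mul_apply (g h : Equiv.Perm (Fin n)) (x : Rn n) :
    permR n (g * h) x = permR n g (permR n h x) := by
  obtain ⟨f, rfl⟩ := kap_surjective x
  rw [permR_kap, permR_kap, permR_kap, pact_mul]

lemma finrank_InvSub (r : ℕ) (hn : 0 < n) {a b : Fin n} (hab : a ≠ b) :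
    finrank ℂ (InvSub r n) = finrank ℂ (LinearMap.range (invIncl r a b)) := by
  have := finiteDimensional_Rn hn
  choose S c hS hc h0 using exists_slots hab
  obtain ⟨D, hD⟩ := exists_QGE_eq_all hn
  refine finrank_invariants_eq (G := Equiv.Perm (Fin n))
    (pointwise (Fin n → Fin (r + 1)) (qF n))
    (pointwise (Fin n → Fin (r + 1)) (LinearMap.pi fun p => evBlock S c a b p))
    (fun s => Submodule.pi Set.univ fun _ => boundFam n (stepBound n D s))
    (fun s u hu φ _ => boundFam_mono (fun p _ => stepBound_mono D s p) (hu φ (Set.mem_univ φ)))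
    ?_ ?_ (m := (n + 1) * D) ?_ (W := LinearMap.range (targetIncl r a b)) ?_
    (fun α => diagAct r α (famAct α)) (fun α => diagAct r α (permR n α).toLinearMap)
    (fun α => diagAct r α (translateL α)) (diagAct_mul r ?_)
    (diagAct_mul (f := fun α => (permR n α).toLinearMap) r ?_)
    (diagAct_mul r translateL_mul) ?_ ?_ ?_ ?_ (finrank_range_targetIncl_le hn r hab) ?_
    fun x => mem_range_invIncl
  · rw [eq_bot_iff]
    intro u hu
    funext φ
    have := hu φ (Set.mem_univ φ)
    rwa [boundFam_stepBound_zero] at this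
  · intro s u hu he
    rw [map_pointwise] at he ⊢
    intro φ
    obtain ⟨v, hv, hvu⟩ := he φ
    have hvs : v ∈ boundFam n (stepBound n D (s + 1)) :=
      boundFam_mono (fun p _ => stepBound_mono D s p) hv
    have h1 := qF_mem_of_evBlock_eq_zero hn hab hS hc h0 hD s (u := u φ - v)
      (sub_mem (hu φ (Set.mem_univ φ)) hvs) (fun p => by
        rw [map_sub, sub_eq_zero]
        exact (congrFun hvu p).symm)
    rw [map_sub] at h1
    have h2 := add_mem h1 (Submodule.mem_map_of_mem (f := qF n) hv)
    rwa [sub_add_cancel] at h2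
  · rw [eq_top_iff]
    intro y _
    rw [map_pointwise]
    intro φ
    rw [map_boundFam_stepBound_top hD]
    exact Submodule.mem_top
  · intro u
    rw [mem_range_targetIncl]
    exact fun φ p => evBlock_mem S c a b p _
  · intro g h x
    funext I
    rw [famAct_apply, famAct_apply, famAct_apply, rename_rename, map_mul_toEmbedding, mul_inv_rev]
    rfl
  · exact permR_mul_apply
  · intro α u
    funext φ
    exact qF_famAct α _
  · intro α u
    funext φ p σ
    exact evBlock_famAct S c a b p α _ σ
  · exact fun s α u hu φ _ => famAct_mem_boundFam (hu _ (Set.mem_univ _)) α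
  · intro α w hw
    rw [mem_range_targetIncl] at hw ⊢
    exact fun φ p => mul_mem_blockTarget (hw _ p) _
  · intro x
    constructor
    · exact fun h σ => funext fun φ => h σ φ
    · exact fun h σ φ => congrFun (h σ) φ

end Invariants

/-- For `r ≥ 1`, `n ≥ 2`, the space of `Sₙ`-invariants
`(V^{⊗n} ⊗ Rₙ)^{Sₙ}` (with `V = ℂ^{r+1}`, `Sₙ` acting diagonally) has dimension
`(r+1)^{n−2}·((r+1)² + (n−1)(r+1)r/2)`. -/
theorem weyl_module_dimension (r n : ℕ) (hr : 1 ≤ r) (hn : 2 ≤ n) :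
    Module.finrank ℂ ↥(InvSub r n) =
      (r + 1) ^ (n - 2) * ((r + 1) ^ 2 + (n - 1) * ((r + 1) * r) / 2) := by
  have hn0 : 0 < n := by omega
  have hab : (⟨0, by omega⟩ : Fin n) ≠ ⟨1, by omega⟩ := by simp
  have h := two_mul_finrank_antiSub_comp_swap r hab
  rw [finrank_InvSub r hn0 hab, finrank_range_invIncl hn0]
  generalize Module.finrank ℂ (antiSub fun φ : Fin n → Fin (r + 1) =>
    φ ∘ ⇑(Equiv.swap (⟨0, by omega⟩ : Fin n) ⟨1, by omega⟩)) = K at h ⊢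
  obtain ⟨m, rfl⟩ : ∃ m, n = m + 2 := ⟨n - 2, by omega⟩
  obtain ⟨t, ht⟩ : ∃ t, (r + 1) * r = 2 * t := by
    rw [mul_comm]
    exact (Nat.even_mul_succ_self r).two_dvd
  have hK : K = (r + 1) ^ m * t := by
    simp only [show m + 2 - 1 = m + 1 by omega] at h
    refine Nat.eq_of_mul_eq_mul_left two_pos (Nat.add_right_cancel (h.trans ?_))
    have h2 : 2 * ((r + 1) ^ m * t) = (r + 1) ^ m * (2 * t) := by ring
    rw [h2, ← ht]
    ring
  rw [show (m + 2 - 1) * ((r + 1) * r) / 2 = (m + 1) * t by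
    rw [ht, show (m + 2 - 1) * (2 * t) = 2 * ((m + 1) * t) by
      rw [show m + 2 - 1 = m + 1 by omega]; ring, Nat.mul_div_cancel_left _ two_pos], hK]
  simp only [show m + 2 - 1 = m + 1 by omega, show m + 2 - 2 = m by omega]
  ring

end
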